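/- arXiv:1508.03052 — 2 statements merged into one kernel-verified Lean document; each statement's English description precedes it below -/
import Mathlib

section
/- Let G be a finite graph with σ = σ(G) ≥ 5 and σ ≥ Δ(G) + 2. Suppose every odd cycle of G has length at least g'_σ, where g'_5 = 9 and g'_σ = σ for σ > 5; every even cycle of G has length at least 6; and mad(G) < 2 + 2/(3ℓ_σ − 1), where ℓ_σ = 8 if σ = 5, ℓ_σ = 7 if σ ∈ {6,7}, and ℓ_σ = σ if σ ≥ 8. Then χ'_s(G) = σ. -/
open SimpleGraph

/-- The degree of a vertex (cardinality of its neighbor set). -/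
noncomputable def ndeg {V : Type*} (G : SimpleGraph V) (v : V) : ℕ :=
  (G.neighborSet v).ncard

/-- `σ(G)`: the maximum of `deg x + deg y - 1` over all edges `xy` of `G`. -/
noncomputable def sigmaG {V : Type*} (G : SimpleGraph V) : ℕ :=
  sSup {m | ∃ x y, G.Adj x y ∧ m = ndeg G x + ndeg G y - 1}

/-- The maximum degree `Δ(G)`. -/
noncomputable def maxDeg {V : Type*} (G : SimpleGraph V) : ℕ :=
  sSup (Set.range (ndeg G))

/-- Two edges are at distance at most two: they share an endpoint, or an endpoint of
one is adjacent to an endpoint of the other. -/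
def EdgesNear {V : Type*} (G : SimpleGraph V) (e f : Sym2 V) : Prop :=
  ∃ u v, u ∈ e ∧ v ∈ f ∧ (u = v ∨ G.Adj u v)

/-- A strong edge-coloring: every two distinct edges at distance at most two
receive different colors. -/
def IsStrongEdgeColoring {V α : Type*} (G : SimpleGraph V) (φ : Sym2 V → α) : Prop :=
  ∀ e ∈ G.edgeSet, ∀ f ∈ G.edgeSet, e ≠ f → EdgesNear G e f → φ e ≠ φ f

/-- The strong chromatic index `χ'ₛ(G)`: the least `k` such that `G` has a strong
edge-coloring with colors `0, …, k-1`. -/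
noncomputable def strongChromaticIndex {V : Type*} (G : SimpleGraph V) : ℕ :=
  sInf {k | ∃ φ : Sym2 V → ℕ, (∀ e ∈ G.edgeSet, φ e < k) ∧ IsStrongEdgeColoring G φ}

/-- The set of edges incident with a vertex `v`. -/
def Einc {V : Type*} (G : SimpleGraph V) (v : V) : Set (Sym2 V) :=
  {e ∈ G.edgeSet | v ∈ e}

/-- `ℓ_σ` from the refined key lemma: `ℓ_5 = 8`, `ℓ_6 = ℓ_7 = 7`, `ℓ_σ = σ` for `σ ≥ 8`. -/
def ellSigma (s : ℕ) : ℕ :=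
  if s = 5 then 8 else if s ≤ 7 then 7 else s

section partA
/-- Winning positions of the token game with `k` moves left. -/
def good (k w v t h H O : ℕ) : Prop :=
  match k with
  | 0 => t = 1 ∧ h = 2 ∧ v = 0
  | 1 => t = 0 ∧ h = 1 ∧ 1 ≤ v ∧ (w = 0 ∨ v = 1)
  | 2 => t = 1 ∧ h = 1 ∧ 1 ≤ w ∧ 1 ≤ v ∧ (w = 1 ∨ v = 1)
  | 3 => (t = 0 ∧ h = 1 ∧ 1 ≤ w ∧ 2 ≤ v ∧ (w = 1 ∨ v = 2)) ∨
      (t = 1 ∧ h = 2 ∧ 1 ≤ w ∧ 1 ≤ v ∧ (w = 1 ∨ v = 1))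
  | 4 => (t = 0 ∧ h = 0 ∧ 1 ≤ v ∧ (w = 0 ∨ v = 1)) ∨
      (t = 0 ∧ h = 1 ∧ 1 ≤ w ∧ 2 ≤ v ∧ (w = 1 ∨ v = 2)) ∨
      (t = 1 ∧ h = 0 ∧ 1 ≤ w ∧ 1 ≤ v ∧ (w = 1 ∨ v = 1)) ∨
      (t = 1 ∧ h = 1 ∧ 2 ≤ w ∧ 2 ≤ v ∧ (w = 2 ∨ v = 2))
  | 5 => (t = 0 ∧ h = 0 ∧ 1 ≤ v ∧ (w ≤ 1 ∨ v ≤ 2)) ∨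
      (t = 0 ∧ h = 1 ∧ 1 ≤ w ∧ 2 ≤ v ∧ (w ≤ 2 ∨ v ≤ 3) ∧ ¬ (O = 2 ∧ v = 2) ∧ ¬ (w = 1 ∧ v = O)) ∨
      (t = 1 ∧ h = 0 ∧ (w ≤ 1 ∨ v ≤ 1)) ∨
      (t = 1 ∧ h ≠ 0 ∧ 1 ≤ w ∧ 1 ≤ v ∧ (w ≤ 2 ∨ v ≤ 2))
  | k + 6 => if k % 2 = 0 then
        (t = 0 ∧ h = 0 ∧ (w < k / 2 + 2 ∨ v < k / 2 + 3)) ∨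
        (t = 0 ∧ h = 1 ∧ (w < k / 2 + 3 ∨ v < k / 2 + 4)) ∨
        (t = 1 ∧ h ≠ 1 ∧ (w < k / 2 + 3 ∨ v < k / 2 + 3)) ∨
        (t = 1 ∧ h = 1 ∧ (w < k / 2 + 4 ∨ v < k / 2 + 4) ∧
          (k = 0 → w ≠ 0 ∧ ¬ (w = H ∧ v = O ∧ (H = 2 ∨ O = 2))))
      else
        (t = 1 ∧ h = 0 ∧ (w < k / 2 + 3 ∨ v < k / 2 + 3)) ∨
        (t = 0 ∧ h = 0 ∧ (w < k / 2 + 3 ∨ v < k / 2 + 4)) ∨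
        (t = 0 ∧ h = 1 ∧ (w < k / 2 + 4 ∨ v < k / 2 + 5)) ∨
        (t = 1 ∧ h = 1 ∧ (w < k / 2 + 4 ∨ v < k / 2 + 4)) ∨
        (t = 1 ∧ h = 2 ∧ (w < k / 2 + 4 ∨ v < k / 2 + 4) ∧
          (k = 1 → ¬ (w = H ∧ v = O ∧ (H = 2 ∨ O = 2))))

/-- Consistency of a position. -/
structure okst (w v t h H O : ℕ) : Prop where
  ht : t ≤ 1
  hh : h ≤ 2
  h2 : h = 2 → t = 1
  h0 : h = 0 → w < H
  h1 : h = 1 → 1 ≤ v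
  hw : w ≤ H
  hv : v ≤ O
  hH : 2 ≤ H
  hO : 2 ≤ O
  d3 : 3 + w ≤ H + v + t
  d4 : v + t + 1 ≤ O + w

set_option maxHeartbeats 4000000 in
theorem tight (k w v t h H O : ℕ) (hok : okst w v t h H O) (hg : good (k + 2) w v t h H O) :
    (v < O ∧ good (k + 1) (if h = 1 then v - 1 else v) (if h = 0 then w + 1 else w)
      (if h = 2 then 1 else 1 - t) 0 O H) ∨
    (1 ≤ w ∧ good (k + 1) (if h = 1 then v - 1 else v) (if h = 0 then w + 1 else w)
      (if h = 2 then 1 else 1 - t) 1 O H) ∨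
    (t = 0 ∧ good (k + 1) (if h = 1 then v - 1 else v) (if h = 0 then w + 1 else w)
      (if h = 2 then 1 else 1 - t) 2 O H) := by
  obtain ⟨ht, hh, h2, h0, h1, hw, hv, hH, hO, d3, d4⟩ := hok
  have e2 : h = 0 ∨ h = 1 ∨ h = 2 := by omega
  have e1 : t = 0 ∨ t = 1 := by omega
  match k with
  | 0 | 1 | 2 | 3 | 4 => 
    rcases e1 with rfl | rfl <;> rcases e2 with rfl | rfl | rfl <;> 
     simp [good] at hg ⊢ <;> omega
  | k + 5 =>
    rcases Nat.mod_two_eq_zero_or_one k with hk | hk <;>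
    rcases e1 with rfl | rfl <;> rcases e2 with rfl | rfl | rfl <;> 
     simp [good, Nat.add_mod, hk] at hg ⊢ <;> omega

set_option maxHeartbeats 4000000 in
theorem drop1 (k w v t h H O o : ℕ) (hok : okst w v t h H O) (hg : good (k + 1) w v t h H O)
    (hd : 4 + w ≤ H + v + t) (ho : o ≤ 2)
    (ob : o = 0 → (if h = 0 then 2 else 1) + w ≤ H)
    (og : o = 1 → (if h = 1 then 2 else 1) ≤ v)
    (ot : o = 2 → t = 1 ∧ h ≠ 2)
    (hk : k ≤ 1 → o ≠ 1) :
    ((if h = 0 then 1 else 0) + (if o = 0 then 1 else 0) + w < H ∧ good (k + 1) (w + 1) v t h H O) ∨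
    ((if h = 1 then 1 else 0) + (if o = 1 then 1 else 0) < v ∧ good (k + 1) w (v - 1) t h H O) ∨
    (t = 1 ∧ h ≠ 2 ∧ o ≠ 2 ∧ good (k + 1) w v 0 h H O) := by
  obtain ⟨ht, hh, h2, h0, h1, hw, hv, hH, hO, d3, d4⟩ := hok
  have e2 : h = 0 ∨ h = 1 ∨ h = 2 := by omega
  have e1 : t = 0 ∨ t = 1 := by omega
  have e3 : o = 0 ∨ o = 1 ∨ o = 2 := by omega
  match k with
  | 0 | 1 | 2 | 3 | 4 => 
    rcases e1 with rfl | rfl <;> rcases e2 with rfl | rfl | rfl <;> rcases e3 with rfl | rfl | rfl <;> 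
     simp [good] at hg ob og ot hk h2 h0 h1 ⊢ <;> omega
  | k + 5 =>
    rcases Nat.mod_two_eq_zero_or_one k with hm | hm <;>
    rcases e1 with rfl | rfl <;> rcases e2 with rfl | rfl | rfl <;> rcases e3 with rfl | rfl | rfl <;> 
     simp [good, hm] at hg ob og ot h2 h0 h1 ⊢ <;> omega

end partA

section partB
open Finset

/-- The colour set is split as `H ∪ O ∪ {τ}`. -/
structure TPart (U H O : Finset ℕ) (τ : ℕ) : Prop where
  dis : ∀ x, x ∈ H → x ∉ O
  tH : τ ∉ H
  tO : τ ∉ O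
  un : ∀ x, x ∈ U ↔ x ∈ H ∨ x ∈ O ∨ x = τ
  cH : 2 ≤ #H
  cO : 2 ≤ #O

theorem TPart.swap {U H O τ} (h : TPart U H O τ) : TPart U O H τ :=
  ⟨fun x hx hy => h.dis x hy hx, h.tO, h.tH, fun x => by rw [h.un]; tauto, h.cO, h.cH⟩

theorem TPart.card {U H O τ} (h : TPart U H O τ) : #U = #H + #O + 1 := by
  have : U = insert τ (H ∪ O) := by ext x; simp [h.un]; tauto
  rw [this, card_insert_of_notMem (by simp [h.tH, h.tO]), card_union_of_disjoint]
  exact Finset.disjoint_left.2 h.dis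

theorem TPart.cardC {U H O τ} (h : TPart U H O τ) {C : Finset ℕ} (hC : C ⊆ U) :
    #C = #(H ∩ C) + #(O ∩ C) + (if τ ∈ C then 1 else 0) := by
  have : C = (H ∩ C) ∪ (O ∩ C) ∪ (if τ ∈ C then {τ} else ∅) := by
    ext x
    have := h.un x
    have h2 := @hC x
    by_cases hx : τ ∈ C
    · simp [hx]; grind
    · simp [hx]; grind
  have h1 : #C = #((H ∩ C) ∪ (O ∩ C) ∪ (if τ ∈ C then {τ} else ∅)) := by rw [← this]
  rw [h1, card_union_of_disjoint, card_union_of_disjoint]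
  · split_ifs <;> simp
  · rw [Finset.disjoint_left]; intro x; have := h.dis x; simp; tauto
  · rw [Finset.disjoint_left]; intro x; have := h.tH; have := h.tO; split_ifs <;> simp; grind

/-- Set-level version of `good`. -/
def gs (k : ℕ) (H O : Finset ℕ) (τ : ℕ) (C : Finset ℕ) (c : ℕ) : Prop :=
  good k #(H \ C) #(O ∩ C) (if τ ∈ C then 1 else 0) (if c ∈ H then 0 else if c ∈ O then 1 else 2)
    #H #O

theorem TPart.ok {U H O τ} (h : TPart U H O τ) {C : Finset ℕ} (hC : C ⊆ U) {c : ℕ} (hc : c ∈ C)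
    (h3 : 3 ≤ #C) (h4 : #C + 2 ≤ #U) :
    okst #(H \ C) #(O ∩ C) (if τ ∈ C then 1 else 0) (if c ∈ H then 0 else if c ∈ O then 1 else 2)
      #H #O := by
  have e1 := h.card
  have e2 := h.cardC hC
  have e3 := card_sdiff_add_card_inter H C
  have e4 : #(O ∩ C) ≤ #O := card_le_card inter_subset_left
  refine ⟨by split_ifs <;> simp, by split_ifs <;> simp, ?_, ?_, ?_, by omega, by omega, h.cH, h.cO,
    by omega, by omega⟩
  · have := (h.un c).1 (hC hc)
    grind
  · intro hh
    have : c ∈ H := by grind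
    have : 0 < #(H ∩ C) := card_pos.2 ⟨c, by simp [*]⟩
    omega
  · intro hh
    have : c ∈ O := by grind
    exact card_pos.2 ⟨c, by simp [*]⟩

theorem drop_set (k : ℕ) {U H O τ} (h : TPart U H O τ) {C : Finset ℕ} (hC : C ⊆ U) {c o : ℕ}
    (hc : c ∈ C) (ho : o ∈ C) (hco : o ≠ c) (h3 : 4 ≤ #C) (h4 : #C + 2 ≤ #U)
    (hk : k ≤ 1 → o ∉ O) (hg : gs (k + 1) H O τ C c) :
    ∃ x ∈ C, x ≠ o ∧ x ≠ c ∧ gs (k + 1) H O τ (C.erase x) c := by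
  have e1 := h.card
  have e2 := h.cardC hC
  have e3 := card_sdiff_add_card_inter H C
  have key := drop1 k _ _ _ _ _ _ (if o ∈ H then 0 else if o ∈ O then 1 else 2)
    (h.ok hC hc (by omega) h4) hg (by omega) (by split_ifs <;> simp) ?_ ?_ ?_ ?_
  · rcases key with ⟨k1, k2⟩ | ⟨k1, k2⟩ | ⟨k1, k2, k3, k4⟩
    · have : ∃ x ∈ H ∩ C, x ∉ ({c, o} : Finset ℕ) := by
        by_contra hcon
        push Not at hcon
        have hsub : H ∩ C ⊆ ({c, o} : Finset ℕ).filter (· ∈ H) := fun x hx => by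
          have := hcon x hx
          simp at hx ⊢
          simp at this
          tauto
        have := card_le_card hsub
        rw [card_filter, sum_pair hco.symm] at this
        grind
      obtain ⟨x, hx, hx2⟩ := this
      simp at hx hx2
      refine ⟨x, hx.2, hx2.2, hx2.1, ?_⟩
      unfold gs
      have a1 : #(H \ C.erase x) = #(H \ C) + 1 := by
        rw [sdiff_erase hx.1, card_insert_of_notMem (by simp [hx])]
      have a2 : O ∩ C.erase x = O ∩ C := by
        ext y; have := h.dis x hx.1; simp; grind
      have a3 : (τ ∈ C.erase x) ↔ τ ∈ C := by
        have := h.tH; simp; grind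
      simp only [a1, a2, a3]
      exact k2
    · have : ∃ x ∈ O ∩ C, x ∉ ({c, o} : Finset ℕ) := by
        by_contra hcon
        push Not at hcon
        have hsub : O ∩ C ⊆ ({c, o} : Finset ℕ).filter (· ∈ O) := fun x hx => by
          have := hcon x hx
          simp at hx ⊢
          simp at this
          tauto
        have := card_le_card hsub
        rw [card_filter, sum_pair hco.symm] at this
        have := h.dis c
        have := h.dis o
        grind
      obtain ⟨x, hx, hx2⟩ := this
      simp at hx hx2
      refine ⟨x, hx.2, hx2.2, hx2.1, ?_⟩
      unfold gs
      have a1 : H \ C.erase x = H \ C := by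
        ext y; have := h.dis y; simp; grind
      have a2 : #(O ∩ C.erase x) = #(O ∩ C) - 1 := by
        rw [inter_erase, card_erase_of_mem (by simp [hx])]
      have a3 : (τ ∈ C.erase x) ↔ τ ∈ C := by
        have := h.tO; simp; grind
      simp only [a1, a2, a3]
      exact k2
    · have hcτ : c ≠ τ := by
        rintro rfl; simp [h.tH, h.tO] at k2
      have hoτ : o ≠ τ := by
        rintro rfl; simp [h.tH, h.tO] at k3
      have hτ : τ ∈ C := by by_contra hh; simp [hh] at k1
      refine ⟨τ, hτ, hoτ.symm, hcτ.symm, ?_⟩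
      unfold gs
      have a1 : H \ C.erase τ = H \ C := by
        ext y; have := h.tH; simp; grind
      have a2 : O ∩ C.erase τ = O ∩ C := by
        ext y; have := h.tO; simp; grind
      simp only [a1, a2]
      simpa using k4
  · intro hh
    have hoH : o ∈ H := by grind
    by_cases hcH : c ∈ H
    · have : #({c, o} : Finset ℕ) ≤ #(H ∩ C) := card_le_card (by intro x; simp; grind)
      rw [card_pair hco.symm] at this
      simp [hcH]; omega
    · have : 0 < #(H ∩ C) := card_pos.2 ⟨o, by simp [*]⟩
      grind
  · intro hh
    have hoH : o ∈ O := by grind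
    by_cases hcH : c ∈ O
    · have : #({c, o} : Finset ℕ) ≤ #(O ∩ C) := card_le_card (by intro x; simp; grind)
      rw [card_pair hco.symm] at this
      split_ifs <;> omega
    · have : 0 < #(O ∩ C) := card_pos.2 ⟨o, by simp [*]⟩
      grind
  · have h1 := (h.un c).1 (hC hc)
    have h2 := (h.un o).1 (hC ho)
    have := h.tH
    have := h.tO
    intro hh
    have : o = τ := by grind
    subst this
    grind
  · intro hk1
    have := hk hk1
    grind

theorem drop_many (k : ℕ) {U H O τ} (h : TPart U H O τ) {c o : ℕ} (hco : o ≠ c)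
    (hk : k ≤ 1 → o ∉ O) (e : ℕ) : ∀ (C : Finset ℕ), C ⊆ U → c ∈ C → o ∈ C → ∀ d', 3 ≤ d' →
    #C = d' + e → #C + 2 ≤ #U → gs (k + 1) H O τ C c →
    ∃ C' ⊆ C, #C' = d' ∧ o ∈ C' ∧ c ∈ C' ∧ gs (k + 1) H O τ C' c := by
  induction e with
  | zero => intro C hC hc ho d' hd he h4 hg; exact ⟨C, Subset.rfl, he, ho, hc, hg⟩
  | succ e ih =>
    intro C hC hc ho d' hd he h4 hg
    obtain ⟨x, hx, hxo, hxc, hg'⟩ := drop_set k h hC hc ho hco (by omega) h4 hk hg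
    have hcard : #(C.erase x) = #C - 1 := card_erase_of_mem hx
    obtain ⟨C', h1, h2⟩ := ih (C.erase x) ((erase_subset _ _).trans hC) (by simp [hc, hxc.symm])
      (by simp [ho, hxo.symm]) d' hd (by omega) (by omega) hg'
    exact ⟨C', h1.trans (erase_subset _ _), h2⟩

theorem step (k : ℕ) {U H O τ} (h : TPart U H O τ) {C : Finset ℕ} (hC : C ⊆ U) {c : ℕ}
    (hc : c ∈ C) (h3 : 3 ≤ #C) (h4 : #C + 2 ≤ #U) (hg : gs (k + 2) H O τ C c) (d' : ℕ)
    (hd : 3 ≤ d') (hd' : d' + #C ≤ #U + 1) :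
    ∃ C' c', C' ⊆ U ∧ #C' = d' ∧ C ∩ C' = {c} ∧ c' ∈ C' ∧ c' ≠ c ∧ gs (k + 1) O H τ C' c' := by
  set C1 := insert c (U \ C) with hC1
  have hC1U : C1 ⊆ U := by
    intro x; have := @hC x; simp [hC1]; grind
  have cardC1 : #C1 = #U - #C + 1 := by
    rw [hC1, card_insert_of_notMem (by simp [hc]), card_sdiff_of_subset hC]
  have key := tight k _ _ _ _ _ _ (h.ok hC hc h3 h4) hg
  have a1 : #(O \ C1) = (if (if c ∈ H then 0 else if c ∈ O then 1 else 2) = 1 then #(O ∩ C) - 1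
      else #(O ∩ C)) := by
    have : O \ C1 = (O ∩ C).erase c := by
      ext x; have := h.un x; simp [hC1]; tauto
    rw [this]
    have := h.dis c
    by_cases hcO : c ∈ O
    · have : c ∉ H := fun hh => this hh hcO
      rw [card_erase_of_mem (by simp [hc, hcO])]; simp [hcO, this]
    · rw [erase_eq_of_notMem (by simp [hcO])]; simp [hcO]; split_ifs <;> simp
  have a2 : #(H ∩ C1) = (if (if c ∈ H then 0 else if c ∈ O then 1 else 2) = 0 then #(H \ C) + 1
      else #(H \ C)) := by
    by_cases hcH : c ∈ H
    · have : H ∩ C1 = insert c (H \ C) := by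
        ext x; have := h.un x; simp [hC1]; grind
      rw [this, card_insert_of_notMem (by simp [hc])]; simp [hcH]
    · have : H ∩ C1 = H \ C := by
        ext x; have := h.un x; simp [hC1]; grind
      rw [this]; simp [hcH]; split_ifs <;> simp
  have a3 : (if τ ∈ C1 then 1 else 0) = (if (if c ∈ H then 0 else if c ∈ O then 1 else 2) = 2 then 1
      else 1 - (if τ ∈ C then 1 else 0)) := by
    have := (h.un c).1 (hC hc)
    have := (h.un τ)
    have := h.tH
    have := h.tO
    simp [hC1]; grind
  rw [← a1, ← a2, ← a3] at key
  have fin : ∀ c', c' ∈ U → c' ∉ C → gs (k + 1) O H τ C1 c' →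
     ∃ C' c', C' ⊆ U ∧ #C' = d' ∧ C ∩ C' = {c} ∧ c' ∈ C' ∧ c' ≠ c ∧ gs (k + 1) O H τ C' c' := by
    intro c' hU hn hg'
    have hne : c ≠ c' := fun hh => hn (hh ▸ hc)
    have hkk : k ≤ 1 → c ∉ H := by
      intro hk1 hcO
      unfold gs at hg
      simp only [hcO, if_true] at hg
      have : k = 0 ∨ k = 1 := by omega
      rcases this with rfl | rfl <;> simp [good] at hg
    obtain ⟨C', b1, b2, b3, b4, b5⟩ := drop_many k h.swap hne hkk (#U + 1 - #C - d') C1 hC1U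
      (by simp [hC1, hU, hn]) (by simp [hC1]) d' hd (by omega) (by omega) hg'
    refine ⟨C', c', b1.trans hC1U, b2, ?_, b4, hne.symm, b5⟩
    ext x
    have := @b1 x
    simp [hC1] at this ⊢
    grind
  rcases key with ⟨k1, k2⟩ | ⟨k1, k2⟩ | ⟨k1, k2⟩
  · obtain ⟨c', hc', hcn⟩ : ∃ x ∈ O, x ∉ O ∩ C := by
      by_contra hcon; push Not at hcon
      have := card_le_card (show O ⊆ O ∩ C from hcon); omega
    simp [hc'] at hcn
    refine fin c' ((h.un c').2 (by simp [hc'])) hcn ?_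
    unfold gs
    simpa [hc'] using k2
  · obtain ⟨c', hc'⟩ := card_pos.1 k1
    simp at hc'
    refine fin c' ((h.un c').2 (by simp [hc'])) hc'.2 ?_
    unfold gs
    simpa [hc', h.dis c' hc'.1] using k2
  · have hτ : τ ∉ C := by by_contra hh; simp [hh] at k1
    refine fin τ ((h.un τ).2 (by simp)) hτ ?_
    unfold gs
    simpa [h.tH, h.tO] using k2

theorem last_step {U H O τ} (h : TPart U H O τ) {C : Finset ℕ} (hC : C ⊆ U) {c : ℕ}
    (hc : c ∈ C) (hg : gs 1 H O τ C c) (d' : ℕ)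
    (hd : 3 ≤ d') (hd' : d' + #C ≤ #U + 1) (hd2 : d' ≤ #O + 1) :
    ∃ C', C' ⊆ U ∧ #C' = d' ∧ C ∩ C' = {c} ∧ τ ∈ C' ∧ τ ≠ c ∧ C' ∩ insert τ H = {τ} := by
  unfold gs at hg
  simp only [good] at hg
  obtain ⟨g1, g2, g3, g4⟩ := hg
  have hτ : τ ∉ C := by by_contra hh; simp [hh] at g1
  have hcO : c ∈ O := by grind
  have hcH : c ∉ H := fun hh => h.dis c hh hcO
  have hne : τ ≠ c := fun hh => hτ (hh ▸ hc)
  have e1 := h.card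
  have e2 := h.cardC hC
  have e3 := card_sdiff_add_card_inter H C
  have e4 := card_sdiff_add_card_inter O C
  simp [hτ] at e2
  obtain ⟨A, hA, hAc⟩ := exists_subset_card_eq (s := O \ C) (n := d' - 2) (by omega)
  have hA' : ∀ x ∈ A, x ∈ O ∧ x ∉ C := fun x hx => by simpa using hA hx
  refine ⟨insert τ (insert c A), ?_, ?_, ?_, by simp, hne, ?_⟩
  · intro x; have := h.un x; have := hA' x; simp; grind
  · rw [card_insert_of_notMem, card_insert_of_notMem, hAc]
    · omega
    · intro hh; exact (hA' c hh).2 hc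
    · have := h.tO; have := hA' τ; simp; grind
  · ext x; have := hA' x; simp; grind
  · ext x; have := hA' x; have := h.dis x; simp; grind

theorem chain {U : Finset ℕ} {τ : ℕ} (k : ℕ) : ∀ (H O C : Finset ℕ) (c : ℕ) (d : ℕ → ℕ) (T : Finset ℕ),
    TPart U H O τ → gs k H O τ C c → C ⊆ U → c ∈ C → #C = d 0 → (∀ i ≤ k + 1, 3 ≤ d i) →
    (∀ i ≤ k, d i + d (i + 1) ≤ #U + 1) → #T = d (k + 1) →
    T = insert τ (if k % 2 = 0 then O else H) →
    ∃ (Cf : ℕ → Finset ℕ) (cf : ℕ → ℕ), Cf 0 = C ∧ cf 0 = c ∧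
      (∀ i ≤ k, Cf i ⊆ U ∧ #(Cf i) = d i) ∧
      (∀ i < k, Cf i ∩ Cf (i + 1) = {cf i} ∧ cf i ≠ cf (i + 1)) ∧ Cf k ∩ T = {τ} ∧ cf k = τ := by
  induction k with
  | zero =>
    intro H O C c d T h hg hC hc h0 h3 hdd hT hTT
    unfold gs at hg
    simp only [good] at hg
    obtain ⟨g1, g2, g3⟩ := hg
    have hτ : τ ∈ C := by by_contra hh; simp [hh] at g1
    have hcτ : c = τ := by
      have := (h.un c).1 (hC hc)
      by_contra hh
      grind
    refine ⟨fun _ => C, fun _ => c, rfl, rfl, ?_, by simp, ?_, hcτ⟩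
    · intro i hi; obtain rfl : i = 0 := by omega
      exact ⟨hC, h0⟩
    · simp at hTT
      rw [card_eq_zero] at g3
      rw [hTT]
      ext x
      have : x ∉ O ∩ C := by rw [g3]; simp
      simp at this ⊢; grind
  | succ k ih =>
    intro H O C c d T h hg hC hc h0 h3 hdd hT hTT
    have d0 := h3 0 (by omega)
    have d1 := h3 1 (by omega)
    have d01 := hdd 0 (by omega)
    simp at d01
    have hex : ∃ C' c', C' ⊆ U ∧ #C' = d 1 ∧ C ∩ C' = {c} ∧ c' ∈ C' ∧ c' ≠ c ∧
        gs k O H τ C' c' := by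
      cases k with
      | zero =>
        have d12 := hdd 1 (by omega)
        simp at hTT
        have : #T = #H + 1 := by rw [hTT, card_insert_of_notMem h.tH]
        have e1 := h.card
        obtain ⟨C', b1, b2, b3, b4, b5, b6⟩ := last_step h hC hc hg (d 1) d1 (by omega) (by simp at hT d12; omega)
        refine ⟨C', τ, b1, b2, b3, b4, b5, ?_⟩
        unfold gs good
        simp [b4, h.tO, h.tH]
        ext x
        have : x ∈ C' ∩ insert τ H ↔ x = τ := by rw [b6]; simp
        have := h.tH
        simp at *; grind
      | succ k => exact step k h hC hc (by omega) (by omega) hg (d 1) d1 (by omega)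
    obtain ⟨C', c', b1, b2, b3, b4, b5, b6⟩ := hex
    obtain ⟨Cf, cf, f1, f2, f3, f4, f5, f6⟩ := ih O H C' c' (fun i => d (i + 1)) T h.swap b6 b1 b4 b2
      (fun i hi => h3 _ (by omega)) (fun i hi => hdd _ (by omega)) hT
      (by rw [hTT]; rcases Nat.mod_two_eq_zero_or_one k with hk | hk <;> simp [Nat.add_mod, hk])
    refine ⟨fun i => Nat.casesOn i C Cf, fun i => Nat.casesOn i c cf, rfl, rfl, ?_, ?_, f5, f6⟩
    · intro i hi
      cases i with
      | zero => exact ⟨hC, h0⟩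
      | succ i => exact f3 i (by omega)
    · intro i hi
      cases i with
      | zero => simp [f1, f2, b3, b5.symm]
      | succ i => exact f4 i (by omega)

end partB

section partC
open Finset

/-- Existence of a solution of the path problem. -/
def PathEx (s n : ℕ) (d : ℕ → ℕ) (C0 : Finset ℕ) (c0 : ℕ) (T : Finset ℕ) (τ : ℕ) : Prop :=
  ∃ (Cf : ℕ → Finset ℕ) (cf : ℕ → ℕ), Cf 0 = C0 ∧ Cf n = T ∧ cf 0 = c0 ∧ cf (n - 1) = τ ∧
    (∀ i ≤ n, Cf i ⊆ range s ∧ #(Cf i) = d i) ∧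
    (∀ i < n, Cf i ∩ Cf (i + 1) = {cf i}) ∧ ∀ i, i + 1 < n → cf i ≠ cf (i + 1)

theorem PathEx.cons {s n d C0 c0 T τ C c} (hn : 1 ≤ n) (h : PathEx s n (fun i => d (i + 1)) C0 c0 T τ)
    (h1 : C ⊆ range s) (h2 : #C = d 0) (h3 : C ∩ C0 = {c}) (h4 : c ≠ c0) :
    PathEx s (n + 1) d C c T τ := by
  obtain ⟨Cf, cf, f1, f2, f3, f4, f5, f6, f7⟩ := h
  obtain ⟨m, rfl⟩ : ∃ m, n = m + 1 := ⟨n - 1, by omega⟩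
  refine ⟨fun i => Nat.casesOn i C Cf, fun i => Nat.casesOn i c cf, rfl, f2, rfl, by simpa using f4, ?_, ?_, ?_⟩
  · intro i hi
    cases i with
    | zero => exact ⟨h1, h2⟩
    | succ i => exact f5 i (by omega)
  · intro i hi
    cases i with
    | zero => simp [f1, h3]
    | succ i => exact f6 i (by omega)
  · intro i hi
    cases i with
    | zero => simp [f3, h4]
    | succ i => exact f7 i (by omega)

theorem PathEx.rev {s n d C0 c0 T τ} (h : PathEx s n (fun i => d (n - i)) T τ C0 c0) :
    PathEx s n d C0 c0 T τ := by
  obtain ⟨Cf, cf, f1, f2, f3, f4, f5, f6, f7⟩ := h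
  refine ⟨fun i => Cf (n - i), fun i => cf (n - 1 - i), by simpa, by simpa, by simpa, by simpa,
    ?_, ?_, ?_⟩
  · intro i hi
    have := f5 (n - i) (by omega)
    dsimp only at this ⊢
    rwa [show n - (n - i) = i by omega] at this
  · intro i hi
    have := f6 (n - 1 - i) (by omega)
    rw [show n - 1 - i + 1 = n - i by omega, inter_comm] at this
    dsimp only
    rw [show n - (i + 1) = n - 1 - i by omega]
    exact this
  · intro i hi
    have := f7 (n - 1 - (i + 1)) (by omega)
    rw [show n - 1 - (i + 1) + 1 = n - 1 - i by omega] at this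
    exact this.symm

theorem TPart.of {s : ℕ} {T : Finset ℕ} {τ : ℕ} (hT : T ⊆ range s) (hτ : τ ∈ T) (h3 : 3 ≤ #T)
    (h4 : #T + 2 ≤ s) : TPart (range s) (T.erase τ) (range s \ T) τ := by
  refine ⟨?_, by simp, by simp [hτ], ?_, ?_, ?_⟩
  · intro x; simp; tauto
  · intro x; have := @hT x; simp at this ⊢; grind
  · rw [card_erase_of_mem hτ]; omega
  · rw [card_sdiff_of_subset hT]; simp; omega

theorem chain' {s : ℕ} {T : Finset ℕ} {τ : ℕ} (hT : T ⊆ range s) (hτ : τ ∈ T) (k : ℕ) (d : ℕ → ℕ)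
    (C : Finset ℕ) (c : ℕ) (hC : C ⊆ range s) (hc : c ∈ C) (h0 : #C = d 0)
    (hd3 : ∀ i ≤ k + 1, 3 ≤ d i) (hdd : ∀ i ≤ k, d i + d (i + 1) ≤ s + 1) (hTd : #T = d (k + 1))
    (hg : if k % 2 = 0 then gs k (range s \ T) (T.erase τ) τ C c
      else gs k (T.erase τ) (range s \ T) τ C c) :
    PathEx s (k + 1) d C c T τ := by
  have t3 := hd3 (k + 1) le_rfl
  have t4 := hd3 k (by omega)
  have t5 := hdd k le_rfl
  have hP := TPart.of hT hτ (by omega) (by omega)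
  have key : ∃ (Cf : ℕ → Finset ℕ) (cf : ℕ → ℕ), Cf 0 = C ∧ cf 0 = c ∧
      (∀ i ≤ k, Cf i ⊆ range s ∧ #(Cf i) = d i) ∧
      (∀ i < k, Cf i ∩ Cf (i + 1) = {cf i} ∧ cf i ≠ cf (i + 1)) ∧ Cf k ∩ T = {τ} ∧ cf k = τ := by
    split_ifs at hg with hk
    · exact chain k _ _ C c d T hP.swap hg hC hc h0 hd3 (by simpa using hdd) hTd (by simp [hk, hτ])
    · exact chain k _ _ C c d T hP hg hC hc h0 hd3 (by simpa using hdd) hTd (by simp [hk, hτ])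
  obtain ⟨Cf, cf, f1, f2, f3, f4, f5, f6⟩ := key
  refine ⟨fun i => if i = k + 1 then T else Cf i, cf, by simpa, by simp, f2, by simpa, ?_, ?_, ?_⟩
  · intro i hi
    dsimp only
    split_ifs with h
    · exact ⟨hT, h ▸ hTd⟩
    · exact f3 i (by omega)
  · intro i hi
    dsimp only
    rw [if_neg (by omega)]
    split_ifs with h
    · obtain rfl : i = k := by omega
      rw [f5, f6]
    · exact (f4 i (by omega)).1
  · intro i hi; exact (f4 i (by omega)).2

theorem allgood (k w v t h H O : ℕ) (hok : okst w v t h H O) (hk : 7 ≤ k) (hs : H + O + 1 ≤ k)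
    (h7 : k = 7 → ¬ (h = 2 ∧ w = H ∧ v = O ∧ (H = 2 ∨ O = 2))) : good k w v t h H O := by
  obtain ⟨ht, hh, h2, h0, h1, hw, hv, hH, hO, d3, d4⟩ := hok
  have e2 : h = 0 ∨ h = 1 ∨ h = 2 := by omega
  have e1 : t = 0 ∨ t = 1 := by omega
  obtain ⟨k, rfl⟩ : ∃ j, k = j + 6 := ⟨k - 6, by omega⟩
  rcases Nat.mod_two_eq_zero_or_one k with hm | hm <;>
    rcases e1 with rfl | rfl <;> rcases e2 with rfl | rfl | rfl <;>
     simp [good, hm] at h0 h1 h2 h7 ⊢ <;> omega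

theorem path_main {s : ℕ} {T : Finset ℕ} {τ : ℕ} (hT : T ⊆ range s) (hτ : τ ∈ T) (k : ℕ) (d : ℕ → ℕ)
    (C : Finset ℕ) (c : ℕ) (hC : C ⊆ range s) (hc : c ∈ C) (h0 : #C = d 0)
    (hd3 : ∀ i ≤ k + 1, 3 ≤ d i) (hdd : ∀ i ≤ k, d i + d (i + 1) ≤ s + 1) (hTd : #T = d (k + 1))
    (hk : 7 ≤ k) (hks : s ≤ k)
    (h7 : k = 7 → ¬ (c = τ ∧ C = insert τ (range s \ T) ∧ (#T = 3 ∨ #C = 3))) :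
    PathEx s (k + 1) d C c T τ := by
  have t3 := hd3 (k + 1) le_rfl
  have t4 := hd3 k (by omega)
  have t5 := hdd k le_rfl
  have hP := TPart.of hT hτ (by omega) (by omega)
  have r0 := hd3 0 (by omega)
  have r1 := hd3 1 (by omega)
  have r2 := hdd 0 (by omega)
  simp at r2
  have hcs := hP.card
  simp at hcs
  refine chain' hT hτ k d C c hC hc h0 hd3 hdd hTd ?_
  split_ifs with hm
  · refine allgood _ _ _ _ _ _ _ (hP.swap.ok hC hc (by omega) (by simp; omega)) hk (by omega) ?_
    intro hk7; omega
  · refine allgood _ _ _ _ _ _ _ (hP.ok hC hc (by omega) (by simp; omega)) hk (by omega) ?_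
    rintro hk7 ⟨b1, b2, b3, b4⟩
    have a0 : c = τ := by
      have := (hP.un c).1 (hC hc)
      grind
    have a1 : T.erase τ ∩ C = ∅ := by
      have := card_sdiff_add_card_inter (T.erase τ) C
      rw [← card_eq_zero]; omega
    have a2 : range s \ T ⊆ C := by
      have := eq_of_subset_of_card_le (inter_subset_left (s₁ := range s \ T) (s₂ := C)) (by omega)
      rw [← this]; exact inter_subset_right
    have a3 : C = insert τ (range s \ T) := by
      ext x
      have h1 : x ∉ T.erase τ ∩ C := by rw [a1]; simp
      have h2 := @a2 x
      have h3 := @hC x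
      simp at h1 h2 h3 ⊢
      grind
    refine h7 hk7 ⟨a0, a3, ?_⟩
    rw [a3, card_insert_of_notMem (by simp [hτ])]
    rw [card_erase_of_mem hτ] at b4
    omega

set_option maxHeartbeats 2000000 in
theorem path_special {s : ℕ} {T : Finset ℕ} {τ : ℕ} (hs6 : 6 ≤ s) (hs7 : s ≤ 7)
    (hT : T ⊆ range s) (hτ : τ ∈ T) (d : ℕ → ℕ)
    (C : Finset ℕ) (hCd : C = insert τ (range s \ T)) (h0 : #C = d 0)
    (hd3 : ∀ i ≤ 8, 3 ≤ d i) (hdd : ∀ i ≤ 7, d i + d (i + 1) ≤ s + 1) (hTd : #T = d 8)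
    (hT3 : #T = 3) :
    PathEx s 8 d C τ T τ := by
  have hC : C ⊆ range s := by
    rw [hCd]; intro x; have := @hT τ hτ; simp at this ⊢; grind
  have hY : #(range s \ T) = s - 3 := by rw [card_sdiff_of_subset hT]; simp [hT3]
  have hcc : #C = s - 2 := by
    rw [hCd, card_insert_of_notMem (by simp [hτ]), hY]; omega
  have hτs : τ < s := by simpa using hT hτ
  have q0 := hdd 0; have q1 := hdd 1; have q2 := hdd 2; have q3 := hdd 3; have q4 := hdd 4
  have q5 := hdd 5; have q6 := hdd 6; have q7 := hdd 7
  have p0 := hd3 0; have p1 := hd3 1; have p2 := hd3 2; have p3 := hd3 3; have p4 := hd3 4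
  have p5 := hd3 5; have p6 := hd3 6; have p7 := hd3 7
  simp at *
  by_cases h7 : d 7 = 3
  · obtain ⟨T', t1, t2, t3⟩ := exists_subsuperset_card_eq hT (n := s - 2) (by omega) (by simp)
    have key : PathEx s 8 (fun i => if i = 8 then s - 2 else d i) C τ T' τ := by
      refine path_main t2 (t1 hτ) 7 _ C τ hC (by simp [hCd]) (by simpa using h0) ?_ ?_ (by simp [t3])
        (by norm_num) hs7 ?_
      · intro i hi; split_ifs
        · omega
        · exact hd3 i hi
      · intro i hi; have := hdd i hi; rw [if_neg (by omega)]; split_ifs with h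
        · obtain rfl : i = 7 := by omega
          omega
        · exact this
      · rintro - ⟨-, -, h⟩; omega
    obtain ⟨Cf, cf, f1, f2, f3, f4, f5, f6, f7⟩ := key
    refine ⟨fun i => if i = 8 then T else Cf i, cf, by simpa, by simp, f3, f4, ?_, ?_, f7⟩
    · intro i hi; dsimp only; split_ifs with h
      · subst h; exact ⟨hT, hTd⟩
      · have := f5 i hi; simpa [h] using this
    · intro i hi
      dsimp only
      rw [if_neg (by omega)]
      split_ifs with h
      · obtain rfl : i = 7 := by omega
        have := f6 7 (by omega)
        simp at f4
        rw [f4] at this ⊢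
        simp [f2] at this
        apply Subset.antisymm
        · rw [← this]; exact inter_subset_inter_left t1
        · have h7 : τ ∈ Cf 7 ∩ T' := by rw [this]; simp
          simp at h7
          simp [h7, hτ]
      · exact f6 i hi
  obtain ⟨x1, x2, hx12, hX⟩ : ∃ x1 x2, x1 ≠ x2 ∧ T.erase τ = {x1, x2} := by
    rw [← card_eq_two, card_erase_of_mem hτ, hT3]
  have hTe : T = {τ, x1, x2} := by rw [← insert_erase hτ, hX]
  have hx1 : x1 ∈ T.erase τ := by simp [hX]
  have hx2 : x2 ∈ T.erase τ := by simp [hX]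
  have hx1s := hT (mem_of_mem_erase hx1)
  have hx2s := hT (mem_of_mem_erase hx2)
  simp at hx1 hx2 hx1s hx2s
  have hCT : C ∩ T = {τ} := by
    rw [hCd]; ext x; simp; grind
  have hYs : ∀ y ∈ range s \ T, y < s ∧ y ≠ τ ∧ y ≠ x1 ∧ y ≠ x2 := by
    intro y hy; rw [hTe] at hy; simp at hy; tauto
  by_cases h2 : d 2 ≤ s - 3
  · obtain ⟨Y', y1, y2⟩ := exists_subset_card_eq (s := range s \ T) (n := d 2 - 1) (by omega)
    obtain ⟨y, hy⟩ : Y'.Nonempty := card_pos.1 (by omega)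
    have hYs' : ∀ y ∈ Y', y < s ∧ y ≠ τ ∧ y ≠ x1 ∧ y ≠ x2 := fun y hy => hYs y (y1 hy)
    have hc2 : #(insert x1 Y') = d 2 := by
      rw [card_insert_of_notMem, y2]; · omega
      · intro h; have := hYs' _ h; tauto
    refine PathEx.cons (C0 := T) (c0 := x1) (by norm_num) ?_ hC h0 hCT (Ne.symm hx1.1)
    refine PathEx.cons (C0 := insert x1 Y') (c0 := y) (by norm_num) ?_ hT (by simp; omega) ?_ ?_
    · refine chain' hT hτ 5 _ _ _ ?_ (by simp [hy]) hc2 (fun i hi => hd3 _ (by omega))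
        (fun i hi => hdd _ (by omega)) hTd ?_
      · intro x; have := hYs' x; simp; grind
      · have a1 : T.erase τ \ insert x1 Y' = {x2} := by
          rw [hX]; ext x; have := hYs' x; simp; grind
        have a2 : (range s \ T) ∩ insert x1 Y' = Y' := by
          ext x; have := @y1 x; simp at this ⊢; grind
        have a3 : τ ∉ insert x1 Y' := by have := hYs' τ; simp; grind
        have a4 : y ∉ T.erase τ := by rw [hX]; have := hYs' y; simp; grind
        have a5 : y ∈ range s \ T := y1 hy
        norm_num
        unfold gs
        simp only [a1, a2, a3, a4, a5, if_true, if_false, y2, hY]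
        simp [good]
        omega
    · rw [hTe]; ext x; have := hYs' x; simp; grind
    · have := hYs' y hy; tauto
  obtain ⟨y1, hy1⟩ : (range s \ T).Nonempty := card_pos.1 (by omega)
  have hy1' := hYs y1 hy1
  have hc2 : #(insert x1 (range s \ T)) = d 2 := by
    rw [card_insert_of_notMem, hY]; · omega
    · intro h; have := hYs _ h; tauto
  have hc3 : #({y1, x2, τ} : Finset ℕ) = d 3 := by
    rw [card_eq_three.2 ⟨y1, x2, τ, by tauto, by tauto, by tauto, rfl⟩]; omega
  have hc3s : ({y1, x2, τ} : Finset ℕ) ⊆ range s := by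
    intro x; simp; grind
  have hc3e : insert x1 (range s \ T) ∩ {y1, x2, τ} = {y1} := by
    ext x; have := hYs x; simp at this hy1 ⊢; grind
  suffices hsuf : ∃ c3, c3 ≠ y1 ∧ PathEx s 5 (fun i => d (i + 3)) {y1, x2, τ} c3 T τ by
    obtain ⟨c3, h31, h32⟩ := hsuf
    refine PathEx.cons (C0 := T) (c0 := x1) (by norm_num) ?_ hC h0 hCT (Ne.symm hx1.1)
    refine PathEx.cons (C0 := insert x1 (range s \ T)) (c0 := y1) (by norm_num) ?_ hT (by simp; omega) ?_ ?_
    · exact PathEx.cons (by norm_num) h32 (by intro x; simp; grind) hc2 hc3e h31.symm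
    · rw [hTe]; ext x; have := hYs x; simp at this ⊢ <;> grind
    · tauto
  have hYe : #((range s \ T).erase y1) = s - 4 := by rw [card_erase_of_mem hy1]; omega
  by_cases h4 : d 4 ≤ s - 3
  · refine ⟨x2, by tauto, ?_⟩
    obtain ⟨Y', z1, z2⟩ := exists_subset_card_eq (s := (range s \ T).erase y1) (n := d 4 - 1) (by omega)
    obtain ⟨y, hy⟩ : Y'.Nonempty := card_pos.1 (by omega)
    have hYs' : ∀ y ∈ Y', y < s ∧ y ≠ τ ∧ y ≠ x1 ∧ y ≠ x2 ∧ y ≠ y1 ∧ y ∉ T := fun y hy => by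
      have h1 := z1 hy
      simp only [mem_erase] at h1
      have h2 := hYs y h1.2
      simp at h1
      tauto
    have hc4 : #(insert x2 Y') = d 4 := by
      rw [card_insert_of_notMem, z2]; · omega
      · intro h; have := hYs' _ h; tauto
    refine PathEx.cons (C0 := insert x2 Y') (c0 := y) (by norm_num) ?_ hc3s hc3 ?_ ?_
    · refine chain' hT hτ 3 _ _ _ ?_ (by simp [hy]) hc4 (fun i hi => hd3 _ (by omega))
        (fun i hi => hdd _ (by omega)) hTd ?_
      · intro x; have := hYs' x; simp; grind
      · have a1 : T.erase τ \ insert x2 Y' = {x1} := by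
          rw [hX]; ext x; have := hYs' x; simp; grind
        have a2 : (range s \ T) ∩ insert x2 Y' = Y' := by
          ext x; have := hYs' x; simp at this ⊢; grind
        have a3 : τ ∉ insert x2 Y' := by have := hYs' τ; simp; grind
        have a4 : y ∉ T.erase τ := by rw [hX]; have := hYs' y; simp; grind
        have a5 : y ∈ range s \ T := by have := hYs' y; simp; grind
        norm_num
        unfold gs
        simp only [a1, a2, a3, a4, a5, if_true, if_false, z2, hY]
        simp [good]
        omega
    · ext x; have := hYs' x; simp; grind
    · have := hYs' y hy; tauto
  · refine ⟨τ, by tauto, ?_⟩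
    obtain ⟨y2, hy2⟩ : ((range s \ T).erase y1).Nonempty := card_pos.1 (by omega)
    have hYe2 : #(((range s \ T).erase y1).erase y2) = s - 5 := by rw [card_erase_of_mem hy2]; omega
    have hy2' := hYs y2 (mem_of_mem_erase hy2)
    have hy21 : y2 ≠ y1 := (mem_erase.1 hy2).1
    obtain ⟨Y', z1, z2⟩ := exists_subset_card_eq (s := ((range s \ T).erase y1).erase y2)
      (n := d 6 - 2) (by omega)
    obtain ⟨y3, hy3⟩ : Y'.Nonempty := card_pos.1 (by omega)
    have hYs' : ∀ y ∈ Y', y < s ∧ y ≠ τ ∧ y ≠ x1 ∧ y ≠ x2 ∧ y ≠ y1 ∧ y ≠ y2 ∧ y ∉ T := fun y hy => by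
      have h1 := z1 hy
      simp only [mem_erase] at h1
      have h2 := hYs y h1.2.2
      simp at h1
      tauto
    have hYs2 : ∀ y ∈ (range s \ T).erase y1, y < s ∧ y ≠ τ ∧ y ≠ x1 ∧ y ≠ x2 ∧ y ≠ y1 := fun y hy => by
      have h1 := hy
      simp only [mem_erase] at h1
      have h2 := hYs y h1.2
      tauto
    have hc4 : #(insert τ (insert x1 ((range s \ T).erase y1))) = d 4 := by
      rw [card_insert_of_notMem, card_insert_of_notMem, hYe]; · omega
      · intro h; have := hYs2 _ h; tauto
      · intro h
        rcases mem_insert.1 h with h | h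
        · tauto
        · have := hYs2 _ h; tauto
    have hc5 : #({y1, y2, x2} : Finset ℕ) = d 5 := by
      rw [card_eq_three.2 ⟨y1, y2, x2, by tauto, by tauto, by tauto, rfl⟩]; omega
    have hc6 : #(insert x1 (insert x2 Y')) = d 6 := by
      rw [card_insert_of_notMem, card_insert_of_notMem, z2]; · omega
      · intro h; have := hYs' _ h; tauto
      · intro h
        rcases mem_insert.1 h with h | h
        · tauto
        · have := hYs' _ h; tauto
    refine PathEx.cons (C0 := insert τ (insert x1 ((range s \ T).erase y1))) (c0 := y2)
      (by norm_num) ?_ hc3s hc3 ?_ ?_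
    · refine PathEx.cons (C0 := {y1, y2, x2}) (c0 := x2) (by norm_num) ?_ ?_ hc4 ?_ ?_
      · refine PathEx.cons (C0 := insert x1 (insert x2 Y')) (c0 := y3) (by norm_num) ?_ ?_ hc5 ?_ ?_
        · refine chain' hT hτ 1 _ _ _ ?_ (by simp [hy3]) hc6 (fun i hi => hd3 _ (by omega))
            (fun i hi => hdd _ (by omega)) hTd ?_
          · intro x; have := hYs' x; simp; grind
          · have a1 : T.erase τ \ insert x1 (insert x2 Y') = ∅ := by
              rw [hX]; ext x; have := hYs' x; simp; grind
            have a2 : (range s \ T) ∩ insert x1 (insert x2 Y') = Y' := by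
              ext x; have := hYs' x; simp at this ⊢; grind
            have a3 : τ ∉ insert x1 (insert x2 Y') := by have := hYs' τ; simp; grind
            have a4 : y3 ∉ T.erase τ := by rw [hX]; have := hYs' y3; simp; grind
            have a5 : y3 ∈ range s \ T := by have := hYs' y3; simp; grind
            norm_num
            unfold gs
            simp only [a1, a2, a3, a4, a5, if_true, if_false, z2, hY]
            simp [good]
            omega
        · intro x; simp; grind
        · ext x; have := hYs' x; simp; grind
        · have := hYs' y3 hy3; tauto
      · intro x; have := hYs2 x; simp at this ⊢; grind
      · ext x; have := hYs2 x; simp at this hy2 ⊢; grind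
      · tauto
    · ext x; have := hYs2 x; simp at this ⊢; grind
    · tauto

theorem path_core {s n : ℕ} (hs : 5 ≤ s) (hn : (if s = 5 then 8 else if s ≤ 7 then 7 else s) + 1 ≤ n)
    (d : ℕ → ℕ) (hd3 : ∀ i ≤ n, 3 ≤ d i) (hdd : ∀ i < n, d i + d (i + 1) ≤ s + 1)
    {C T : Finset ℕ} {c τ : ℕ} (hC : C ⊆ range s) (hT : T ⊆ range s) (hc : c ∈ C) (hτ : τ ∈ T)
    (h0 : #C = d 0) (hTd : #T = d n) : PathEx s n d C c T τ := by
  obtain ⟨k, rfl⟩ : ∃ k, n = k + 1 := ⟨n - 1, by split_ifs at hn <;> omega⟩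
  by_cases hsp : k = 7 ∧ (c = τ ∧ C = insert τ (range s \ T) ∧ (#T = 3 ∨ #C = 3))
  · obtain ⟨rfl, rfl, h1, h2⟩ := hsp
    have hs6 : 6 ≤ s ∧ s ≤ 7 := by split_ifs at hn <;> omega
    rcases h2 with h2 | h2
    · exact path_special hs6.1 hs6.2 hT hτ d C h1 h0 hd3 (fun i hi => hdd i (by omega)) hTd h2
    · refine PathEx.rev ?_
      refine path_special hs6.1 hs6.2 hC hc _ T ?_ hTd (fun i hi => hd3 _ (by omega)) ?_ (by simpa) h2
      · rw [h1]
        ext x; have := @hT x; simp at this ⊢; grind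
      · intro i hi
        have := hdd (7 - i) (by omega)
        rw [show 7 - i + 1 = 8 - i by omega, add_comm] at this
        rw [show 7 + 1 - (i + 1) = 7 - i by omega]; exact this
  · refine path_main hT hτ k d C c hC hc h0 hd3 (fun i hi => hdd i (by omega)) hTd ?_ ?_ ?_
    · split_ifs at hn <;> omega
    · split_ifs at hn <;> omega
    · tauto

end partC

section partD
open Finset

theorem path_lemma {s n : ℕ} (hs : 5 ≤ s)
    (hn : (if s = 5 then 8 else if s ≤ 7 then 7 else s) + 1 ≤ n)
    (d : ℕ → ℕ) (hd : ∀ i ≤ n, d i + 2 ≤ s) (hdd : ∀ i < n, d i + d (i + 1) ≤ s + 1)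
    {C T : Finset ℕ} {c τ : ℕ} (hC : C ⊆ range s) (hT : T ⊆ range s) (hc : c ∈ C) (hτ : τ ∈ T)
    (h0 : #C ≤ d 0) (hTd : #T ≤ d n) :
    ∃ (Cf : ℕ → Finset ℕ) (cf : ℕ → ℕ), C ⊆ Cf 0 ∧ T ⊆ Cf n ∧ cf 0 = c ∧ cf (n - 1) = τ ∧
      (∀ i ≤ n, Cf i ⊆ range s ∧ d i ≤ #(Cf i)) ∧
      (∀ i < n, Cf i ∩ Cf (i + 1) = {cf i}) ∧ ∀ i, i + 1 < n → cf i ≠ cf (i + 1) := by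
  have q0 := hd 0 (by omega)
  have qn := hd n le_rfl
  obtain ⟨C', a1, a2, a3⟩ := exists_subsuperset_card_eq hC (n := max (d 0) 3) (by omega) (by simp; omega)
  obtain ⟨T', b1, b2, b3⟩ := exists_subsuperset_card_eq hT (n := max (d n) 3) (by omega) (by simp; omega)
  obtain ⟨Cf, cf, f1, f2, f3, f4, f5, f6, f7⟩ := path_core hs hn (fun i => max (d i) 3)
    (fun i hi => by omega) (fun i hi => by have := hdd i hi; have := hd i (by omega); have := hd (i+1) (by omega); omega) a2 b2 (a1 hc) (b1 hτ) a3 b3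
  exact ⟨Cf, cf, f1 ▸ a1, f2 ▸ b1, f3, f4, fun i hi => ⟨(f5 i hi).1,
    (le_max_left _ _).trans (f5 i hi).2.ge⟩, f6, f7⟩

/-- Solvability of the cyclic problem. -/
def CycEx (s n : ℕ) (d : ℕ → ℕ) : Prop :=
  ∃ (Cf : ℕ → Finset ℕ) (cf : ℕ → ℕ), (∀ i, Cf (i + n) = Cf i) ∧ (∀ i, cf (i + n) = cf i) ∧
    (∀ i, Cf i ⊆ range s ∧ d i ≤ #(Cf i)) ∧ ∀ i, Cf i ∩ Cf (i + 1) = {cf i} ∧ cf i ≠ cf (i + 1)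

theorem CycEx.of_fin {s n : ℕ} {d : ℕ → ℕ} (hn : 1 ≤ n) (hd : ∀ i, d (i + n) = d i)
    (Cf : ℕ → Finset ℕ) (cf : ℕ → ℕ) (h1 : Cf n = Cf 0) (h2 : cf n = cf 0)
    (h3 : ∀ i < n, Cf i ⊆ range s ∧ d i ≤ #(Cf i))
    (h4 : ∀ i < n, Cf i ∩ Cf (i + 1) = {cf i} ∧ cf i ≠ cf (i + 1)) : CycEx s n d := by
  refine ⟨fun i => Cf (i % n), fun i => cf (i % n), by simp, by simp, ?_, ?_⟩
  · intro i
    have hi := Nat.mod_lt i hn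
    have : d i = d (i % n) := (Function.Periodic.map_mod_nat (f := d) hd i).symm
    rw [this]
    exact h3 _ hi
  · intro i
    have hi := Nat.mod_lt i hn
    have e1 : Cf ((i + 1) % n) = Cf (i % n + 1) ∧ cf ((i + 1) % n) = cf (i % n + 1) := by
      rw [← Nat.mod_add_mod]
      rcases Nat.lt_or_ge (i % n + 1) n with h | h
      · rw [Nat.mod_eq_of_lt h]; simp
      · have : i % n + 1 = n := by omega
        rw [this]; simp [h1, h2]
    dsimp only
    rw [e1.1, e1.2]
    exact h4 _ hi

theorem CycEx.rot {s n : ℕ} {d : ℕ → ℕ} (hd : ∀ i, d (i + n) = d i) (j : ℕ) (hj : j < n)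
    (h : CycEx s n (fun i => d (i + j))) : CycEx s n d := by
  obtain ⟨Cf, cf, f1, f2, f3, f4⟩ := h
  refine ⟨fun i => Cf (i + (n - j)), fun i => cf (i + (n - j)), ?_, ?_, ?_, ?_⟩
  · intro i; dsimp only; rw [← f1 (i + (n - j))]; congr 1; omega
  · intro i; dsimp only; rw [← f2 (i + (n - j))]; congr 1; omega
  · intro i
    have := f3 (i + (n - j))
    dsimp only at this ⊢
    rwa [show i + (n - j) + j = i + n by omega, hd] at this
  · intro i
    have := f4 (i + (n - j))
    dsimp only at this ⊢
    rwa [show i + 1 + (n - j) = i + (n - j) + 1 by omega]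

theorem CycEx.mono {s n : ℕ} {d d' : ℕ → ℕ} (h : CycEx s n d') (hd : ∀ i, d i ≤ d' i) :
    CycEx s n d := by
  obtain ⟨Cf, cf, f1, f2, f3, f4⟩ := h
  exact ⟨Cf, cf, f1, f2, fun i => ⟨(f3 i).1, (hd i).trans (f3 i).2⟩, f4⟩

theorem CycEx.extend {s s' n : ℕ} {d e : ℕ → ℕ} (h : CycEx s' n d) (hs : s' ≤ s) (par : ℕ → Prop)
    [DecidablePred par]
    (hp : ∀ i, par (i + n) ↔ par i) (he : ∀ i, e (i + n) = e i)
    (hee : ∀ i, s' + e i + e (i + 1) ≤ s)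
    (hpe : ∀ i, e i ≠ 0 → e (i + 1) ≠ 0 → (par i ↔ ¬ par (i + 1))) :
    CycEx s n (fun i => d i + e i) := by
  obtain ⟨Cf, cf, f1, f2, f3, f4⟩ := h
  have hfs : ∀ i x, x ∈ Cf i → x < s' := fun i x hx => by simpa using (f3 i).1 hx
  refine ⟨fun i => Cf i ∪ (if par i then Ico s' (s' + e i) else Ico (s - e i) s), cf, ?_, f2, ?_, ?_⟩
  · intro i; simp [f1, hp, he]
  · intro i
    have := hee i
    constructor
    · intro x hx
      have := hfs i x
      simp at hx ⊢
      split_ifs at hx <;> simp at hx <;> grind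
    · rw [card_union_of_disjoint]
      · have := (f3 i).2
        split_ifs <;> simp <;> omega
      · rw [Finset.disjoint_left]; intro x hx
        have := hfs i x hx
        split_ifs <;> simp <;> omega
  · intro i
    refine ⟨?_, (f4 i).2⟩
    rw [← (f4 i).1]
    have h1 := hee i
    have h2 := hpe i
    ext x
    have h3 := hfs i x
    have h4 := hfs (i + 1) x
    by_cases hx : x < s'
    · simp; split_ifs <;> simp <;> grind
    · have a1 : x ∉ Cf i := fun hh => hx (h3 hh)
      have a2 : x ∉ Cf (i + 1) := fun hh => hx (h4 hh)
      simp [a1, a2]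
      split_ifs with p1 p2 p2 <;> simp <;> grind

theorem cyc_uniform_long {m n : ℕ} (hm : 3 ≤ m)
    (hn : (if 2 * m - 1 = 5 then 8 else if 2 * m - 1 ≤ 7 then 7 else 2 * m - 1) + 1 ≤ n) :
    CycEx (2 * m - 1) n (fun _ => m) := by
  have hn1 : 1 ≤ n := by omega
  have hn8 : 8 ≤ n := by split_ifs at hn <;> omega
  obtain ⟨Cf, cf, f1, f2, f3, f4, f5, f6, f7⟩ := path_core (s := 2 * m - 1) (n := n) (by omega) hn
    (fun _ => m) (fun _ _ => hm) (fun _ _ => by omega) (C := range m) (T := range m) (c := 0) (τ := 1)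
    (by intro x; simp; omega) (by intro x; simp; omega) (by simp; omega) (by simp; omega) (by simp)
    (by simp)
  refine CycEx.of_fin hn1 (by simp) Cf (fun i => if i = n then 0 else cf i) (by rw [f1, f2])
    (by simp [f3]) (fun i hi => ⟨(f5 i hi.le).1, (f5 i hi.le).2.ge⟩) ?_
  intro i hi
  rw [if_neg (by omega)]
  refine ⟨f6 i hi, ?_⟩
  split_ifs with h
  · obtain rfl : i = n - 1 := by omega
    rw [f4]; simp
  · exact f7 i (by omega)

theorem cyc_uniform_eq {m : ℕ} (hm : 3 ≤ m) : CycEx (2 * m - 1) (2 * m - 1) (fun _ => m) := by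
  obtain ⟨n, hn⟩ : ∃ n, n = 2 * m - 1 := ⟨_, rfl⟩
  rw [← hn]
  refine CycEx.of_fin (by omega) (by simp)
    (fun i => (range n).filter fun x => (i ≤ x → (x - i) % 2 = 0) ∧ (x < i → (x + n - i) % 2 = 0))
    (fun i => if i = n then 0 else i) ?_ (by simp) ?_ ?_
  · ext x; simp; intro h; omega
  · intro i hi
    refine ⟨filter_subset _ _, ?_⟩
    have : #((range m).image fun r => if i + 2 * r < n then i + 2 * r else i + 2 * r - n) = m := by
      rw [card_image_of_injOn, card_range]
      intro a ha b hb
      simp at ha hb ⊢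
      split_ifs <;> omega
    rw [← this]
    apply card_le_card
    intro x
    simp
    rintro r hr rfl
    split_ifs <;> omega
  · intro i hi
    constructor
    · ext x
      simp
      split_ifs <;> omega
    · split_ifs <;> omega

theorem cyc_uniform_even {n : ℕ} (hn : 6 ≤ n) (he : n % 2 = 0) : CycEx 5 n (fun _ => 3) := by
  by_cases h9 : 9 ≤ n
  · exact cyc_uniform_long (m := 3) le_rfl (by simpa using h9)
  · have : n = 6 ∨ n = 8 := by omega
    rcases this with rfl | rfl
    · refine CycEx.of_fin (by norm_num) (by simp)
        (fun i => [{0, 1, 2}, {0, 3, 4}, {1, 2, 3}, {0, 1, 4}, {0, 2, 3}, {1, 3, 4}, {0, 1, 2}].getD i ∅)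
        (fun i => [0, 3, 1, 0, 3, 1, 0].getD i 0) rfl rfl ?_ ?_
      · decide
      · decide
    · refine CycEx.of_fin (by norm_num) (by simp)
        (fun i => [{0, 1, 2}, {0, 3, 4}, {1, 2, 3}, {0, 1, 4}, {0, 2, 3}, {1, 2, 4}, {0, 1, 3},
          {2, 3, 4}, {0, 1, 2}].getD i ∅)
        (fun i => [0, 3, 1, 0, 2, 1, 3, 2, 0].getD i 0) rfl rfl ?_ ?_
      · decide
      · decide

theorem cyc_seven_six {a : ℕ → ℕ} (ha : ∀ i, a (i + 7) = a i) (haa : ∀ i, a i + a (i + 1) ≤ 1) :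
    CycEx 6 7 (fun i => 3 + a i) := by
  have key : ∃ j < 7, a (j + 1) = 0 ∧ a (j + 3) = 0 ∧ a (j + 5) = 0 ∧ a (j + 6) = 0 := by
    by_contra hcon
    push Not at hcon
    have h0 := hcon 0; have h1 := hcon 1; have h2 := hcon 2; have h3 := hcon 3
    have h4 := hcon 4; have h5 := hcon 5; have h6 := hcon 6
    have b0 := haa 0; have b1 := haa 1; have b2 := haa 2; have b3 := haa 3
    have b4 := haa 4; have b5 := haa 5; have b6 := haa 6
    have c0 := ha 0; have c1 := ha 1; have c2 := ha 2; have c3 := ha 3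
    have c4 := ha 4; have c5 := ha 5; have c6 := ha 6
    norm_num at h0 h1 h2 h3 h4 h5 h6 b0 b1 b2 b3 b4 b5 b6 c0 c1 c2 c3 c4 c5 c6
    omega
  obtain ⟨j, hj, j1, j3, j5, j6⟩ := key
  refine CycEx.rot (by simp [ha]) j hj ?_
  refine CycEx.of_fin (by norm_num) (fun i => by rw [show i + 7 + j = i + j + 7 by omega, ha])
    (fun i => [{0, 1, 2, 3}, {0, 4, 5}, {1, 2, 3, 4}, {0, 1, 5}, {0, 2, 3, 4}, {1, 2, 5}, {3, 4, 5},
      {0, 1, 2, 3}].getD i ∅)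
    (fun i => [0, 4, 1, 0, 2, 5, 3, 0].getD i 0) rfl rfl ?_ ?_
  · intro i hi
    constructor
    · revert i; decide
    · have := haa (i + j)
      have a1 : a (i + j) ≤ 1 := by omega
      rw [add_comm] at j1 j3 j5 j6
      have hcard : ∀ i < 7, #([{0, 1, 2, 3}, {0, 4, 5}, {1, 2, 3, 4}, {0, 1, 5}, {0, 2, 3, 4},
        {1, 2, 5}, {3, 4, 5}, ({0, 1, 2, 3} : Finset ℕ)].getD i ∅) = [4, 3, 4, 3, 4, 3, 3].getD i 0 := by
        decide
      rw [hcard i hi]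
      interval_cases i <;> simp only [List.getD_cons_zero, List.getD_cons_succ] <;> omega
  · decide

theorem cycle_lemma {s n : ℕ} (hs : 5 ≤ s) {d : ℕ → ℕ} (hper : ∀ i, d (i + n) = d i)
    (hd : ∀ i, d i + 2 ≤ s) (hdd : ∀ i, d i + d (i + 1) ≤ s + 1)
    (hodd : n % 2 = 1 → (if s = 5 then 9 else s) ≤ n) (heven : n % 2 = 0 → 6 ≤ n)
    (hn : n ≤ if s = 5 then 8 else if s ≤ 7 then 7 else s) : CycEx s n d := by
  rcases Nat.mod_two_eq_zero_or_one n with h | h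
  · have h6 := heven h
    refine CycEx.mono (d' := fun i => 3 + (d i - 3)) ?_ (fun i => by omega)
    refine CycEx.extend (s' := 5) (cyc_uniform_even h6 h) hs (fun i => i % 2 = 0) ?_ ?_ ?_ ?_
    · intro i; omega
    · intro i; simp [hper]
    · intro i; have := hd i; have := hd (i + 1); have := hdd i; omega
    · intro i; omega
  have ho := hodd h
  have hn1 : 1 ≤ n := by omega
  -- minimal modified degree, rotated to position zero
  obtain ⟨j, hj, hmin⟩ := exists_min_image (range n) d ⟨0, by simp; omega⟩
  have hmin' : ∀ i, d j ≤ d i := fun i => by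
    rw [← Function.Periodic.map_mod_nat (f := d) hper i]
    exact hmin _ (by simpa using Nat.mod_lt i hn1)
  have hjn : j < n := by simpa using hj
  refine CycEx.rot hper j hjn ?_
  obtain ⟨D, hD⟩ : ∃ D : ℕ → ℕ, D = fun i => d (i + j) := ⟨_, rfl⟩
  rw [← hD]
  have hDper : ∀ i, D (i + n) = D i := fun i => by
    rw [hD]; dsimp only; rw [show i + n + j = i + j + n by omega, hper]
  have hDd : ∀ i, D i + 2 ≤ s := fun i => by rw [hD]; exact hd _
  have hDD : ∀ i, D i + D (i + 1) ≤ s + 1 := fun i => by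
    rw [hD]; have := hdd (i + j); rwa [show i + j + 1 = i + 1 + j by omega] at this
  have hDmin : ∀ i, D 0 ≤ D i := fun i => by rw [hD]; simp; exact hmin' _
  clear hD hmin hmin' hper hd hdd hj hjn
  obtain ⟨m, hm⟩ : ∃ m, m = max (D 0) 3 := ⟨_, rfl⟩
  have hms : 2 * m - 1 ≤ s := by
    have := hDD 0; have := hDmin 1; have := hDd 0; simp at *; omega
  by_cases hspec : n = 7 ∧ m = 3
  · obtain ⟨rfl, hm3⟩ := hspec
    have hs7 : s = 6 ∨ s = 7 := by split_ifs at ho hn <;> omega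
    have hD0 : D 0 ≤ 3 := by omega
    rcases hs7 with rfl | rfl
    · refine CycEx.mono (cyc_seven_six (a := fun i => D i - 3) ?_ ?_) (fun i => by omega)
      · intro i; simp [hDper]
      · intro i; have := hDd i; have := hDd (i + 1); have := hDD i; omega
    · have hb := CycEx.extend (s := 7) (d := fun i => 3 + (if 5 ≤ D i ∨ (4 ≤ D i ∧ (i % 7) % 2 = 0) then 1 else 0))
        (e := fun i => (if 5 ≤ D i ∨ (4 ≤ D i ∧ (i % 7) % 2 = 1) then 1 else 0))
        (cyc_seven_six ?_ ?_) (by norm_num) (fun _ => True) ?_ ?_ ?_ ?_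
      · refine hb.mono ?_
        intro i
        have := hDd i
        split_ifs <;> omega
      · intro i; simp [hDper]
      · intro i
        have h1 := hDD i
        have h2 : (i + 1) % 7 = 0 → D (i + 1) ≤ 3 := fun h => by
          rw [← Function.Periodic.map_mod_nat (f := D) hDper, h]; exact hD0
        have h3 : i % 7 = 0 → D i ≤ 3 := fun h => by
          rw [← Function.Periodic.map_mod_nat (f := D) hDper, h]; exact hD0
        split_ifs <;> omega
      · simp
      · intro i; simp [hDper]
      · intro i
        have h1 := hDD i
        have h2 : (i + 1) % 7 = 0 → D (i + 1) ≤ 3 := fun h => by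
          rw [← Function.Periodic.map_mod_nat (f := D) hDper, h]; exact hD0
        have h3 : i % 7 = 0 → D i ≤ 3 := fun h => by
          rw [← Function.Periodic.map_mod_nat (f := D) hDper, h]; exact hD0
        split_ifs <;> omega
      · intro i
        have h1 := hDD i
        have h2 : (i + 1) % 7 = 0 → D (i + 1) ≤ 3 := fun h => by
          rw [← Function.Periodic.map_mod_nat (f := D) hDper, h]; exact hD0
        have h3 : i % 7 = 0 → D i ≤ 3 := fun h => by
          rw [← Function.Periodic.map_mod_nat (f := D) hDper, h]; exact hD0
        split_ifs <;> omega
  · have huni : CycEx (2 * m - 1) n (fun _ => m) := by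
      by_cases hmn : 2 * m - 1 = n
      · have := cyc_uniform_eq (m := m) (by omega)
        rwa [hmn] at this ⊢
      · apply cyc_uniform_long (by omega)
        split_ifs at ho hn ⊢ <;> omega
    refine CycEx.mono (d' := fun i => m + (D i - m)) ?_ (fun i => by omega)
    refine CycEx.extend huni hms (fun i => (i % n) % 2 = 0) ?_ ?_ ?_ ?_
    · intro i; simp
    · intro i; simp [hDper]
    · intro i
      have := hDd i; have := hDd (i + 1); have := hDD i; have := hDmin i; have := hDmin (i + 1)
      omega
    · intro i e1 e2
      have h2 : (i + 1) % n ≠ 0 := fun h => by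
        rw [← Function.Periodic.map_mod_nat (f := D) hDper, h] at e2; omega
      have h4 : (i + 1) % n = i % n + 1 := by
        have hi := Nat.mod_lt i hn1
        rw [← Nat.mod_add_mod] at h2 ⊢
        rcases Nat.lt_or_ge (i % n + 1) n with h | h
        · rw [Nat.mod_eq_of_lt h]
        · have : i % n + 1 = n := by omega
          rw [this] at h2; simp at h2
      rw [h4]; omega

end partD

section partE
open Finset

section graphpart
variable {V : Type*}

theorem mem_Einc {G : SimpleGraph V} {v : V} {e : Sym2 V} :
    e ∈ Einc G v ↔ ∃ a, G.Adj v a ∧ e = s(v, a) := by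
  constructor
  · rintro ⟨h1, h2⟩
    obtain ⟨a, rfl⟩ := Sym2.mem_iff_exists.1 h2
    exact ⟨a, h1, rfl⟩
  · rintro ⟨a, h, rfl⟩
    exact ⟨h, by simp⟩

theorem Einc_eq_image (G : SimpleGraph V) (v : V) : Einc G v = Set.image (fun a => s(v, a)) (G.neighborSet v) := by
  ext e
  rw [mem_Einc]
  simp [eq_comm]

theorem Einc_ncard (G : SimpleGraph V) (v : V) : (Einc G v).ncard = ndeg G v := by
  rw [Einc_eq_image, Set.ncard_image_of_injective]
  · rfl
  · intro a b h; exact Sym2.congr_right.1 h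

theorem strong_iff {G : SimpleGraph V} {φ : Sym2 V → ℕ} :
    IsStrongEdgeColoring G φ ↔ ∀ x y, G.Adj x y → Set.InjOn φ (Einc G x ∪ Einc G y) := by
  constructor
  · intro h x y hxy e he f hf hef
    by_contra hne
    have he1 : e ∈ G.edgeSet := by rcases he with he | he <;> exact he.1
    have hf1 : f ∈ G.edgeSet := by rcases hf with he | he <;> exact he.1
    refine h e he1 f hf1 hne ?_ hef
    rcases he with he | he <;> rcases hf with hf | hf
    · exact ⟨x, x, he.2, hf.2, Or.inl rfl⟩
    · exact ⟨x, y, he.2, hf.2, Or.inr hxy⟩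
    · exact ⟨y, x, he.2, hf.2, Or.inr hxy.symm⟩
    · exact ⟨y, y, he.2, hf.2, Or.inl rfl⟩
  · rintro h e he f hf hne ⟨u, v, hu, hv, huv⟩ hef
    apply hne
    rcases huv with rfl | huv
    · obtain ⟨a, rfl⟩ := Sym2.mem_iff_exists.1 hu
      exact h u a he (Or.inl ⟨he, hu⟩) (Or.inl ⟨hf, hv⟩) hef
    · exact h u v huv (Or.inl ⟨he, hu⟩) (Or.inr ⟨hf, hv⟩) hef

theorem leaf_unique {G : SimpleGraph V} {w : V} (hw : ndeg G w = 1) {a b : V} (ha : G.Adj w a)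
    (hb : G.Adj w b) : a = b := by
  unfold ndeg at hw
  obtain ⟨c, hc⟩ := Set.ncard_eq_one.1 hw
  have h1 : a ∈ G.neighborSet w := ha
  have h2 : b ∈ G.neighborSet w := hb
  rw [hc] at h1 h2
  rw [h1, h2]

/-- The graph has a strong edge-colouring with `s` colours. -/
def HasCol (s : ℕ) (G : SimpleGraph V) : Prop :=
  ∃ φ : Sym2 V → ℕ, (∀ e ∈ G.edgeSet, φ e < s) ∧ IsStrongEdgeColoring G φ

/-- A leaf edge whose inner end has at most one non-leaf neighbour can be coloured greedily. -/
theorem leaf_case [Finite V] {s : ℕ} {G : SimpleGraph V} {v w u : V} (hvw : G.Adj v w) (hw : ndeg G w = 1)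
    (hu : G.Adj v u) (hl : ∀ a, G.Adj v a → a ≠ u → ndeg G a = 1) (hs : ndeg G v + ndeg G u ≤ s + 1)
    (h : HasCol s (G.deleteEdges {s(v, w)})) : HasCol s G := by
  classical
  obtain ⟨φ, h1, h2⟩ := h
  set F := (Einc G v ∪ Einc G u) \ {s(v, w)} with hF
  have hFc : F.ncard < s := by
    have a1 : s(v, w) ∈ Einc G v ∪ Einc G u := Or.inl ⟨hvw, by simp⟩
    have a2 : F.ncard + 1 = (Einc G v ∪ Einc G u).ncard := Set.ncard_sdiff_singleton_add_one a1 (Set.toFinite _)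
    have a3 := Set.ncard_union_add_ncard_inter (Einc G v) (Einc G u)
    have a4 : 0 < (Einc G v ∩ Einc G u).ncard := by
      rw [Set.ncard_pos]; exact ⟨s(v, u), ⟨hu, by simp⟩, ⟨hu, by simp⟩⟩
    rw [Einc_ncard, Einc_ncard] at a3
    omega
  have hc : ∃ c < s, ∀ f ∈ F, φ f ≠ c := by
    by_contra hcon
    push Not at hcon
    have : (range s : Set ℕ) ⊆ Set.image φ F := by
      intro c hc
      obtain ⟨f, hf, hfc⟩ := hcon c (by simpa using hc)
      exact ⟨f, hf, hfc⟩
    have h3 := Set.ncard_le_ncard this (Set.toFinite _)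
    have h4 := Set.ncard_image_le (f := φ) (Set.toFinite F)
    rw [Set.ncard_coe_finset, card_range] at h3
    omega
  obtain ⟨c, hcs, hcF⟩ := hc
  have hw1 : ∀ e ∈ G.edgeSet, w ∈ e → e = s(v, w) := by
    intro e he hwe
    obtain ⟨a, rfl⟩ := Sym2.mem_iff_exists.1 hwe
    rw [leaf_unique hw (show G.Adj w a from he) hvw.symm, Sym2.eq_swap]
  have key : ∀ f ∈ G.edgeSet, f ≠ s(v, w) → EdgesNear G s(v, w) f → f ∈ F := by
    rintro f hf hne ⟨p, q, hp, hq, hpq⟩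
    refine ⟨?_, hne⟩
    have hqv : q = v → f ∈ Einc G v ∪ Einc G u := fun h => Or.inl ⟨hf, h ▸ hq⟩
    have hqw : q ≠ w := fun h => hne (hw1 f hf (h ▸ hq))
    rw [Sym2.mem_iff] at hp
    rcases hp with rfl | rfl
    · rcases hpq with rfl | hpq
      · exact hqv rfl
      · by_cases hqu : q = u
        · subst hqu; exact Or.inr ⟨hf, hq⟩
        · have hq1 := hl q hpq hqu
          obtain ⟨a, rfl⟩ := Sym2.mem_iff_exists.1 hq
          have : a = p := leaf_unique hq1 hf hpq.symm
          subst this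
          exact Or.inl ⟨hf, by simp⟩
    · rcases hpq with rfl | hpq
      · exact absurd rfl hqw
      · exact hqv (leaf_unique hw hpq hvw.symm)
  refine ⟨Function.update φ s(v, w) c, ?_, ?_⟩
  · intro e he
    by_cases hev : e = s(v, w)
    · rw [hev, Function.update_self]; exact hcs
    · rw [Function.update_of_ne hev]
      exact h1 e (by rw [SimpleGraph.edgeSet_deleteEdges]; exact ⟨he, hev⟩)
  · intro e he f hf hne hnear
    by_cases hev : e = s(v, w)
    · subst hev
      rw [Function.update_self, Function.update_of_ne hne.symm]
      exact (hcF f (key f hf hne.symm hnear)).symm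
    · by_cases hfv : f = s(v, w)
      · subst hfv
        rw [Function.update_self, Function.update_of_ne hev]
        obtain ⟨p, q, hp, hq, hpq⟩ := hnear
        exact hcF e (key e he hev ⟨q, p, hq, hp, by rcases hpq with h | h; exacts [Or.inl h.symm, Or.inr h.symm]⟩)
      · rw [Function.update_of_ne hev, Function.update_of_ne hfv]
        refine h2 e (by rw [SimpleGraph.edgeSet_deleteEdges]; exact ⟨he, hev⟩) f
          (by rw [SimpleGraph.edgeSet_deleteEdges]; exact ⟨hf, hfv⟩) hne ?_
        obtain ⟨p, q, hp, hq, hpq⟩ := hnear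
        refine ⟨p, q, hp, hq, ?_⟩
        rcases hpq with h | h
        · exact Or.inl h
        · right
          rw [SimpleGraph.deleteEdges_adj]
          refine ⟨h, ?_⟩
          intro hh
          simp only [Set.mem_singleton_iff] at hh
          have : w ∈ s(p, q) := by rw [hh]; simp
          rw [Sym2.mem_iff] at this
          rcases this with rfl | rfl
          · exact hev (hw1 e he hp)
          · exact hfv (hw1 f hf hq)

end graphpart

end partE

section partF
open Finset

section assemblepart
variable {V : Type*}

theorem extend_col {G : SimpleGraph V} {N : ℕ} (hN : 1 ≤ N) (z : ℕ → V) (cf : ℕ → ℕ)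
    (f : ℕ → V → ℕ) (φ' : Sym2 V → ℕ)
    (hinj : ∀ i < N, ∀ k < N, z (i+1) = z (k+1) → i = k)
    (hdeg : ∀ j ≤ N + 1, 2 ≤ ndeg G (z j))
    (hcons : ∀ j ≤ N, ∀ k ≤ N, s(z j, z (j+1)) = s(z k, z (k+1)) → cf j = cf k) :
    ∃ φ : Sym2 V → ℕ, (∀ j ≤ N, φ s(z j, z (j+1)) = cf j) ∧
      (∀ i < N, ∀ w, ndeg G w = 1 → φ s(z (i+1), w) = f i w) ∧
      (∀ e, (∀ i < N, z (i+1) ∉ e) → φ e = φ' e) := by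
  classical
  refine ⟨fun e => if h : ∃ j, j ≤ N ∧ e = s(z j, z (j+1)) then cf h.choose else
    if h : ∃ p : ℕ × V, p.1 < N ∧ ndeg G p.2 = 1 ∧ e = s(z (p.1+1), p.2) then f h.choose.1 h.choose.2
    else φ' e, ?_, ?_, ?_⟩
  · intro j hj
    have h : ∃ k, k ≤ N ∧ s(z j, z (j+1)) = s(z k, z (k+1)) := ⟨j, hj, rfl⟩
    simp only [dif_pos h]
    exact (hcons j hj _ h.choose_spec.1 h.choose_spec.2).symm
  · intro i hi w hw
    have h1 : ¬ ∃ k, k ≤ N ∧ s(z (i+1), w) = s(z k, z (k+1)) := by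
      rintro ⟨k, hk, he⟩
      have : w ∈ s(z k, z (k+1)) := by rw [← he]; simp
      rw [Sym2.mem_iff] at this
      rcases this with h | h
      · have := hdeg k (by omega); rw [← h] at this; omega
      · have := hdeg (k+1) (by omega); rw [← h] at this; omega
    have h2 : ∃ p : ℕ × V, p.1 < N ∧ ndeg G p.2 = 1 ∧ s(z (i+1), w) = s(z (p.1+1), p.2) :=
      ⟨(i, w), hi, hw, rfl⟩
    simp only [dif_neg h1, dif_pos h2]
    obtain ⟨a1, a2, a3⟩ := h2.choose_spec
    rw [Sym2.eq_iff] at a3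
    rcases a3 with ⟨b1, b2⟩ | ⟨b1, b2⟩
    · rw [← b2, ← hinj i hi _ a1 b1]
    · have := hdeg (i+1) (by omega); rw [b1] at this; omega
  · intro e he
    have h1 : ¬ ∃ k, k ≤ N ∧ e = s(z k, z (k+1)) := by
      rintro ⟨k, hk, rfl⟩
      rcases k with _ | k
      · exact he 0 (by omega) (by simp)
      · exact he k (by omega) (by simp)
    have h2 : ¬ ∃ p : ℕ × V, p.1 < N ∧ ndeg G p.2 = 1 ∧ e = s(z (p.1+1), p.2) := by
      rintro ⟨p, h, -, rfl⟩
      exact he p.1 h (by simp)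
    simp only [dif_neg h1, dif_neg h2]

theorem leaf_inj [Finite V] {G : SimpleGraph V} {x a b : V} (ha : G.Adj x a) (hb : G.Adj x b) (hab : a ≠ b)
    {C : Finset ℕ} {p q : ℕ} (hp : p ∈ C) (hq : q ∈ C) (hpq : p ≠ q) (hc : ndeg G x ≤ #C) :
    ∃ f : V → ℕ, (∀ w, G.Adj x w → w ≠ a → w ≠ b → f w ∈ C ∧ f w ≠ p ∧ f w ≠ q) ∧
      (∀ w, G.Adj x w → w ≠ a → w ≠ b → ∀ w', G.Adj x w' → w' ≠ a → w' ≠ b → f w = f w' → w = w') := by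
  classical
  have h1 : (G.neighborSet x \ {a, b}).encard ≤ ((C \ {p, q} : Finset ℕ) : Set ℕ).encard := by
    rw [← Set.Finite.cast_ncard_eq (Set.toFinite _), ← Set.Finite.cast_ncard_eq (Finset.finite_toSet _),
      Set.ncard_coe_finset]
    have e1 : (G.neighborSet x \ {a, b}).ncard + 2 = ndeg G x := by
      have := Set.ncard_sdiff_add_ncard_of_subset (s := {a, b}) (t := G.neighborSet x)
        (by intro y hy; rcases hy with rfl | rfl; exacts [ha, hb]) (Set.toFinite _)
      rw [Set.ncard_pair hab] at this
      exact this
    have e2 : #(C \ {p, q}) + 2 = #C := by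
      have := Finset.card_sdiff_add_card_eq_card (s := {p, q}) (t := C)
        (by intro y hy; simp at hy; rcases hy with rfl | rfl; exacts [hp, hq])
      rw [Finset.card_pair hpq] at this
      exact this
    have : (G.neighborSet x \ {a, b}).ncard ≤ #(C \ {p, q}) := by omega
    exact_mod_cast this
  obtain ⟨f, hf1, hf2⟩ := (Set.toFinite (G.neighborSet x \ {a, b})).exists_injOn_of_encard_le h1
  refine ⟨f, ?_, ?_⟩
  · intro w hw hwa hwb
    have := hf1 (show w ∈ G.neighborSet x \ {a, b} from ⟨hw, by simp [hwa, hwb]⟩)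
    simp at this
    tauto
  · intro w hw hwa hwb w' hw' hwa' hwb' h
    exact hf2 ⟨hw, by simp [hwa, hwb]⟩ ⟨hw', by simp [hwa', hwb']⟩ h

theorem assemble [Finite V] {G : SimpleGraph V} {s N : ℕ} (hN : 1 ≤ N) (z : ℕ → V)
    (Cf : ℕ → Finset ℕ) (cf : ℕ → ℕ) (φ' : Sym2 V → ℕ)
    (hinj : ∀ i < N, ∀ k < N, z (i+1) = z (k+1) → i = k)
    (hadj : ∀ j ≤ N, G.Adj (z j) (z (j+1)))
    (hne : ∀ i < N, z i ≠ z (i+2))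
    (hleaf : ∀ i < N, ∀ w, G.Adj (z (i+1)) w → w = z i ∨ w = z (i+2) ∨ ndeg G w = 1)
    (hdeg : ∀ j ≤ N + 1, 2 ≤ ndeg G (z j))
    (hcons : ∀ j ≤ N, ∀ k ≤ N, s(z j, z (j+1)) = s(z k, z (k+1)) → cf j = cf k)
    (hCd : ∀ i < N, ndeg G (z (i+1)) ≤ #(Cf (i+1)))
    (hCs : ∀ j ≤ N + 1, Cf j ⊆ range s)
    (hlink : ∀ j ≤ N, Cf j ∩ Cf (j+1) = {cf j})
    (hcf : ∀ j < N, cf j ≠ cf (j+1))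
    (hcompat : ∀ j ≤ N + 1, ∀ i < N, z j = z (i+1) → Cf j = Cf (i+1))
    (hφeq : ∀ j ≤ N, ((∀ i < N, z j ≠ z (i+1)) ∨ (∀ i < N, z (j+1) ≠ z (i+1))) →
      φ' s(z j, z (j+1)) = cf j)
    (hend : ∀ j ≤ N + 1, (∀ i < N, z j ≠ z (i+1)) →
      Set.InjOn φ' (Einc G (z j)) ∧ ∀ e ∈ Einc G (z j), φ' e ∈ Cf j)
    (hout : ∀ x y, G.Adj x y → (∀ i < N, x ≠ z (i+1)) → (∀ i < N, y ≠ z (i+1)) →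
      Set.InjOn φ' (Einc G x ∪ Einc G y))
    (houts : ∀ x y, G.Adj x y → (∀ i < N, x ≠ z (i+1)) → (∀ i < N, y ≠ z (i+1)) → φ' s(x, y) < s) :
    HasCol s G := by
  classical
  have hmem : ∀ j ≤ N, cf j ∈ Cf j ∧ cf j ∈ Cf (j+1) := by
    intro j hj
    have : cf j ∈ Cf j ∩ Cf (j+1) := by rw [hlink j hj]; simp
    simpa using this
  have hf : ∀ i, ∃ f : V → ℕ, i < N → (∀ w, G.Adj (z (i+1)) w → w ≠ z i → w ≠ z (i+2) → f w ∈ Cf (i+1) ∧ f w ≠ cf i ∧ f w ≠ cf (i+1)) ∧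
      (∀ w, G.Adj (z (i+1)) w → w ≠ z i → w ≠ z (i+2) → ∀ w', G.Adj (z (i+1)) w' → w' ≠ z i → w' ≠ z (i+2) → f w = f w' → w = w') := by
    intro i
    by_cases hi : i < N
    · obtain ⟨f, h⟩ := leaf_inj (hadj i (by omega)).symm (hadj (i+1) (by omega)) (hne i hi)
        (hmem i (by omega)).2 (hmem (i+1) (by omega)).1 (hcf i hi) (hCd i hi)
      exact ⟨f, fun _ => h⟩
    · exact ⟨fun _ => 0, fun h => absurd h hi⟩
  choose f hf using hf
  obtain ⟨φ, P1, P2, P3⟩ := extend_col hN z cf f φ' hinj hdeg hcons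
  -- an outer neighbour of an inner vertex
  have P4 : ∀ x, (∀ i < N, x ≠ z (i+1)) → ndeg G x ≠ 1 → ∀ e ∈ Einc G x, φ e = φ' e := by
    intro x hx hx1 e he
    obtain ⟨a, ha, rfl⟩ := mem_Einc.1 he
    by_cases haz : ∃ i < N, a = z (i+1)
    · obtain ⟨i, hi, rfl⟩ := haz
      rcases hleaf i hi x ha.symm with rfl | rfl | h
      · rw [P1 i (by omega), hφeq i (by omega) (Or.inl hx)]
      · rw [Sym2.eq_swap, P1 (i+1) (by omega), hφeq (i+1) (by omega) (Or.inr hx)]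
      · exact absurd h hx1
    · push Not at haz
      apply P3
      intro i hi hm
      rw [Sym2.mem_iff] at hm
      rcases hm with h | h
      · exact hx i hi h.symm
      · exact haz i hi h.symm
  have Q0 : ∀ i < N, Set.InjOn φ (Einc G (z (i+1))) ∧ ∀ e ∈ Einc G (z (i+1)), φ e ∈ Cf (i+1) := by
    intro i hi
    have c1 : φ s(z (i+1), z i) = cf i := by rw [Sym2.eq_swap, P1 i (by omega)]
    have c2 : φ s(z (i+1), z (i+2)) = cf (i+1) := P1 (i+1) (by omega)
    have c3 : ∀ w, G.Adj (z (i+1)) w → w ≠ z i → w ≠ z (i+2) → φ s(z (i+1), w) = f i w := by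
      intro w h1 h2 h3
      rcases hleaf i hi w h1 with h | h | h
      · exact absurd h h2
      · exact absurd h h3
      · exact P2 i hi w h
    obtain ⟨f1, f2⟩ := hf i hi
    have hc := hcf i hi
    constructor
    · intro e he e' he' hee
      obtain ⟨a, ha, rfl⟩ := mem_Einc.1 he
      obtain ⟨b, hb, rfl⟩ := mem_Einc.1 he'
      congr 2
      by_cases a1 : a = z i
      · by_cases b1 : b = z i
        · rw [a1, b1]
        · by_cases b2 : b = z (i+2)
          · subst a1 b2; rw [c1, c2] at hee; exact absurd hee hc
          · subst a1; rw [c1, c3 b hb b1 b2] at hee; exact absurd hee.symm (f1 b hb b1 b2).2.1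
      · by_cases a2 : a = z (i+2)
        · by_cases b1 : b = z i
          · subst a2 b1; rw [c1, c2] at hee; exact absurd hee.symm hc
          · by_cases b2 : b = z (i+2)
            · rw [a2, b2]
            · subst a2; rw [c2, c3 b hb b1 b2] at hee; exact absurd hee.symm (f1 b hb b1 b2).2.2
        · rw [c3 a ha a1 a2] at hee
          by_cases b1 : b = z i
          · subst b1; rw [c1] at hee; exact absurd hee (f1 a ha a1 a2).2.1
          · by_cases b2 : b = z (i+2)
            · subst b2; rw [c2] at hee; exact absurd hee (f1 a ha a1 a2).2.2
            · rw [c3 b hb b1 b2] at hee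
              exact f2 a ha a1 a2 b hb b1 b2 hee
    · intro e he
      obtain ⟨a, ha, rfl⟩ := mem_Einc.1 he
      by_cases a1 : a = z i
      · subst a1; rw [c1]; exact (hmem i (by omega)).2
      · by_cases a2 : a = z (i+2)
        · subst a2; rw [c2]; exact (hmem (i+1) (by omega)).1
        · rw [c3 a ha a1 a2]; exact (f1 a ha a1 a2).1
  have Q : ∀ j ≤ N + 1, Set.InjOn φ (Einc G (z j)) ∧ ∀ e ∈ Einc G (z j), φ e ∈ Cf j := by
    intro j hj
    by_cases hz : ∃ i < N, z j = z (i+1)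
    · obtain ⟨i, hi, h⟩ := hz
      rw [hcompat j hj i hi h, h]
      exact Q0 i hi
    · push Not at hz
      have h4 := P4 (z j) hz (by have := hdeg j hj; omega)
      obtain ⟨h1, h2⟩ := hend j hj hz
      refine ⟨?_, ?_⟩
      · intro e he e' he' hee
        rw [h4 e he, h4 e' he'] at hee
        exact h1 he he' hee
      · intro e he
        rw [h4 e he]; exact h2 e he
  have L : ∀ j ≤ N, Set.InjOn φ (Einc G (z j) ∪ Einc G (z (j+1))) := by
    intro j hj
    obtain ⟨i1, m1⟩ := Q j (by omega)
    obtain ⟨i2, m2⟩ := Q (j+1) (by omega)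
    have hm1 : s(z j, z (j+1)) ∈ Einc G (z j) := ⟨hadj j hj, by simp⟩
    have hm2 : s(z j, z (j+1)) ∈ Einc G (z (j+1)) := ⟨hadj j hj, by simp⟩
    have key : ∀ e ∈ Einc G (z j), ∀ e' ∈ Einc G (z (j+1)), φ e = φ e' → e = e' := by
      intro e he e' he' hee
      have h1 : φ e ∈ Cf j ∩ Cf (j+1) := by
        rw [Finset.mem_inter]; exact ⟨m1 e he, by rw [hee]; exact m2 e' he'⟩
      rw [hlink j hj, Finset.mem_singleton] at h1
      rw [i1 he hm1 (by rw [h1, P1 j hj]), i2 he' hm2 (by rw [← hee, h1, P1 j hj])]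
    rintro e (he | he) e' (he' | he') hee
    · exact i1 he he' hee
    · exact key e he e' he' hee
    · exact (key e' he' e he hee.symm).symm
    · exact i2 he he' hee
  have R : ∀ i < N, ∀ y, G.Adj (z (i+1)) y → Set.InjOn φ (Einc G (z (i+1)) ∪ Einc G y) := by
    intro i hi y hy
    rcases hleaf i hi y hy with rfl | rfl | h
    · rw [Set.union_comm]; exact L i (by omega)
    · exact L (i+1) (by omega)
    · have : Einc G y ⊆ Einc G (z (i+1)) := by
        intro e he
        obtain ⟨a, ha, rfl⟩ := mem_Einc.1 he
        rw [leaf_unique h ha hy.symm]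
        exact ⟨hy.symm, by simp⟩
      rw [Set.union_eq_self_of_subset_right this]
      exact (Q0 i hi).1
  refine ⟨φ, ?_, ?_⟩
  · intro e
    refine Sym2.ind (fun x y hxy => ?_) e
    have hxy : G.Adj x y := hxy
    by_cases hx : ∃ i < N, x = z (i+1)
    · obtain ⟨i, hi, rfl⟩ := hx
      simpa using hCs (i+1) (by omega) ((Q0 i hi).2 s(z (i+1), y) ⟨hxy, by simp⟩)
    · by_cases hy : ∃ i < N, y = z (i+1)
      · obtain ⟨i, hi, rfl⟩ := hy
        simpa using hCs (i+1) (by omega) ((Q0 i hi).2 s(x, z (i+1)) ⟨hxy, by simp⟩)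
      · push Not at hx hy
        rw [P3]
        · exact houts x y hxy hx hy
        · intro i hi hm
          rw [Sym2.mem_iff] at hm
          rcases hm with h | h
          · exact hx i hi h.symm
          · exact hy i hi h.symm
  · rw [strong_iff]
    intro x y hxy
    by_cases hx : ∃ i < N, x = z (i+1)
    · obtain ⟨i, hi, rfl⟩ := hx
      exact R i hi y hxy
    · by_cases hy : ∃ i < N, y = z (i+1)
      · obtain ⟨i, hi, rfl⟩ := hy
        rw [Set.union_comm]
        exact R i hi x hxy.symm
      · push Not at hx hy
        have P5 : ∀ x y, G.Adj x y → (∀ i < N, x ≠ z (i+1)) → (∀ i < N, y ≠ z (i+1)) →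
            ∀ e ∈ Einc G x, φ e = φ' e := by
          intro x y hxy hx hy
          by_cases h1 : ndeg G x = 1
          · intro e he
            obtain ⟨a, ha, rfl⟩ := mem_Einc.1 he
            rw [leaf_unique h1 ha hxy]
            apply P3
            intro i hi hm
            rw [Sym2.mem_iff] at hm
            rcases hm with h | h
            · exact hx i hi h.symm
            · exact hy i hi h.symm
          · exact P4 x hx h1
        have h6 : ∀ e ∈ Einc G x ∪ Einc G y, φ e = φ' e := by
          rintro e (he | he)
          · exact P5 x y hxy hx hy e he
          · exact P5 y x hxy.symm hy hx e he
        intro e he e' he' hee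
        rw [h6 e he, h6 e' he'] at hee
        exact hout x y hxy hx hy he he' hee

end assemblepart

end partF

section partG
open Finset

section redpart
variable {V : Type*}

/-- The hereditary hypotheses on the graph. -/
structure Hyp (s : ℕ) (G : SimpleGraph V) : Prop where
  deg : ∀ v, ndeg G v + 2 ≤ s
  sum : ∀ x y, G.Adj x y → ndeg G x + ndeg G y ≤ s + 1
  odd : ∀ (v : V) (c : G.Walk v v), c.IsCycle → c.length % 2 = 1 → (if s = 5 then 9 else s) ≤ c.length
  even : ∀ (v : V) (c : G.Walk v v), c.IsCycle → c.length % 2 = 0 → 6 ≤ c.length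
  mad : ∀ S : Finset V, S.Nonempty → 3 * ellSigma s * {e ∈ G.edgeSet | ∀ v ∈ e, v ∈ S}.ncard <
    3 * ellSigma s * #S + {e ∈ G.edgeSet | ∀ v ∈ e, v ∈ S}.ncard

theorem ndeg_mono [Finite V] {G G' : SimpleGraph V} (h : G' ≤ G) (v : V) : ndeg G' v ≤ ndeg G v :=
  Set.ncard_le_ncard (fun _ hw => h hw) (Set.toFinite _)

theorem ell_pos (s : ℕ) : 7 ≤ ellSigma s := by
  unfold ellSigma; split_ifs <;> omega

theorem Hyp.mono [Finite V] {s : ℕ} {G G' : SimpleGraph V} (H : Hyp s G) (h : G' ≤ G) : Hyp s G' where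
  deg v := by have := H.deg v; have := ndeg_mono h v; omega
  sum x y hxy := by
    have := H.sum x y (h hxy); have := ndeg_mono h x; have := ndeg_mono h y; omega
  odd v c hc hl := by
    have := H.odd v (c.mapLe h) (hc.mapLe h) (by simpa using hl)
    simpa using this
  even v c hc hl := by
    have := H.even v (c.mapLe h) (hc.mapLe h) (by simpa using hl)
    simpa using this
  mad S hS := by
    have h1 := H.mad S hS
    have h2 : {e ∈ G'.edgeSet | ∀ v ∈ e, v ∈ S}.ncard ≤ {e ∈ G.edgeSet | ∀ v ∈ e, v ∈ S}.ncard :=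
      Set.ncard_le_ncard (fun e he => ⟨SimpleGraph.edgeSet_mono h he.1, he.2⟩) (Set.toFinite _)
    have := ell_pos s
    nlinarith

theorem del_lt [Finite V] {G : SimpleGraph V} {D : Set (Sym2 V)} {e : Sym2 V} (h1 : e ∈ G.edgeSet) (h2 : e ∈ D) :
    (G.deleteEdges D).edgeSet.ncard < G.edgeSet.ncard := by
  apply Set.ncard_lt_ncard _ (Set.toFinite _)
  rw [SimpleGraph.edgeSet_deleteEdges]
  refine ⟨Set.sdiff_subset, fun h => (h h1).2 h2⟩

theorem cycle_red [Finite V] {s : ℕ} {G : SimpleGraph V} (hs : 5 ≤ s) (H : Hyp s G) {n : ℕ} (hn3 : 3 ≤ n)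
    (hn : n ≤ ellSigma s) (z : ℕ → V) (hper : ∀ i, z (i + n) = z i)
    (hinj : ∀ i < n, ∀ k < n, z i = z k → i = k)
    (hadj : ∀ i, G.Adj (z i) (z (i+1)))
    (hleaf : ∀ i w, G.Adj (z (i+1)) w → w = z i ∨ w = z (i+2) ∨ ndeg G w = 1)
    (hdeg : ∀ i, 2 ≤ ndeg G (z i))
    (hodd : n % 2 = 1 → (if s = 5 then 9 else s) ≤ n) (heven : n % 2 = 0 → 6 ≤ n)
    (IH : ∀ G', G' ≤ G → G'.edgeSet.ncard < G.edgeSet.ncard → HasCol s G') : HasCol s G := by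
  classical
  obtain ⟨Cf, cf, p1, p2, p3, p4⟩ := cycle_lemma (s := s) (n := n) hs (d := fun i => ndeg G (z i))
    (fun i => by simp [hper]) (fun i => H.deg _) (fun i => H.sum _ _ (hadj i)) hodd heven hn
  have zp : Function.Periodic z n := hper
  have cp : Function.Periodic cf n := p2
  have Cp : Function.Periodic Cf n := p1
  have hmod : ∀ a b, z a = z b → a % n = b % n := by
    intro a b hab
    rw [← zp.map_mod_nat a, ← zp.map_mod_nat b] at hab
    exact hinj _ (Nat.mod_lt _ (by omega)) _ (Nat.mod_lt _ (by omega)) hab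
  have hZ : ∀ a, ∃ i < n, z a = z (i+1) := by
    intro a
    refine ⟨(a + (n - 1)) % n, Nat.mod_lt _ (by omega), ?_⟩
    rw [← zp.map_mod_nat a, ← zp.map_mod_nat ((a + (n-1)) % n + 1)]
    congr 1
    rw [Nat.mod_add_mod, show a + (n - 1) + 1 = a + n by omega, Nat.add_mod_right]
  set D : Set (Sym2 V) := {e | ∃ i, z i ∈ e} with hD
  obtain ⟨φ', h1, h2⟩ := IH (G.deleteEdges D) (SimpleGraph.deleteEdges_le _)
    (del_lt (e := s(z 0, z 1)) (hadj 0) ⟨0, by simp⟩)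
  rw [strong_iff] at h2
  have hE : ∀ x y, G.Adj x y → (∀ i < n, x ≠ z (i+1)) → (∀ i < n, y ≠ z (i+1)) →
      (G.deleteEdges D).Adj x y := by
    intro x y hxy hx hy
    rw [SimpleGraph.deleteEdges_adj]
    refine ⟨hxy, ?_⟩
    rintro ⟨k, hk⟩
    obtain ⟨i, hi, h⟩ := hZ k
    rw [h, Sym2.mem_iff] at hk
    rcases hk with hk | hk
    · exact hx i hi hk.symm
    · exact hy i hi hk.symm
  have hE2 : ∀ x y, G.Adj x y → (∀ i < n, x ≠ z (i+1)) → (∀ i < n, y ≠ z (i+1)) →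
      Einc G x ⊆ Einc (G.deleteEdges D) x := by
    intro x y hxy hx hy e he
    obtain ⟨a, ha, rfl⟩ := mem_Einc.1 he
    refine ⟨hE x a ha hx ?_, by simp⟩
    rintro i hi rfl
    rcases hleaf i x ha.symm with h | h | h
    · obtain ⟨k, hk, h'⟩ := hZ i
      exact hx k hk (h.trans h')
    · obtain ⟨k, hk, h'⟩ := hZ (i+2)
      exact hx k hk (h.trans h')
    · exact hy i hi (leaf_unique h hxy ha)
  refine assemble (by omega : 1 ≤ n) z Cf cf φ' ?_ (fun j _ => hadj j) ?_ (fun i _ => hleaf i)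
    (fun j _ => hdeg j) ?_ (fun i _ => (p3 (i+1)).2) (fun j _ => (p3 j).1) (fun j _ => (p4 j).1)
    (fun j _ => (p4 j).2) ?_ ?_ ?_ ?_ ?_
  · intro i hi k hk h
    have : i ≡ k [MOD n] := Nat.ModEq.add_right_cancel' 1 (hmod _ _ h)
    exact Nat.ModEq.eq_of_lt_of_lt this hi hk
  · intro i hi h
    have h1 : i + 0 ≡ i + 2 [MOD n] := hmod _ _ h
    have h2 := Nat.ModEq.add_left_cancel' i h1
    have := Nat.ModEq.eq_of_lt_of_lt h2 (by omega) (by omega)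
    omega
  · intro j hj k hk h
    rw [Sym2.eq_iff] at h
    rcases h with ⟨a, -⟩ | ⟨a, b⟩
    · rw [← cp.map_mod_nat j, ← cp.map_mod_nat k, hmod _ _ a]
    · have a' : j ≡ k + 1 [MOD n] := hmod _ _ a
      have b' : j + 1 ≡ k [MOD n] := hmod _ _ b
      have c' : k + 2 ≡ k + 0 [MOD n] := (a'.symm.add_right 1).trans b'
      have h2 := Nat.ModEq.add_left_cancel' k c'
      have := Nat.ModEq.eq_of_lt_of_lt h2 (by omega) (by omega)
      omega
  · intro j hj i hi h
    rw [← Cp.map_mod_nat j, ← Cp.map_mod_nat (i+1), hmod _ _ h]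
  · intro j hj h
    obtain ⟨i, hi, h'⟩ := hZ j
    obtain ⟨k, hk, h''⟩ := hZ (j+1)
    rcases h with h | h
    · exact absurd h' (h i hi)
    · exact absurd h'' (h k hk)
  · intro j hj h
    obtain ⟨i, hi, h'⟩ := hZ j
    exact absurd h' (h i hi)
  · intro x y hxy hx hy
    exact (h2 x y (hE x y hxy hx hy)).mono
      (Set.union_subset_union (hE2 x y hxy hx hy) (hE2 y x hxy.symm hy hx))
  · intro x y hxy hx hy
    exact h1 _ (hE x y hxy hx hy)

theorem thread_red [Finite V] {s : ℕ} {G : SimpleGraph V} (hs : 5 ≤ s) (H : Hyp s G) {N : ℕ}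
    (hN : N = ellSigma s) (z : ℕ → V)
    (hinj : ∀ i < N, ∀ k < N, z (i+1) = z (k+1) → i = k)
    (h0 : ∀ i < N, z 0 ≠ z (i+1)) (hN1 : ∀ i < N, z (N+1) ≠ z (i+1))
    (hadj : ∀ j ≤ N, G.Adj (z j) (z (j+1)))
    (hne : ∀ i < N, z i ≠ z (i+2))
    (hleaf : ∀ i < N, ∀ w, G.Adj (z (i+1)) w → w = z i ∨ w = z (i+2) ∨ ndeg G w = 1)
    (hdeg : ∀ j ≤ N + 1, 2 ≤ ndeg G (z j))
    (IH : ∀ G', G' ≤ G → G'.edgeSet.ncard < G.edgeSet.ncard → HasCol s G') : HasCol s G := by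
  classical
  have hN7 := ell_pos s
  rw [← hN] at hN7
  have hin : ∀ j, 1 ≤ j → j ≤ N → ∀ k, 1 ≤ k → k ≤ N → z j = z k → j = k := by
    intro j hj hj' k hk hk' h
    have := hinj (j-1) (by omega) (k-1) (by omega)
      (by rw [show j - 1 + 1 = j by omega, show k - 1 + 1 = k by omega]; exact h)
    omega
  have h0' : ∀ j, 1 ≤ j → j ≤ N → z 0 ≠ z j := by
    intro j hj hj'
    have := h0 (j-1) (by omega)
    rwa [show j - 1 + 1 = j by omega] at this
  have hN1' : ∀ j, 1 ≤ j → j ≤ N → z (N+1) ≠ z j := by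
    intro j hj hj'
    have := hN1 (j-1) (by omega)
    rwa [show j - 1 + 1 = j by omega] at this
  set D : Set (Sym2 V) := {e | (∃ i < N, z (i+1) ∈ e) ∧ e ≠ s(z 0, z 1) ∧ e ≠ s(z N, z (N+1))} with hD
  obtain ⟨φ', h1, h2⟩ := IH (G.deleteEdges D) (SimpleGraph.deleteEdges_le _)
    (del_lt (e := s(z 1, z 2)) (hadj 1 (by omega)) ⟨⟨0, by omega, by simp⟩, by
      rw [Ne, Sym2.eq_iff]
      rintro (⟨a, b⟩ | ⟨a, b⟩)
      · exact h0' 1 (by omega) (by omega) a.symm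
      · exact h0' 2 (by omega) (by omega) b.symm, by
      rw [Ne, Sym2.eq_iff]
      rintro (⟨a, b⟩ | ⟨a, b⟩)
      · exact hN1' 2 (by omega) (by omega) b.symm
      · exact hN1' 1 (by omega) (by omega) a.symm⟩)
  rw [strong_iff] at h2
  have hE : ∀ x y, G.Adj x y → (∀ i < N, x ≠ z (i+1)) → (∀ i < N, y ≠ z (i+1)) →
      (G.deleteEdges D).Adj x y := by
    intro x y hxy hx hy
    rw [SimpleGraph.deleteEdges_adj]
    refine ⟨hxy, ?_⟩
    rintro ⟨⟨i, hi, hk⟩, -⟩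
    rw [Sym2.mem_iff] at hk
    rcases hk with hk | hk
    · exact hx i hi hk.symm
    · exact hy i hi hk.symm
  have e0 : (G.deleteEdges D).Adj (z 0) (z 1) := by
    rw [SimpleGraph.deleteEdges_adj]
    exact ⟨hadj 0 (by omega), fun h => h.2.1 rfl⟩
  have eN : (G.deleteEdges D).Adj (z N) (z (N+1)) := by
    rw [SimpleGraph.deleteEdges_adj]
    exact ⟨hadj N (by omega), fun h => h.2.2 rfl⟩
  have hE2 : ∀ x, (∀ i < N, x ≠ z (i+1)) → (ndeg G x = 1 → ∃ y, G.Adj x y ∧ ∀ i < N, y ≠ z (i+1)) →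
      Einc G x ⊆ Einc (G.deleteEdges D) x := by
    intro x hx hy e he
    obtain ⟨a, ha, rfl⟩ := mem_Einc.1 he
    refine ⟨?_, by simp⟩
    by_cases haz : ∃ i < N, a = z (i+1)
    · obtain ⟨i, hi, rfl⟩ := haz
      rcases hleaf i hi x ha.symm with rfl | rfl | h
      · rcases i with _ | i
        · exact e0
        · exact absurd rfl (hx i (by omega))
      · by_cases hi2 : i + 1 < N
        · exact absurd rfl (hx (i+1) hi2)
        · have : N = i + 1 := by omega
          subst this
          exact eN.symm
      · obtain ⟨y, hy1, hy2⟩ := hy h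
        exact absurd (leaf_unique h hy1 ha) (hy2 i hi)
    · push Not at haz
      exact hE x a ha hx haz
  have hE0 := hE2 (z 0) h0 (fun h => by have := hdeg 0 (by omega); omega)
  have hEN := hE2 (z (N+1)) hN1 (fun h => by have := hdeg (N+1) (by omega); omega)
  set C := (Set.toFinite (Set.image φ' (Einc G (z 0)))).toFinset with hC
  set T := (Set.toFinite (Set.image φ' (Einc G (z (N+1))))).toFinset with hT
  have hcc : ∀ x, #(Set.toFinite (Set.image φ' (Einc G x))).toFinset ≤ ndeg G x := by
    intro x
    rw [← Set.ncard_eq_toFinset_card (Set.image φ' (Einc G x)) (Set.toFinite _), ← Einc_ncard]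
    exact Set.ncard_image_le (Set.toFinite _)
  obtain ⟨Cf, cf, q1, q2, q3, q4, q5, q6, q7⟩ := path_lemma (s := s) (n := N + 1) hs
    (by rw [hN]; exact le_refl _) (fun i => ndeg G (z i)) (fun i _ => H.deg _)
    (fun i hi => H.sum _ _ (hadj i (by omega))) (C := C) (T := T)
    (c := φ' s(z 0, z 1)) (τ := φ' s(z N, z (N+1)))
    (by
      intro c hc
      simp only [hC, Set.Finite.mem_toFinset] at hc
      obtain ⟨e, he, rfl⟩ := hc
      exact Finset.mem_range.2 (h1 e (hE0 he).1))
    (by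
      intro c hc
      simp only [hT, Set.Finite.mem_toFinset] at hc
      obtain ⟨e, he, rfl⟩ := hc
      exact Finset.mem_range.2 (h1 e (hEN he).1))
    (by
      simp only [hC, Set.Finite.mem_toFinset]
      exact ⟨_, ⟨hadj 0 (by omega), by simp⟩, rfl⟩)
    (by
      simp only [hT, Set.Finite.mem_toFinset]
      exact ⟨_, ⟨hadj N (by omega), by simp⟩, rfl⟩)
    (hcc _) (hcc _)
  have hsplit : ∀ j ≤ N + 1, (∀ i < N, z j ≠ z (i+1)) → j = 0 ∨ j = N + 1 := by
    intro j hj h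
    by_contra hcon
    have := h (j-1) (by omega)
    rw [show j - 1 + 1 = j by omega] at this
    exact this rfl
  refine assemble (by omega : 1 ≤ N) z Cf cf φ' hinj hadj hne hleaf hdeg ?_
    (fun i hi => (q5 (i+1) (by omega)).2) (fun j hj => (q5 j (by omega)).1) (fun j hj => q6 j (by omega))
    (fun j hj => q7 j (by omega)) ?_ ?_ ?_ ?_ ?_
  · intro j hj k hk h
    suffices j = k by rw [this]
    rw [Sym2.eq_iff] at h
    rcases h with ⟨a, b⟩ | ⟨a, b⟩
    · rcases Nat.eq_zero_or_pos j with rfl | hj0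
      · by_contra hk0
        exact h0' k (by omega) hk a
      · rcases Nat.eq_zero_or_pos k with rfl | hk0
        · exact absurd a.symm (h0' j hj0 hj)
        · exact hin j hj0 hj k hk0 hk a
    · exfalso
      have a1 : k = N ∨ k < N := by omega
      have b1 : j = N ∨ j < N := by omega
      rcases Nat.eq_zero_or_pos j with rfl | hj0
      · rcases a1 with rfl | a1
        · have := hin 1 (by omega) (by omega) k (by omega) (by omega) b
          omega
        · exact h0' (k+1) (by omega) (by omega) a
      · rcases Nat.eq_zero_or_pos k with rfl | hk0
        · rcases b1 with rfl | b1
          · have := hin j (by omega) (by omega) 1 (by omega) (by omega) a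
            omega
          · exact h0' (j+1) (by omega) (by omega) b.symm
        · rcases a1 with rfl | a1
          · exact hN1' j hj0 hj a.symm
          · rcases b1 with rfl | b1
            · exact hN1' k hk0 hk b
            · have := hin j (by omega) (by omega) (k+1) (by omega) (by omega) a
              have := hin (j+1) (by omega) (by omega) k (by omega) (by omega) b
              omega
  · intro j hj i hi h
    have : j = i + 1 := by
      rcases Nat.eq_zero_or_pos j with rfl | hj0
      · exact absurd h (h0 i hi)
      · by_cases hjN : j = N + 1
        · subst hjN; exact absurd h (hN1 i hi)
        · exact hin j hj0 (by omega) (i+1) (by omega) (by omega) h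
    rw [this]
  · intro j hj h
    rcases h with h | h
    · rcases hsplit j (by omega) h with rfl | h'
      · exact q3.symm
      · omega
    · rcases hsplit (j+1) (by omega) h with h' | h'
      · omega
      · have : j = N := by omega
        subst this
        exact q4.symm
  · intro j hj h
    have hi : ∀ x y, (G.deleteEdges D).Adj x y → Einc G x ⊆ Einc (G.deleteEdges D) x → Set.InjOn φ' (Einc G x) := by
      intro x y hxy hx
      exact (h2 x y hxy).mono (hx.trans Set.subset_union_left)
    rcases hsplit j hj h with rfl | rfl
    · refine ⟨hi _ _ e0 hE0, fun e he => q1 ?_⟩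
      simp only [hC, Set.Finite.mem_toFinset]
      exact ⟨e, he, rfl⟩
    · refine ⟨hi _ _ eN.symm hEN, fun e he => q2 ?_⟩
      simp only [hT, Set.Finite.mem_toFinset]
      exact ⟨e, he, rfl⟩
  · intro x y hxy hx hy
    exact (h2 x y (hE x y hxy hx hy)).mono
      (Set.union_subset_union (hE2 x hx fun _ => ⟨y, hxy, hy⟩) (hE2 y hy fun _ => ⟨x, hxy.symm, hx⟩))
  · intro x y hxy hx hy
    exact h1 _ (hE x y hxy hx hy)

end redpart

end partG

section partH
open Finset

section findpart
variable {V : Type*}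

theorem deg_two_other {H : SimpleGraph V} {v a b c : V} (h : ndeg H v = 2) (ha : H.Adj v a) (hb : H.Adj v b)
    (hc : H.Adj v c) (hba : b ≠ a) (hca : c ≠ a) : b = c := by
  obtain ⟨x, y, hxy, he⟩ := Set.ncard_eq_two.1 h
  have h1 : a ∈ H.neighborSet v := ha
  have h2 : b ∈ H.neighborSet v := hb
  have h3 : c ∈ H.neighborSet v := hc
  rw [he] at h1 h2 h3
  simp at h1 h2 h3
  grind

theorem ndeg_eq_degree [Fintype V] (H : SimpleGraph V) [DecidableRel H.Adj] (v : V) : ndeg H v = H.degree v := by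
  unfold ndeg
  rw [Set.ncard_eq_toFinset_card']
  rfl

theorem walk_back {H : SimpleGraph V} {y y' : ℕ → V} {m : ℕ} (hm : 1 ≤ m)
    (ha : ∀ i, H.Adj (y i) (y (i+1))) (hn : ∀ i, y i ≠ y (i+2))
    (ha' : ∀ i, H.Adj (y' i) (y' (i+1))) (hn' : ∀ i, y' i ≠ y' (i+2))
    (hd : ∀ i, 1 ≤ i → i < m → ndeg H (y i) = 2)
    (e1 : y m = y' m) (e2 : y (m-1) = y' (m-1)) : y 0 = y' 0 ∧ y 1 = y' 1 := by
  have key : ∀ t, t + 1 ≤ m → y (m-t) = y' (m-t) ∧ y (m-t-1) = y' (m-t-1) := by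
    intro t
    induction t with
    | zero => intro _; exact ⟨e1, e2⟩
    | succ t ih =>
      intro ht
      obtain ⟨h1, h2⟩ := ih (by omega)
      refine ⟨h2, ?_⟩
      obtain ⟨k, hk⟩ : ∃ k, m = k + t + 2 := ⟨m - t - 2, by omega⟩
      subst hk
      rw [show k + t + 2 - t = k + 2 by omega] at h1
      rw [show k + t + 2 - t - 1 = k + 1 by omega] at h2
      rw [show k + t + 2 - (t + 1) - 1 = k by omega]
      refine deg_two_other (hd (k+1) (by omega) (by omega)) (ha (k+1)) (ha k).symm ?_ (hn k) ?_
      · rw [h2]; exact (ha' k).symm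
      · rw [h1]; exact hn' k
  obtain ⟨h1, h2⟩ := key (m-1) (by omega)
  rw [show m - (m - 1) = 1 by omega] at h1
  rw [show m - (m - 1) - 1 = 0 by omega] at h2
  exact ⟨h2, h1⟩

theorem thread_exists [Finite V] (H : SimpleGraph V) (K : Finset V) (hsub : ∀ a b, H.Adj a b → a ∈ K)
    (h2 : ∀ v ∈ K, 2 ≤ ndeg H v) {l : ℕ} (hl : 1 ≤ l)
    (hmad : 3 * l * H.edgeSet.ncard < 3 * l * #K + H.edgeSet.ncard) :
    ∃ y : ℕ → V, (∀ i, H.Adj (y i) (y (i+1))) ∧ (∀ i, y i ≠ y (i+2)) ∧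
      ∀ i, 1 ≤ i → i ≤ l → ndeg H (y i) = 2 := by
  classical
  have := Fintype.ofFinite V
  have ho : ∀ v w, ∃ u, v ∈ K → H.Adj v u ∧ u ≠ w := by
    intro v w
    by_cases hv : v ∈ K
    · have : 1 < (H.neighborSet v).ncard := h2 v hv
      obtain ⟨a, ha, haw⟩ := Set.exists_ne_of_one_lt_ncard this w
      exact ⟨a, fun _ => ⟨ha, haw⟩⟩
    · exact ⟨v, fun h => absurd h hv⟩
  choose oth hoth using ho
  let P : V → V → ℕ → V × V := fun v w i => (fun p : V × V => (p.2, oth p.2 p.1))^[i] (w, v)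
  let Y : V → V → ℕ → V := fun v w i => (P v w i).1
  have hP : ∀ v w i, P v w (i+1) = ((P v w i).2, oth (P v w i).2 (P v w i).1) := by
    intro v w i
    simp only [P, Function.iterate_succ_apply']
  have hPa : ∀ v w, H.Adj v w → ∀ i, H.Adj (P v w i).1 (P v w i).2 := by
    intro v w hvw i
    induction i with
    | zero => exact hvw.symm
    | succ i ih =>
      rw [hP]
      exact (hoth _ _ (hsub _ _ ih.symm)).1
  have hY0 : ∀ v w, Y v w 0 = w := fun v w => rfl
  have hY1 : ∀ v w, Y v w 1 = v := fun v w => rfl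
  have hYa : ∀ v w, H.Adj v w → ∀ i, H.Adj (Y v w i) (Y v w (i+1)) := by
    intro v w hvw i
    have := hPa v w hvw i
    simp only [Y, hP]
    exact this
  have hYn : ∀ v w, H.Adj v w → ∀ i, Y v w i ≠ Y v w (i+2) := by
    intro v w hvw i
    have := (hoth (P v w i).2 (P v w i).1 (hsub _ _ (hPa v w hvw i).symm)).2
    simp only [Y, hP]
    exact this.symm
  by_contra hcon
  have hm : ∀ v w, ∃ m, H.Adj v w → 1 ≤ m ∧ m ≤ l ∧ 3 ≤ ndeg H (Y v w m) ∧
      ∀ i, 1 ≤ i → i < m → ndeg H (Y v w i) = 2 := by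
    intro v w
    by_cases hvw : H.Adj v w
    · have hex : ∃ i, 1 ≤ i ∧ i ≤ l ∧ ndeg H (Y v w i) ≠ 2 := by
        by_contra h
        push Not at h
        exact hcon ⟨Y v w, hYa v w hvw, hYn v w hvw, h⟩
      refine ⟨Nat.find hex, fun _ => ?_⟩
      obtain ⟨a1, a2, a3⟩ := Nat.find_spec hex
      refine ⟨a1, a2, ?_, ?_⟩
      · have := h2 _ (hsub _ _ (hYa v w hvw (Nat.find hex)))
        omega
      · intro i hi him
        have := Nat.find_min hex him
        push Not at this
        exact this hi (by omega)
    · exact ⟨0, fun h => absurd h hvw⟩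
  choose m hm using hm
  set K2 := K.filter (fun v => ndeg H v = 2) with hK2
  set K3 := K.filter (fun v => ¬ ndeg H v = 2) with hK3
  set D2 := K2.sigma (fun v => H.neighborFinset v) with hD2
  set D3 := K3.sigma (fun v => H.neighborFinset v) with hD3
  have hcard : #D2 ≤ #(D3 ×ˢ Icc 2 l) := by
    refine Finset.card_le_card_of_injOn
      (fun d => (⟨Y d.1 d.2 (m d.1 d.2), Y d.1 d.2 (m d.1 d.2 - 1)⟩, m d.1 d.2)) ?_ ?_
    · rintro ⟨v, w⟩ hd
      simp only [hD2, hK2, coe_sigma, Set.mem_sigma_iff, Finset.mem_coe, mem_filter, mem_neighborFinset] at hd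
      obtain ⟨⟨hv, hv2⟩, hvw⟩ := hd
      obtain ⟨b1, b2, b3, b4⟩ := hm v w hvw
      have hm2 : 2 ≤ m v w := by
        by_contra h
        have : m v w = 1 := by omega
        rw [this, hY1] at b3
        omega
      simp only [hD3, hK3, Finset.mem_coe, mem_product, mem_sigma, mem_filter, mem_neighborFinset, mem_Icc]
      have hadj := hYa v w hvw (m v w - 1)
      rw [show m v w - 1 + 1 = m v w by omega] at hadj
      exact ⟨⟨⟨hsub _ _ hadj.symm, by omega⟩, hadj.symm⟩, hm2, b2⟩
    · rintro ⟨v, w⟩ hd ⟨v', w'⟩ hd' heq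
      simp only [hD2, hK2, coe_sigma, Set.mem_sigma_iff, Finset.mem_coe, mem_filter, mem_neighborFinset] at hd hd'
      obtain ⟨⟨hv, hv2⟩, hvw⟩ := hd
      obtain ⟨⟨hv', hv2'⟩, hvw'⟩ := hd'
      simp only [Prod.mk.injEq, Sigma.mk.injEq, heq_eq_eq] at heq
      obtain ⟨⟨e1, e2⟩, e3⟩ := heq
      obtain ⟨b1, b2, b3, b4⟩ := hm v w hvw
      rw [← e3] at e1 e2
      obtain ⟨c1, c2⟩ := walk_back b1 (hYa v w hvw) (hYn v w hvw) (hYa v' w' hvw') (hYn v' w' hvw') b4 e1 e2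
      rw [hY0, hY0] at c1
      rw [hY1, hY1] at c2
      rw [c1, c2]
  have hD2c : #D2 = 2 * #K2 := by
    rw [hD2, card_sigma, Finset.sum_congr rfl (g := fun _ => 2)]
    · simp [mul_comm]
    · intro v hv
      rw [card_neighborFinset_eq_degree, ← ndeg_eq_degree]
      exact (mem_filter.1 hv).2
  have hD3c : 3 * #K3 ≤ #D3 := by
    rw [hD3, card_sigma, mul_comm, ← smul_eq_mul]
    apply Finset.card_nsmul_le_sum
    intro v hv
    rw [card_neighborFinset_eq_degree, ← ndeg_eq_degree]
    have := mem_filter.1 hv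
    have := h2 v this.1
    omega
  have hsum : #D2 + #D3 = 2 * H.edgeSet.ncard := by
    have e1 : H.edgeSet.ncard = #H.edgeFinset := by
      rw [Set.ncard_eq_toFinset_card']; rfl
    rw [e1, ← SimpleGraph.sum_degrees_eq_twice_card_edges, hD2, hD3, card_sigma, card_sigma, hK2, hK3,
      Finset.sum_filter_add_sum_filter_not]
    simp only [card_neighborFinset_eq_degree]
    apply Finset.sum_subset (Finset.subset_univ _)
    intro v _ hv
    rw [← ndeg_eq_degree]
    unfold ndeg
    rw [Set.ncard_eq_zero (Set.toFinite _)]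
    ext a
    simp
    exact fun h => hv (hsub _ _ h)
  have hKc : #K2 + #K3 = #K := Finset.card_filter_add_card_filter_not _
  rw [card_product, Nat.card_Icc] at hcard
  obtain ⟨l', rfl⟩ : ∃ l', l = l' + 1 := ⟨l - 1, by omega⟩
  rw [show l' + 1 + 1 - 2 = l' by omega] at hcard
  rw [← hKc] at hmad
  nlinarith

theorem cycle_walk {G : SimpleGraph V} {n : ℕ} (hn : 3 ≤ n) (z : ℕ → V) (hz : z n = z 0)
    (hadj : ∀ i, G.Adj (z i) (z (i+1))) (hinj : ∀ i < n, ∀ k < n, z i = z k → i = k) :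
    ∃ (v : V) (c : G.Walk v v), c.IsCycle ∧ c.length = n := by
  have key : ∀ k < n, ∃ p : G.Walk (z 0) (z k), p.IsPath ∧ p.length = k ∧ (∀ x ∈ p.support, ∃ i ≤ k, x = z i) ∧
      ∀ e ∈ p.edges, ∃ i < k, e = s(z i, z (i+1)) := by
    intro k
    induction k with
    | zero =>
      intro _
      refine ⟨Walk.nil, by simp, by simp, ?_, by simp⟩
      intro x hx
      simp at hx
      exact ⟨0, le_refl _, hx⟩
    | succ k ih =>
      intro hk
      obtain ⟨p, h1, h2, h3, h4⟩ := ih (by omega)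
      refine ⟨p.concat (hadj k), ?_, by simp [h2], ?_, ?_⟩
      · refine h1.concat ?_ _
        intro hmem
        obtain ⟨i, hi, he⟩ := h3 _ hmem
        have := hinj _ hk _ (by omega) he
        omega
      · intro x hx
        rw [Walk.support_concat] at hx
        simp at hx
        rcases hx with hx | hx
        · obtain ⟨i, hi, he⟩ := h3 _ hx
          exact ⟨i, by omega, he⟩
        · exact ⟨k+1, le_refl _, hx⟩
      · intro e he
        rw [Walk.edges_concat] at he
        simp at he
        rcases he with he | he
        · obtain ⟨i, hi, he⟩ := h4 _ he
          exact ⟨i, by omega, he⟩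
        · exact ⟨k, by omega, he⟩
  obtain ⟨p, h1, h2, h3, h4⟩ := key (n-1) (by omega)
  have hlast : G.Adj (z (n-1)) (z 0) := by
    have := hadj (n-1)
    rwa [show n - 1 + 1 = n by omega, hz] at this
  refine ⟨z (n-1), Walk.cons hlast p, ?_, by simp [h2]; omega⟩
  rw [Walk.cons_isCycle_iff]
  refine ⟨h1, fun hmem => ?_⟩
  obtain ⟨i, hi, he⟩ := h4 _ hmem
  rw [Sym2.eq_iff] at he
  rcases he with ⟨a, b⟩ | ⟨a, b⟩
  · have := hinj _ (by omega) _ (by omega) a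
    omega
  · have := hinj _ (by omega) _ (by omega) a
    have := hinj _ (by omega) _ (by omega) b
    omega

end findpart

end partH

section partI
open Finset

section mainpart
variable {V : Type*}

theorem ndeg_pos_of_adj [Finite V] {G : SimpleGraph V} {a b : V} (h : G.Adj a b) : 1 ≤ ndeg G a := by
  have : 0 < (G.neighborSet a).ncard := by
    rw [Set.ncard_pos]; exact ⟨b, h⟩
  exact this

theorem core_red [Finite V] {s : ℕ} {G : SimpleGraph V} (hs : 5 ≤ s) (H : Hyp s G) {a b : V} (hab : G.Adj a b)
    (hno : ¬ ∃ v w u, G.Adj v w ∧ ndeg G w = 1 ∧ G.Adj v u ∧ ∀ a, G.Adj v a → a ≠ u → ndeg G a = 1)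
    (IH : ∀ G', G' ≤ G → G'.edgeSet.ncard < G.edgeSet.ncard → HasCol s G') : HasCol s G := by
  classical
  have := Fintype.ofFinite V
  set K : Finset V := univ.filter (fun v => 2 ≤ ndeg G v) with hK
  have memK : ∀ v, v ∈ K ↔ 2 ≤ ndeg G v := by intro v; simp [hK]
  let C : SimpleGraph V :=
    { Adj := fun x y => G.Adj x y ∧ 2 ≤ ndeg G x ∧ 2 ≤ ndeg G y
      symm := ⟨fun x y h => ⟨h.1.symm, h.2.2, h.2.1⟩⟩
      loopless := ⟨fun x h => G.loopless.irrefl x h.1⟩ }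
  have hC : ∀ x y, C.Adj x y ↔ G.Adj x y ∧ 2 ≤ ndeg G x ∧ 2 ≤ ndeg G y := fun x y => Iff.rfl
  have hleafC : ∀ x y, 2 ≤ ndeg G x → G.Adj x y → C.Adj x y ∨ ndeg G y = 1 := by
    intro x y hx hxy
    have := ndeg_pos_of_adj hxy.symm
    by_cases h : 2 ≤ ndeg G y
    · exact Or.inl ⟨hxy, hx, h⟩
    · right; omega
  have hKne : K.Nonempty := by
    by_contra hcon
    have h1 : ∀ v, ¬ 2 ≤ ndeg G v := by
      intro v hv
      exact hcon ⟨v, (memK v).2 hv⟩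
    have hb : ∀ x y, G.Adj x y → ndeg G x = 1 := by
      intro x y hxy
      have := ndeg_pos_of_adj hxy
      have := h1 x
      omega
    exact hno ⟨a, b, b, hab, hb b a hab.symm, hab, fun c hc _ => hb c a hc.symm⟩
  have hC2 : ∀ v ∈ K, 2 ≤ ndeg C v := by
    intro v hv
    rw [memK] at hv
    by_contra hcon
    have h1 : (C.neighborSet v).ncard ≤ 1 := by unfold ndeg at hcon; omega
    have : ∃ x, C.neighborSet v ⊆ {x} := by
      rcases (C.neighborSet v).eq_empty_or_nonempty with h | ⟨x, hx⟩
      · exact ⟨v, by rw [h]; simp⟩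
      · refine ⟨x, fun y hy => ?_⟩
        exact (Set.ncard_le_one (Set.toFinite _)).1 h1 y hy x hx
    obtain ⟨x, hx⟩ := this
    have hl : ∀ w, G.Adj v w → w ≠ x → ndeg G w = 1 := by
      intro w hw hwx
      rcases hleafC v w hv hw with h | h
      · exact absurd (hx h) hwx
      · exact h
    have : 1 < (G.neighborSet v).ncard := hv
    obtain ⟨w, hw, hwx⟩ := Set.exists_ne_of_one_lt_ncard this x
    by_cases hvx : G.Adj v x
    · exact hno ⟨v, w, x, hw, hl w hw hwx, hvx, hl⟩
    · refine hno ⟨v, w, w, hw, hl w hw hwx, hw, fun c hc _ => hl c hc ?_⟩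
      rintro rfl
      exact hvx hc
  have hmad := H.mad K hKne
  have hCe : {e ∈ G.edgeSet | ∀ v ∈ e, v ∈ K} = C.edgeSet := by
    ext e
    refine Sym2.ind (fun x y => ?_) e
    simp [hC, memK]
  rw [hCe] at hmad
  have hl7 := ell_pos s
  obtain ⟨y, ya, yn, yd⟩ := thread_exists C K (fun x y h => (memK x).2 h.2.1) hC2 (l := ellSigma s) (by omega) hmad
  have yG : ∀ i, G.Adj (y i) (y (i+1)) := fun i => (ya i).1
  have ydeg : ∀ i, 2 ≤ ndeg G (y i) := fun i => (ya i).2.1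
  have two : ∀ x a b w, ndeg C x = 2 → C.Adj x a → C.Adj x b → a ≠ b → G.Adj x w →
      w = a ∨ w = b ∨ ndeg G w = 1 := by
    intro x a b w hx hxa hxb hab hxw
    rcases hleafC x w hxa.2.1 hxw with h | h
    · by_cases hwa : w = a
      · exact Or.inl hwa
      · right; left
        exact deg_two_other hx hxa h hxb hwa hab.symm
    · exact Or.inr (Or.inr h)
  set l := ellSigma s with hl
  by_cases hB : ∃ n, 1 ≤ n ∧ ∃ p, p + n ≤ l + 1 ∧ ¬ (p = 0 ∧ n = l + 1) ∧ y p = y (p + n)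
  · set n := Nat.find hB with hn
    obtain ⟨n1, p, p1, p2, p3⟩ := Nat.find_spec hB
    rw [← hn] at n1 p1 p2 p3
    have hmin : ∀ k, 1 ≤ k → k < n → ∀ q, q + k ≤ l + 1 → ¬ (q = 0 ∧ k = l + 1) → y q ≠ y (q + k) := by
      intro k k1 k2 q q1 q2 q3
      exact Nat.find_min hB k2 ⟨k1, q, q1, q2, q3⟩
    have n3 : 3 ≤ n := by
      by_contra hcon
      have : n = 1 ∨ n = 2 := by omega
      rcases this with h | h
      · rw [h] at p3
        exact (yG p).ne p3
      · rw [h] at p3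
        exact yn p p3
    have nl : n ≤ l := by omega
    have hinj : ∀ i k, i < k → k < n → y (p + i) ≠ y (p + k) := by
      intro i k hik hk
      have := hmin (k - i) (by omega) (by omega) (p + i) (by omega) (by omega)
      rwa [show p + i + (k - i) = p + k by omega] at this
    have hmodlt : ∀ i, i % n < n := fun i => Nat.mod_lt _ (by omega)
    have hstep : ∀ i, y (p + (i+1) % n) = y (p + i % n + 1) := by
      intro i
      by_cases h : i % n + 1 < n
      · rw [Nat.add_mod, Nat.mod_eq_of_lt (show 1 < n by omega), Nat.mod_eq_of_lt h]; rfl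
      · have h1 : i % n + 1 = n := by have := hmodlt i; omega
        have h2 : (i + 1) % n = 0 := by
          rw [Nat.add_mod, Nat.mod_eq_of_lt (show 1 < n by omega), h1, Nat.mod_self]
        rw [h2, Nat.add_assoc, h1, Nat.add_zero, p3]
    set z : ℕ → V := fun i => y (p + i % n) with hz
    have zC : ∀ i, C.Adj (z i) (z (i+1)) := by
      intro i
      simp only [hz, hstep]
      exact ya _
    have zinj : ∀ i < n, ∀ k < n, z i = z k → i = k := by
      intro i hi k hk h
      simp only [hz, Nat.mod_eq_of_lt hi, Nat.mod_eq_of_lt hk] at h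
      rcases lt_trichotomy i k with hik | hik | hik
      · exact absurd h (hinj i k hik hk)
      · exact hik
      · exact absurd h.symm (hinj k i hik hi)
    have zper : ∀ i, z (i + n) = z i := by intro i; simp [hz]
    have zd : ∀ i, ndeg C (z i) = 2 := by
      intro i
      simp only [hz]
      have := hmodlt i
      by_cases h0 : p + i % n = 0
      · have hp0 : p = 0 := by omega
        rw [hp0, Nat.zero_add] at p3
        rw [h0, p3]
        exact yd n n1 nl
      · exact yd _ (by omega) (by omega)
    have zne : ∀ i, z i ≠ z (i+2) := by
      intro i h
      have h1 : (i + 0) % n = (i + 2) % n := by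
        have h' := zinj (i % n) (hmodlt _) ((i+2) % n) (hmodlt _) (by simpa [hz] using h)
        simpa using h'
      have h2 : 0 ≡ 2 [MOD n] := Nat.ModEq.add_left_cancel' i h1
      have := Nat.ModEq.eq_of_lt_of_lt h2 (by omega) (by omega)
      omega
    obtain ⟨v, c, hc, hcl⟩ := cycle_walk (G := G) n3 z (by simpa using zper 0) (fun i => (zC i).1) zinj
    refine cycle_red hs H n3 nl z zper zinj (fun i => (zC i).1) ?_ (fun i => (zC i).2.1) ?_ ?_ IH
    · intro i w hw
      exact two _ _ _ w (zd (i+1)) (zC i).symm (zC (i+1)) (zne i) hw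
    · intro h
      have := H.odd v c hc (by rw [hcl]; exact h)
      rwa [hcl] at this
    · intro h
      have := H.even v c hc (by rw [hcl]; exact h)
      rwa [hcl] at this
  · have hA : ∀ i k, i < k → k ≤ l + 1 → ¬ (i = 0 ∧ k = l + 1) → y i ≠ y k := by
      intro i k hik hk h0 h
      exact hB ⟨k - i, by omega, i, by omega, by omega, by rw [show i + (k - i) = k by omega]; exact h⟩
    refine thread_red hs H hl y ?_ ?_ ?_ (fun j _ => yG j) (fun i _ => yn i) ?_ (fun j _ => ydeg j) IH
    · intro i hi k hk h
      rcases lt_trichotomy i k with hik | hik | hik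
      · exact absurd h (hA _ _ (by omega) (by omega) (by omega))
      · exact hik
      · exact absurd h.symm (hA _ _ (by omega) (by omega) (by omega))
    · intro i hi
      exact hA _ _ (by omega) (by omega) (by omega)
    · intro i hi
      exact (hA _ _ (by omega) (by omega) (by omega)).symm
    · intro i hi w hw
      exact two _ _ _ w (yd (i+1) (by omega) (by omega)) (ya i).symm (ya (i+1)) (yn i) hw

theorem main_col [Finite V] {s : ℕ} (hs : 5 ≤ s) : ∀ (m : ℕ) (G : SimpleGraph V), G.edgeSet.ncard = m →
    Hyp s G → HasCol s G := by
  intro m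
  induction m using Nat.strong_induction_on with
  | _ m ih =>
    intro G hm H
    have IH : ∀ G', G' ≤ G → G'.edgeSet.ncard < G.edgeSet.ncard → HasCol s G' :=
      fun G' h1 h2 => ih _ (by omega) G' rfl (H.mono h1)
    by_cases hno : ∃ v w u, G.Adj v w ∧ ndeg G w = 1 ∧ G.Adj v u ∧ ∀ a, G.Adj v a → a ≠ u → ndeg G a = 1
    · obtain ⟨v, w, u, h1, h2, h3, h4⟩ := hno
      exact leaf_case h1 h2 h3 h4 (H.sum _ _ h3)
        (IH _ (SimpleGraph.deleteEdges_le _) (del_lt (e := s(v, w)) h1 rfl))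
    · by_cases hab : ∃ a b, G.Adj a b
      · obtain ⟨a, b, hab⟩ := hab
        exact core_red hs H hab hno IH
      · push Not at hab
        have : ∀ e, e ∉ G.edgeSet := by
          intro e
          exact Sym2.ind (fun x y h => hab x y h) e
        exact ⟨fun _ => 0, fun e he => absurd he (this e), fun e he => absurd he (this e)⟩

theorem lower_bound [Finite V] {G : SimpleGraph V} {k : ℕ} {φ : Sym2 V → ℕ} (h1 : ∀ e ∈ G.edgeSet, φ e < k)
    (h2 : IsStrongEdgeColoring G φ) {x y : V} (hxy : G.Adj x y) : ndeg G x + ndeg G y - 1 ≤ k := by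
  rw [strong_iff] at h2
  have hi := h2 x y hxy
  have a1 := Set.InjOn.ncard_image hi
  have a2 : Set.image φ (Einc G x ∪ Einc G y) ⊆ (range k : Set ℕ) := by
    rintro _ ⟨e, he, rfl⟩
    have : e ∈ G.edgeSet := by rcases he with he | he <;> exact he.1
    simpa using h1 e this
  have a3 := Set.ncard_le_ncard a2 (Finset.finite_toSet _)
  rw [Set.ncard_coe_finset, card_range, a1] at a3
  have a4 := Set.ncard_union_add_ncard_inter (Einc G x) (Einc G y)
  have a5 : (Einc G x ∩ Einc G y).ncard ≤ 1 := by
    have : Einc G x ∩ Einc G y ⊆ {s(x, y)} := by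
      rintro e ⟨he, he'⟩
      exact (Sym2.mem_and_mem_iff hxy.ne).1 ⟨he.2, he'.2⟩
    simpa using Set.ncard_le_ncard this (Set.toFinite _)
  rw [Einc_ncard, Einc_ncard] at a4
  omega

theorem final_thm [Finite V] (G : SimpleGraph V)
    (h5 : 5 ≤ sigmaG G)
    (hΔ : maxDeg G + 2 ≤ sigmaG G)
    (hodd : ∀ (v : V) (c : G.Walk v v), c.IsCycle → Odd c.length →
      (if sigmaG G = 5 then 9 else sigmaG G) ≤ c.length)
    (heven : ∀ (v : V) (c : G.Walk v v), c.IsCycle → Even c.length → 6 ≤ c.length)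
    (hmad : ∀ H : G.Subgraph, H.verts.Nonempty →
      (2 * H.edgeSet.ncard : ℚ) / (H.verts.ncard : ℚ) <
        2 + 2 / (3 * (ellSigma (sigmaG G) : ℚ) - 1)) :
    strongChromaticIndex G = sigmaG G := by
  classical
  set S : Set ℕ := {m | ∃ x y, G.Adj x y ∧ m = ndeg G x + ndeg G y - 1} with hS
  have hSf : S.Finite := by
    apply (Set.finite_range (fun p : V × V => ndeg G p.1 + ndeg G p.2 - 1)).subset
    rintro m ⟨x, y, -, rfl⟩
    exact ⟨(x, y), rfl⟩
  have hSb : BddAbove S := hSf.bddAbove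
  have hsig : sigmaG G = sSup S := rfl
  have hSn : S.Nonempty := by
    by_contra hcon
    rw [Set.not_nonempty_iff_eq_empty] at hcon
    rw [hsig, hcon] at h5
    simp at h5
  have hH : Hyp (sigmaG G) G := by
    refine ⟨?_, ?_, ?_, ?_, ?_⟩
    · intro v
      have : ndeg G v ≤ maxDeg G := le_csSup (Set.finite_range _).bddAbove ⟨v, rfl⟩
      omega
    · intro x y hxy
      have : ndeg G x + ndeg G y - 1 ≤ sigmaG G := le_csSup hSb ⟨x, y, hxy, rfl⟩
      omega
    · intro v c hc hl
      exact hodd v c hc (Nat.odd_iff.2 hl)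
    · intro v c hc hl
      exact heven v c hc (Nat.even_iff.2 hl)
    · intro T hT
      have h1 := hmad ((⊤ : G.Subgraph).induce (T : Set V)) (by simpa using hT)
      have h2 : ((⊤ : G.Subgraph).induce (T : Set V)).edgeSet = {e ∈ G.edgeSet | ∀ v ∈ e, v ∈ T} := by
        ext e
        refine Sym2.ind (fun x y => ?_) e
        simp
        tauto
      rw [h2] at h1
      rw [Subgraph.induce_verts, Set.ncard_coe_finset] at h1
      set E := {e ∈ G.edgeSet | ∀ v ∈ e, v ∈ T}.ncard
      have hl := ell_pos (sigmaG G)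
      set l := ellSigma (sigmaG G)
      have hT0 : (0 : ℚ) < #T := by exact_mod_cast hT.card_pos
      have hl0 : (7 : ℚ) ≤ l := by exact_mod_cast hl
      have hl1 : (0 : ℚ) < 3 * l - 1 := by linarith
      rw [div_lt_iff₀ hT0] at h1
      have h3 : (2 + 2 / (3 * (l : ℚ) - 1)) * #T * (3 * l - 1) = 6 * l * #T := by
        field_simp
        ring
      have h4 : (2 * E : ℚ) * (3 * l - 1) < 6 * l * #T := by
        rw [← h3]; exact mul_lt_mul_of_pos_right h1 hl1
      have h5 : (3 * l * E : ℚ) < 3 * l * #T + E := by linarith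
      exact_mod_cast h5
  obtain ⟨φ, p1, p2⟩ := main_col h5 _ G rfl hH
  apply le_antisymm
  · exact Nat.sInf_le ⟨φ, p1, p2⟩
  · have hne : {k | ∃ φ : Sym2 V → ℕ, (∀ e ∈ G.edgeSet, φ e < k) ∧ IsStrongEdgeColoring G φ}.Nonempty :=
      ⟨_, φ, p1, p2⟩
    obtain ⟨ψ, q1, q2⟩ := Nat.sInf_mem hne
    obtain ⟨x, y, hxy, he⟩ := Nat.sSup_mem hSn hSb
    rw [hsig, he]
    exact lower_bound q1 q2 hxy

end mainpart

end partI

theorem strongChromaticIndex_eq_sigma_of_mad {V : Type*} [Fintype V] (G : SimpleGraph V)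
    (h5 : 5 ≤ sigmaG G)
    (hΔ : maxDeg G + 2 ≤ sigmaG G)
    (hodd : ∀ (v : V) (c : G.Walk v v), c.IsCycle → Odd c.length →
      (if sigmaG G = 5 then 9 else sigmaG G) ≤ c.length)
    (heven : ∀ (v : V) (c : G.Walk v v), c.IsCycle → Even c.length → 6 ≤ c.length)
    (hmad : ∀ H : G.Subgraph, H.verts.Nonempty →
      (2 * H.edgeSet.ncard : ℚ) / (H.verts.ncard : ℚ) <
        2 + 2 / (3 * (ellSigma (sigmaG G) : ℚ) - 1)) :
    strongChromaticIndex G = sigmaG G := by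
  exact final_thm G h5 hΔ hodd heven hmad
end

section
/- Let G be a finite graph with σ = σ(G) ≥ 4. Suppose every odd cycle of G has length at least (σ+1)/2, and mad(G) < 2 + 2/(3ℓ_{σ+1} − 1), where ℓ_k = 8 if k = 5, ℓ_k = 7 if k ∈ {6,7}, and ℓ_k = k if k ≥ 8. Then σ ≤ χ'_s(G) ≤ σ + 1. -/
open SimpleGraph

open Finset in
lemma pick_overlap {α : Type*} [DecidableEq α] (A A' : Finset α) (x y : ℕ)
    (hx : x ≤ #A) (hy : y ≤ #A') :
    ∃ X ⊆ A, ∃ Y ⊆ A', #X = x ∧ #Y = y ∧ #(X ∩ Y) ≤ x + y - #(A ∪ A') := by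
  have key : ∀ (A B : Finset α) (x : ℕ), x ≤ #A →
      ∃ X ⊆ A, #X = x ∧ ((X ∩ B = ∅) ∨ A \ B ⊆ X) := by
    intro A B x hx
    by_cases h : x ≤ #(A \ B)
    · obtain ⟨X, hX, hc⟩ := exists_subset_card_eq h
      refine ⟨X, hX.trans sdiff_subset, hc, Or.inl ?_⟩
      ext z
      simp only [mem_inter, notMem_empty, iff_false, not_and]
      intro hz
      exact (mem_sdiff.1 (hX hz)).2
    · push Not at h
      obtain ⟨X, h1, h2, h3⟩ := exists_subsuperset_card_eq
        (sdiff_subset : A \ B ⊆ A) h.le hx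
      exact ⟨X, h2, h3, Or.inr h1⟩
  obtain ⟨X, hXA, hXc, hX⟩ := key A A' x hx
  obtain ⟨Y, hYA, hYc, hY⟩ := key A' X y hy
  refine ⟨X, hXA, Y, hYA, hXc, hYc, ?_⟩
  rcases hY with hY | hY
  · rw [inter_comm, hY]; simp
  rcases hX with hX | hX
  · have : X ∩ Y = ∅ := by
      rw [← subset_empty, ← hX]
      exact inter_subset_inter_left hYA
    rw [this]; simp
  have hU : A ∪ A' ⊆ X ∪ Y := by
    intro z hz
    by_cases h1 : z ∈ X
    · exact mem_union_left _ h1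
    by_cases h2 : z ∈ A'
    · exact mem_union_right _ (hY (mem_sdiff.2 ⟨h2, h1⟩))
    · have : z ∈ A := by
        rcases mem_union.1 hz with h | h
        · exact h
        · exact absurd h h2
      exact mem_union_left _ (hX (mem_sdiff.2 ⟨this, h2⟩))
  have h1 := card_le_card hU
  have h2 := card_union_add_card_inter X Y
  omega

open Finset in
lemma pick_two {α : Type*} [DecidableEq α] (X Y : Finset α) (c c' : α)
    (hX : X.Nonempty) (hY : Y.Nonempty) (hne : ∀ z, X = {z} → Y = {z} → False)
    (hc : c ∉ X) (hc' : c' ∉ Y) :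
    ∃ c1 ∈ X, ∃ c2 ∈ Y, c1 ≠ c2 ∧
      (#(((insert c X) ∩ (insert c' Y)) \ {c1, c2}) ≤ 1 ∨
       #(((insert c X) ∩ (insert c' Y)) \ {c1, c2}) + 2 ≤ #((insert c X) ∩ (insert c' Y))) := by
  have two : ∀ (I : Finset α) (p q : α), p ∈ I → q ∈ I → p ≠ q → #(I \ {p, q}) + 2 ≤ #I := by
    intro I p q hp hq hpq
    have hs : ({p, q} : Finset α) ⊆ I := by
      intro z hz
      simp only [mem_insert, mem_singleton] at hz
      rcases hz with rfl | rfl <;> assumption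
    have := card_sdiff_add_card_eq_card hs
    rw [card_pair hpq] at this
    omega
  have other : ∀ z, z ∈ X → z ∈ Y → ∃ c1 ∈ X, ∃ c2 ∈ Y, c1 ≠ c2 ∧ (c1 = z ∨ c2 = z) := by
    intro z hzX hzY
    by_cases h : ∃ x ∈ X, x ≠ z
    · obtain ⟨x, hx, hxz⟩ := h
      exact ⟨x, hx, z, hzY, hxz, Or.inr rfl⟩
    by_cases h' : ∃ y ∈ Y, y ≠ z
    · obtain ⟨y, hy, hyz⟩ := h'
      exact ⟨z, hzX, y, hy, hyz.symm, Or.inl rfl⟩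
    push Not at h h'
    exact (hne z (eq_singleton_iff_unique_mem.2 ⟨hzX, h⟩)
      (eq_singleton_iff_unique_mem.2 ⟨hzY, h'⟩)).elim
  have basic : ∃ c1 ∈ X, ∃ c2 ∈ Y, c1 ≠ c2 := by
    obtain ⟨x, hx⟩ := hX
    obtain ⟨y, hy⟩ := hY
    by_cases h : x = y
    · subst h
      obtain ⟨a, ha, b, hb, hab, _⟩ := other x hx hy
      exact ⟨a, ha, b, hb, hab⟩
    · exact ⟨x, hx, y, hy, h⟩
  set I := (insert c X) ∩ (insert c' Y) with hI
  by_cases h1 : #I ≤ 1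
  · obtain ⟨a, ha, b, hb, hab⟩ := basic
    exact ⟨a, ha, b, hb, hab, Or.inl ((card_le_card sdiff_subset).trans h1)⟩
  have h1' : 1 < #I := by omega
  have memX : ∀ p ∈ I, p ≠ c → p ∈ X := by
    intro p hp hpc
    exact (mem_insert.1 (mem_inter.1 hp).1).resolve_left hpc
  have memY : ∀ p ∈ I, p ≠ c' → p ∈ Y := by
    intro p hp hpc
    exact (mem_insert.1 (mem_inter.1 hp).2).resolve_left hpc
  by_cases hcc : c = c'
  · by_cases h2 : 1 < #(I.erase c)
    · obtain ⟨p, hp, q, hq, hpq⟩ := one_lt_card.1 h2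
      rw [mem_erase] at hp hq
      exact ⟨p, memX p hp.2 hp.1, q, memY q hq.2 (hcc ▸ hq.1), hpq, Or.inr (two I p q hp.2 hq.2 hpq)⟩
    · have h3 := pred_card_le_card_erase (s := I) (a := c)
      obtain ⟨z, hz⟩ : (I.erase c).Nonempty := card_pos.1 (by omega)
      rw [mem_erase] at hz
      obtain ⟨a, ha, b, hb, hab, h⟩ := other z (memX z hz.2 hz.1) (memY z hz.2 (hcc ▸ hz.1))
      refine ⟨a, ha, b, hb, hab, Or.inl ?_⟩
      have h4 : I \ {a, b} ⊆ I.erase z := by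
        intro t ht
        rw [mem_sdiff] at ht
        simp only [mem_insert, mem_singleton, not_or] at ht
        rw [mem_erase]
        refine ⟨?_, ht.1⟩
        rcases h with rfl | rfl
        · exact ht.2.1
        · exact ht.2.2
      have h5 := card_le_card h4
      rw [card_erase_of_mem hz.2] at h5
      omega
  · obtain ⟨p, hp, q, hq, hpq⟩ := one_lt_card.1 h1'
    by_cases h : p ≠ c ∧ q ≠ c'
    · exact ⟨p, memX p hp h.1, q, memY q hq h.2, hpq, Or.inr (two I p q hp hq hpq)⟩
    · have h' : q ≠ c ∧ p ≠ c' := by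
        by_cases hpc : p = c
        · subst hpc; exact ⟨hpq.symm, hcc⟩
        · have : q = c' := by
            by_contra h6; exact h ⟨hpc, h6⟩
          subst this
          exact ⟨fun h => hcc h.symm, hpq⟩
      exact ⟨q, memX q hq h'.1, p, memY p hp h'.2, hpq.symm, Or.inr (two I q p hq hp hpq.symm)⟩

open Finset in
lemma base_three {k : ℕ} (S S' : Finset (Fin k)) (c c' w : Fin k) (hc : c ∈ S) (hc' : c' ∈ S')
    (hcc : c ≠ c') (hw : w ∉ S) (hw' : w ∉ S') (e e' : ℕ) (he : 2 ≤ e) (he' : 2 ≤ e')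
    (h1 : #S + e ≤ k) (h2 : #S' + e' ≤ k)
    (h3 : #((S ∩ S') \ {c, c'}) + e + e' ≤ k + 1) :
    ∃ S1 S2 : Finset (Fin k), #S1 = e ∧ #S2 = e' ∧ S ∩ S1 = {c} ∧ S1 ∩ S2 = {w} ∧
      S2 ∩ S' = {c'} := by
  have cw : c ≠ w := fun h => hw (h ▸ hc)
  have cw' : c' ≠ w := fun h => hw' (h ▸ hc')
  set A := univ \ (S ∪ {w, c'}) with hA
  set A' := univ \ (S' ∪ {w, c}) with hA'
  have card_univ_k : #(univ : Finset (Fin k)) = k := by simp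
  have cA : k - (#S + 2) ≤ #A := by
    have := le_card_sdiff (S ∪ {w, c'}) univ
    rw [← hA] at this
    have h := card_union_le S {w, c'}
    have h' := card_le_two (a := w) (b := c')
    omega
  have cA' : k - (#S' + 2) ≤ #A' := by
    have := le_card_sdiff (S' ∪ {w, c}) univ
    rw [← hA'] at this
    have h := card_union_le S' {w, c}
    have h' := card_le_two (a := w) (b := c)
    omega
  obtain ⟨X, hX, Y, hY, cX, cY, cXY⟩ := pick_overlap A A' (e - 2) (e' - 2) (by omega) (by omega)
  have hU : univ \ (((S ∩ S') \ {c, c'}) ∪ {c, c', w}) ⊆ A ∪ A' := by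
    intro z hz
    simp only [hA, hA', mem_union, mem_sdiff, mem_univ, true_and, mem_inter, mem_insert,
      mem_singleton] at hz ⊢
    tauto
  have hUc : k - (#((S ∩ S') \ {c, c'}) + 3) ≤ #(A ∪ A') := by
    have a1 := card_le_card hU
    have a2 := le_card_sdiff (((S ∩ S') \ {c, c'}) ∪ {c, c', w}) univ
    have a3 := card_union_le ((S ∩ S') \ {c, c'}) {c, c', w}
    have a4 := card_le_three (a := c) (b := c') (c := w)
    omega
  have hdis : X ∩ Y = ∅ := by
    rw [← card_eq_zero]; omega
  have mX : ∀ z ∈ X, z ∉ S ∧ z ≠ w ∧ z ≠ c' := by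
    intro z hz
    have := hX hz
    simp [hA] at this
    tauto
  have mY : ∀ z ∈ Y, z ∉ S' ∧ z ≠ w ∧ z ≠ c := by
    intro z hz
    have := hY hz
    simp [hA'] at this
    tauto
  have hd : ∀ z, z ∈ X → z ∈ Y → False := by
    intro z h1 h2
    have : z ∈ X ∩ Y := mem_inter.2 ⟨h1, h2⟩
    rw [hdis] at this
    exact notMem_empty _ this
  refine ⟨insert c (insert w X), insert c' (insert w Y), ?_, ?_, ?_, ?_, ?_⟩
  · rw [card_insert_of_notMem, card_insert_of_notMem]
    · omega
    · intro h; exact (mX _ h).2.1 rfl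
    · rw [mem_insert, not_or]; exact ⟨cw, fun h => (mX _ h).1 hc⟩
  · rw [card_insert_of_notMem, card_insert_of_notMem]
    · omega
    · intro h; exact (mY _ h).2.1 rfl
    · rw [mem_insert, not_or]; exact ⟨cw', fun h => (mY _ h).1 hc'⟩
  · ext z
    have := mX z
    simp only [mem_inter, mem_insert, mem_singleton]
    constructor
    · rintro ⟨h, h' | h' | h'⟩
      · exact h'
      · subst h'; exact absurd h hw
      · exact absurd h (this h').1
    · rintro rfl; exact ⟨hc, Or.inl rfl⟩
  · ext z
    have a1 := mX z
    have a2 := mY z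
    have a3 := hd z
    simp only [mem_inter, mem_insert, mem_singleton]
    constructor
    · rintro ⟨h | h | h, h' | h' | h'⟩
      · exact absurd (h.symm.trans h') hcc
      · exact h'
      · exact absurd h (a2 h').2.2
      · exact h
      · exact h
      · exact h
      · exact absurd h' (a1 h).2.2
      · exact h'
      · exact (a3 h h').elim
    · rintro rfl; simp
  · ext z
    have := mY z
    simp only [mem_inter, mem_insert, mem_singleton]
    constructor
    · rintro ⟨h' | h' | h', h⟩
      · exact h'
      · subst h'; exact absurd h hw'
      · exact absurd h (this h').1
    · rintro rfl; exact ⟨Or.inl rfl, hc'⟩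

open Finset in
lemma step_round {k : ℕ} (hk : 5 ≤ k) (S S' : Finset (Fin k)) (c c' : Fin k)
    (hc : c ∈ S) (hc' : c' ∈ S') (e e' : ℕ) (he : 2 ≤ e) (he' : 2 ≤ e')
    (h1 : #S + e ≤ k) (h2 : #S' + e' ≤ k) :
    ∃ (S1 S2 : Finset (Fin k)) (c1 c2 w : Fin k), #S1 = e ∧ #S2 = e' ∧ S ∩ S1 = {c} ∧
      S2 ∩ S' = {c'} ∧ c1 ∈ S1 ∧ c2 ∈ S2 ∧ c ≠ c1 ∧ c2 ≠ c' ∧ c1 ≠ c2 ∧ w ∉ S1 ∧ w ∉ S2 ∧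
      (#((S1 ∩ S2) \ {c1, c2}) ≤ 1 ∨
       #((S1 ∩ S2) \ {c1, c2}) + 2 + k ≤ max #((S ∩ S') \ {c, c'}) 1 + e + e') := by
  have card_univ_k : #(univ : Finset (Fin k)) = k := by simp
  set E := #((S ∩ S') \ {c, c'}) with hE
  obtain ⟨w, hwc, hwc', hwE⟩ : ∃ w, w ≠ c ∧ w ≠ c' ∧
      #(((S ∩ S') \ {c, c'}) ∪ {w}) ≤ max E 1 := by
    by_cases h : ((S ∩ S') \ {c, c'}).Nonempty
    · obtain ⟨w, hw⟩ := h
      have hw' := hw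
      simp only [mem_sdiff, mem_insert, mem_singleton, not_or] at hw'
      refine ⟨w, hw'.2.1, hw'.2.2, ?_⟩
      rw [union_eq_left.2 (singleton_subset_iff.2 hw)]
      exact le_max_left _ _
    · rw [not_nonempty_iff_eq_empty] at h
      have : ({c, c'} : Finset (Fin k)) ≠ univ := by
        intro h6
        have := card_le_two (a := c) (b := c')
        rw [h6] at this
        omega
      obtain ⟨w, hw⟩ : ∃ w, w ∉ ({c, c'} : Finset (Fin k)) := by
        by_contra hcon
        push Not at hcon
        exact this (eq_univ_iff_forall.2 hcon)
      simp only [mem_insert, mem_singleton, not_or] at hw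
      refine ⟨w, hw.1, hw.2, ?_⟩
      rw [h]; simp
  set A := univ \ (S ∪ {w}) with hA
  set A' := univ \ (S' ∪ {w}) with hA'
  have cA : k - (#S + 1) ≤ #A := by
    have := le_card_sdiff (S ∪ {w}) univ
    rw [← hA] at this
    have h := card_union_le S {w}
    rw [card_singleton] at h
    omega
  have cA' : k - (#S' + 1) ≤ #A' := by
    have := le_card_sdiff (S' ∪ {w}) univ
    rw [← hA'] at this
    have h := card_union_le S' {w}
    rw [card_singleton] at h
    omega
  obtain ⟨X, hX, Y, hY, cX, cY, cXY⟩ := pick_overlap A A' (e - 1) (e' - 1) (by omega) (by omega)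
  set γ := #(({c, c'} : Finset (Fin k)) ∩ (S ∩ S')) with hγ
  have hU : univ \ ((((S ∩ S') \ {c, c'}) ∪ {w}) ∪ ({c, c'} ∩ (S ∩ S'))) ⊆ A ∪ A' := by
    intro z hz
    simp only [hA, hA', mem_union, mem_sdiff, mem_univ, true_and, mem_inter, mem_insert,
      mem_singleton] at hz ⊢
    tauto
  have hUc : k - (max E 1 + γ) ≤ #(A ∪ A') := by
    have a1 := card_le_card hU
    have a2 := le_card_sdiff ((((S ∩ S') \ {c, c'}) ∪ {w}) ∪ ({c, c'} ∩ (S ∩ S'))) univ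
    have a3 := card_union_le (((S ∩ S') \ {c, c'}) ∪ {w}) ({c, c'} ∩ (S ∩ S'))
    omega
  have mX : ∀ z ∈ X, z ∉ S ∧ z ≠ w := by
    intro z hz
    have := hX hz
    simp [hA] at this
    tauto
  have mY : ∀ z ∈ Y, z ∉ S' ∧ z ≠ w := by
    intro z hz
    have := hY hz
    simp [hA'] at this
    tauto
  have hcX : c ∉ X := fun h => (mX c h).1 hc
  have hcY : c' ∉ Y := fun h => (mY c' h).1 hc'
  have hEγ : E + γ ≤ #S := by
    have a1 := card_sdiff_add_card_inter (S ∩ S') {c, c'}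
    rw [inter_comm (S ∩ S') {c, c'}] at a1
    have a2 : #(S ∩ S') ≤ #S := card_le_card inter_subset_left
    omega
  have hγ2 : γ ≤ 2 := by
    have a1 : γ ≤ #({c, c'} : Finset (Fin k)) := card_le_card inter_subset_left
    exact a1.trans card_le_two
  have hnd : ∀ z, X = {z} → Y = {z} → False := by
    intro z hx hy
    rw [hx, hy, inter_self, card_singleton] at cXY
    rw [hx, card_singleton] at cX
    rw [hy, card_singleton] at cY
    rcases max_cases E 1 with h | h <;> omega
  obtain ⟨c1, hc1, c2, hc2, hne, hcard⟩ := pick_two X Y c c' (card_pos.1 (by omega))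
    (card_pos.1 (by omega)) hnd hcX hcY
  have hI : #((insert c X) ∩ (insert c' Y)) + γ ≤ #(X ∩ Y) + 2 := by
    have hs : (insert c X) ∩ (insert c' Y) ⊆ (X ∩ Y) ∪ (({c, c'} : Finset (Fin k)) \ (S ∩ S')) ∨ c = c' := by
      by_cases hcc : c = c'
      · exact Or.inr hcc
      left
      intro z hz
      have a1 := mX z
      have a2 := mY z
      simp only [mem_union, mem_sdiff, mem_inter, mem_insert, mem_singleton] at hz ⊢
      rcases hz with ⟨h | h, h' | h'⟩
      · exact absurd (h.symm.trans h') hcc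
      · right; exact ⟨Or.inl h, fun h6 => (a2 h').1 h6.2⟩
      · right; exact ⟨Or.inr h', fun h6 => (a1 h).1 h6.1⟩
      · left; exact ⟨h, h'⟩
    rcases hs with hs | hs
    · have a1 := card_le_card hs
      have a2 := card_union_le (X ∩ Y) (({c, c'} : Finset (Fin k)) \ (S ∩ S'))
      have a3 := card_sdiff_add_card_inter ({c, c'} : Finset (Fin k)) (S ∩ S')
      have a4 := card_le_two (a := c) (b := c')
      omega
    · subst hs
      have a0 : (insert c X) ∩ (insert c Y) = insert c (X ∩ Y) := by
        rw [insert_inter_distrib]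
      have a1 : γ ≤ 1 := by
        rw [hγ]
        refine (card_le_card inter_subset_left).trans ?_
        simp
      rw [a0]
      have := card_insert_le c (X ∩ Y)
      omega
  refine ⟨insert c X, insert c' Y, c1, c2, w, ?_, ?_, ?_, ?_, mem_insert_of_mem hc1,
    mem_insert_of_mem hc2, ?_, ?_, hne, ?_, ?_, ?_⟩
  · rw [card_insert_of_notMem hcX]; omega
  · rw [card_insert_of_notMem hcY]; omega
  · ext z
    have := mX z
    simp only [mem_inter, mem_insert, mem_singleton]
    constructor
    · rintro ⟨h, h' | h'⟩
      · exact h'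
      · exact absurd h (this h').1
    · rintro rfl; exact ⟨hc, Or.inl rfl⟩
  · ext z
    have := mY z
    simp only [mem_inter, mem_insert, mem_singleton]
    constructor
    · rintro ⟨h' | h', h⟩
      · exact h'
      · exact absurd h (this h').1
    · rintro rfl; exact ⟨Or.inl rfl, hc'⟩
  · rintro rfl; exact hcX hc1
  · rintro rfl; exact hcY hc2
  · rw [mem_insert, not_or]; exact ⟨hwc, fun h => (mX _ h).2 rfl⟩
  · rw [mem_insert, not_or]; exact ⟨hwc', fun h => (mY _ h).2 rfl⟩
  · rcases hcard with h | h
    · exact Or.inl h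
    · by_cases h0 : #(X ∩ Y) = 0
      · left; omega
      · right; omega

open Finset in
theorem path_ext {k : ℕ} (hk : 5 ≤ k) (R : ℕ) : ∀ (d : ℕ → ℕ) (S S' : Finset (Fin k))
    (c c' : Fin k), c ∈ S → c' ∈ S' → #S = d 0 → #S' = d (2 * R + 3) →
    (∀ i, 0 < i → i < 2 * R + 3 → 2 ≤ d i) →
    (∀ i, i < 2 * R + 3 → d i + d (i + 1) ≤ k) →
    (R = 0 → c ≠ c' ∧ ∃ w, w ∉ S ∧ w ∉ S') →
    (#((S ∩ S') \ {c, c'}) ≤ 2 * R + 1 ∨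
      #((S ∩ S') \ {c, c'}) + k ≤ 2 * R + 1 + #S + #S') →
    ∃ (T : ℕ → Finset (Fin k)) (C : ℕ → Fin k), T 0 = S ∧ T (2 * R + 3) = S' ∧
      C 0 = c ∧ C (2 * R + 2) = c' ∧ (∀ i, i ≤ 2 * R + 3 → #(T i) = d i) ∧
      (∀ i, i < 2 * R + 3 → T i ∩ T (i + 1) = {C i}) ∧
      (∀ i, i < 2 * R + 2 → C i ≠ C (i + 1)) := by
  induction R with
  | zero =>
    intro d S S' c c' hc hc' hS hS' hd2 hdk h0 hE
    obtain ⟨hcc, w, hw, hw'⟩ := h0 rfl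
    have k0 := hdk 0 (by omega)
    have k1 := hdk 1 (by omega)
    have k2 := hdk 2 (by omega)
    simp only [Nat.mul_zero, Nat.zero_add, Nat.reduceAdd] at *
    obtain ⟨S1, S2, a1, a2, a3, a4, a5⟩ := base_three S S' c c' w hc hc' hcc hw hw' (d 1) (d 2)
      (hd2 1 (by omega) (by omega)) (hd2 2 (by omega) (by omega)) (by omega) (by omega) (by omega)
    refine ⟨fun i => if i = 0 then S else if i = 1 then S1 else if i = 2 then S2 else S',
      fun i => if i = 0 then c else if i = 1 then w else c', by simp, by simp, by simp, by simp,
      ?_, ?_, ?_⟩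
    · intro i hi
      interval_cases i <;> simp [*]
    · intro i hi
      interval_cases i <;> simp [*]
    · intro i hi
      interval_cases i
      · simp only [if_true]; rintro rfl; exact hw hc
      · simp; rintro rfl; exact hw' hc'
  | succ R ih =>
    intro d S S' c c' hc hc' hS hS' hd2 hdk h0 hE
    have k0 := hdk 0 (by omega)
    have k1 := hdk (2 * R + 4) (by omega)
    have e3 : 2 * (R + 1) + 3 = 2 * R + 5 := by ring
    have e2 : 2 * (R + 1) + 2 = 2 * R + 4 := by ring
    rw [e3] at hS' hd2 hdk ⊢
    rw [e2]
    rw [Nat.zero_add] at k0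
    rw [show 2 * R + 4 + 1 = 2 * R + 5 from rfl] at k1
    obtain ⟨S1, S2, c1, c2, w, a1, a2, a3, a4, a5, a6, a7, a8, a9, a10, a11, a12⟩ :=
      step_round hk S S' c c' hc hc' (d 1) (d (2 * R + 4)) (hd2 1 (by omega) (by omega))
        (hd2 (2 * R + 4) (by omega) (by omega)) (by omega) (by omega)
    obtain ⟨T, C, b1, b2, b3, b4, b5, b6, b7⟩ := ih (fun i => d (i + 1)) S1 S2 c1 c2 a5 a6 a1 a2
      (fun i h h' => hd2 (i + 1) (by omega) (by omega))
      (fun i h => hdk (i + 1) (by omega)) (fun _ => ⟨a9, w, a10, a11⟩)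
      (by
        rw [a1, a2]
        rcases max_cases #((S ∩ S') \ {c, c'}) 1 with h | h <;>
        rcases a12 with h' | h' <;> rcases hE with h'' | h'' <;> omega)
    refine ⟨fun i => if i = 0 then S else if i = 2 * R + 5 then S' else T (i - 1),
      fun i => if i = 0 then c else if i = 2 * R + 4 then c' else C (i - 1), by simp, by simp,
      by simp, by simp, ?_, ?_, ?_⟩
    · intro i hi
      rcases Nat.eq_zero_or_pos i with rfl | hpos
      · simpa using hS
      by_cases h : i = 2 * R + 5
      · subst h; simpa using hS'
      · have := b5 (i - 1) (by omega)
        simp only [hpos.ne', h, if_false]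
        rw [this]
        congr 1
        omega
    · intro i hi
      rcases Nat.eq_zero_or_pos i with rfl | hpos
      · simp [b1, a3]
      by_cases h : i = 2 * R + 4
      · subst h
        simp [b2, a4]
      · have := b6 (i - 1) (by omega)
        simp only [hpos.ne', h, if_false, Nat.succ_ne_zero, Nat.add_sub_cancel]
        rw [Nat.sub_add_cancel hpos] at this
        rw [if_neg (by omega), if_neg (by omega), this]
    · intro i hi
      rcases Nat.eq_zero_or_pos i with rfl | hpos
      · simp [b3, a7]
      by_cases h : i = 2 * R + 3
      · subst h
        simp [b4, a8]
      · have := b7 (i - 1) (by omega)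
        simp only [hpos.ne', if_false, Nat.succ_ne_zero, Nat.add_sub_cancel]
        rw [Nat.sub_add_cancel hpos] at this
        rw [if_neg (by omega), if_neg (by omega)]
        exact this

/-- A system on `H`: color sets `S v` of size `d v`, adjacent sets meeting exactly in the color of
the edge, and edge colors distinct around each vertex. -/
def IsSystem {V : Type*} (k : ℕ) (d : V → ℕ) (H : SimpleGraph V) (S : V → Finset (Fin k))
    (c : Sym2 V → Fin k) : Prop :=
  (∀ v, (S v).card = d v) ∧ (∀ u v, H.Adj u v → S u ∩ S v = {c s(u, v)}) ∧
  (∀ u v w, H.Adj u v → H.Adj u w → v ≠ w → c s(u, v) ≠ c s(u, w))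

open Finset in
lemma thread_ext {V : Type*} {k : ℕ} (hk : 5 ≤ k) (d : V → ℕ) (H H' : SimpleGraph V)
    (x : ℕ → V) (R : ℕ)
    (hadj : ∀ i, i < 2 * R + 3 → H.Adj (x i) (x (i + 1)))
    (hinj : ∀ i j, 0 < i → i < 2 * R + 3 → j ≤ 2 * R + 3 → x i = x j → i = j)
    (hnb : ∀ i, 0 < i → i < 2 * R + 3 → ∀ y, H.Adj (x i) y → y = x (i - 1) ∨ y = x (i + 1))
    (hd2 : ∀ i, 0 < i → i < 2 * R + 3 → 2 ≤ d (x i))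
    (hdk : ∀ u v, H.Adj u v → d u + d v ≤ k)
    (hH' : ∀ u v, H'.Adj u v ↔ H.Adj u v ∧
      ∀ i, 0 < i → i < 2 * R + 2 → s(u, v) ≠ s(x i, x (i + 1)))
    (S : V → Finset (Fin k)) (c : Sym2 V → Fin k) (hS : IsSystem k d H' S c)
    (hR : R = 0 → c s(x 0, x 1) ≠ c s(x (2 * R + 2), x (2 * R + 3)) ∧
      ∃ w, w ∉ S (x 0) ∧ w ∉ S (x (2 * R + 3)))
    (hE : #((S (x 0) ∩ S (x (2 * R + 3))) \ {c s(x 0, x 1), c s(x (2 * R + 2), x (2 * R + 3))})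
        ≤ 2 * R + 1 ∨
      #((S (x 0) ∩ S (x (2 * R + 3))) \ {c s(x 0, x 1), c s(x (2 * R + 2), x (2 * R + 3))}) + k
        ≤ 2 * R + 1 + #(S (x 0)) + #(S (x (2 * R + 3)))) :
    ∃ S' c', IsSystem k d H S' c' := by
  classical
  obtain ⟨hS1, hS2, hS3⟩ := hS
  have sy : ∀ {i j : ℕ} {u v : V}, s(u, v) = s(x i, x j) → u = x i ∧ v = x j ∨ u = x j ∧ v = x i := by
    intro i j u v h
    simpa using h
  -- non-interior vertices keep their edges
  have non : ∀ u y, (∀ i, 0 < i → i < 2 * R + 3 → u ≠ x i) →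
      ∀ i, 0 < i → i < 2 * R + 2 → s(u, y) ≠ s(x i, x (i + 1)) := by
    intro u y hu i h0 h1 h
    rcases sy h with h | h
    · exact hu i h0 (by omega) h.1
    · exact hu (i + 1) (by omega) (by omega) h.1
  have n0 : ∀ i, 0 < i → i < 2 * R + 3 → x 0 ≠ x i := by
    intro i h0 h1 h
    have := hinj i 0 h0 h1 (by omega) h.symm
    omega
  have nL : ∀ i, 0 < i → i < 2 * R + 3 → x (2 * R + 3) ≠ x i := by
    intro i h0 h1 h
    have := hinj i (2 * R + 3) h0 h1 (by omega) h.symm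
    omega
  have a0 : H'.Adj (x 0) (x 1) := (hH' _ _).2 ⟨hadj 0 (by omega), non _ _ n0⟩
  have aL : H'.Adj (x (2 * R + 3)) (x (2 * R + 2)) :=
    (hH' _ _).2 ⟨(hadj (2 * R + 2) (by omega)).symm, non _ _ nL⟩
  have m0 : c s(x 0, x 1) ∈ S (x 0) := by
    have := hS2 _ _ a0
    have h : c s(x 0, x 1) ∈ S (x 0) ∩ S (x 1) := by rw [this]; simp
    exact (mem_inter.1 h).1
  have mL : c s(x (2 * R + 2), x (2 * R + 3)) ∈ S (x (2 * R + 3)) := by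
    have := hS2 _ _ aL
    have h : c s(x (2 * R + 2), x (2 * R + 3)) ∈ S (x (2 * R + 3)) ∩ S (x (2 * R + 2)) := by
      rw [this, Sym2.eq_swap]; simp
    exact (mem_inter.1 h).1
  obtain ⟨T, C, t1, t2, t3, t4, t5, t6, t7⟩ := path_ext hk R (fun i => d (x i)) (S (x 0))
    (S (x (2 * R + 3))) _ _ m0 mL (hS1 _) (hS1 _) hd2 (fun i hi => hdk _ _ (hadj i hi)) hR hE
  set S' : V → Finset (Fin k) := fun v =>
    if h : ∃ i, (0 < i ∧ i < 2 * R + 3) ∧ v = x i then T h.choose else S v with hS'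
  set c' : Sym2 V → Fin k := fun e =>
    if h : ∃ i, (0 < i ∧ i < 2 * R + 2) ∧ e = s(x i, x (i + 1)) then C h.choose else c e with hc'
  have S'non : ∀ u, (∀ i, 0 < i → i < 2 * R + 3 → u ≠ x i) → S' u = S u := by
    intro u hu
    simp only [hS']
    rw [dif_neg]
    rintro ⟨i, hi, h⟩
    exact hu i hi.1 hi.2 h
  have c'non : ∀ u y, (∀ i, 0 < i → i < 2 * R + 3 → u ≠ x i) → c' s(u, y) = c s(u, y) := by
    intro u y hu
    simp only [hc']
    rw [dif_neg]
    rintro ⟨i, hi, h⟩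
    exact non u y hu i hi.1 hi.2 h
  have S'x : ∀ i, i ≤ 2 * R + 3 → S' (x i) = T i := by
    intro i hi
    by_cases h0 : i = 0
    · subst h0; rw [S'non _ n0, t1]
    by_cases hL : i = 2 * R + 3
    · subst hL; rw [S'non _ nL, t2]
    have hex : ∃ j, (0 < j ∧ j < 2 * R + 3) ∧ x i = x j := ⟨i, ⟨by omega, by omega⟩, rfl⟩
    simp only [hS']
    rw [dif_pos hex]
    have := hex.choose_spec
    exact congrArg T (hinj i hex.choose (by omega) (by omega) (by omega) this.2).symm
  have c'x : ∀ i, i < 2 * R + 3 → c' s(x i, x (i + 1)) = C i := by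
    intro i hi
    by_cases h0 : i = 0
    · subst h0; rw [c'non _ _ n0, t3]
    by_cases hL : i = 2 * R + 2
    · subst hL; rw [Sym2.eq_swap, c'non _ _ nL, t4, Sym2.eq_swap]
    have hex : ∃ j, (0 < j ∧ j < 2 * R + 2) ∧ s(x i, x (i + 1)) = s(x j, x (j + 1)) :=
      ⟨i, ⟨by omega, by omega⟩, rfl⟩
    simp only [hc']
    rw [dif_pos hex]
    have hs := hex.choose_spec
    have : i = hex.choose := by
      rcases sy hs.2 with h | h
      · exact hinj _ _ (by omega) (by omega) (by omega) h.1
      · have q1 := hinj _ _ (by omega) (by omega) (by omega) h.1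
        have q2 := hinj _ _ (by omega) (by omega) (by omega) h.2
        omega
    exact congrArg C this.symm
  have inter : ∀ u v, H.Adj u v → (∃ i, 0 < i ∧ i < 2 * R + 3 ∧ u = x i) →
      S' u ∩ S' v = {c' s(u, v)} := by
    rintro u v huv ⟨i, h0, h1, rfl⟩
    rcases hnb i h0 h1 v huv with rfl | rfl
    · have := t6 (i - 1) (by omega)
      rw [Nat.sub_add_cancel h0] at this
      rw [S'x _ (by omega), S'x _ (by omega), inter_comm, this, Sym2.eq_swap]
      have h2 := c'x (i - 1) (by omega)
      rw [Nat.sub_add_cancel h0] at h2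
      rw [h2]
    · rw [S'x _ (by omega), S'x _ (by omega), t6 i h1, c'x i h1]
  refine ⟨S', c', ?_, ?_, ?_⟩
  · intro v
    by_cases h : ∃ i, 0 < i ∧ i < 2 * R + 3 ∧ v = x i
    · obtain ⟨i, h0, h1, rfl⟩ := h
      rw [S'x _ (by omega), t5 i (by omega)]
    · push Not at h
      rw [S'non v h, hS1]
  · intro u v huv
    by_cases h : ∃ i, 0 < i ∧ i < 2 * R + 3 ∧ u = x i
    · exact inter u v huv h
    by_cases h' : ∃ i, 0 < i ∧ i < 2 * R + 3 ∧ v = x i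
    · rw [inter_comm, Sym2.eq_swap]; exact inter v u huv.symm h'
    push Not at h h'
    rw [S'non u h, S'non v h', c'non u v h]
    exact hS2 u v ((hH' u v).2 ⟨huv, non u v h⟩)
  · intro u v w huv huw hvw
    by_cases h : ∃ i, 0 < i ∧ i < 2 * R + 3 ∧ u = x i
    · obtain ⟨i, h0, h1, rfl⟩ := h
      have e1 : c' s(x i, x (i - 1)) = C (i - 1) := by
        have h2 := c'x (i - 1) (by omega)
        rw [Nat.sub_add_cancel h0] at h2
        rw [Sym2.eq_swap, h2]
      have e2 := c'x i h1
      have e3 := t7 (i - 1) (by omega)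
      rw [Nat.sub_add_cancel h0] at e3
      rcases hnb i h0 h1 v huv with rfl | rfl <;> rcases hnb i h0 h1 w huw with rfl | rfl
      · exact absurd rfl hvw
      · rw [e1, e2]; exact e3
      · rw [e1, e2]; exact e3.symm
      · exact absurd rfl hvw
    · push Not at h
      rw [c'non u v h, c'non u w h]
      exact hS3 u v w ((hH' u v).2 ⟨huv, non u v h⟩) ((hH' u w).2 ⟨huw, non u w h⟩) hvw

open Finset in
lemma find_thread {V : Type*} [Fintype V] [DecidableEq V] (H : SimpleGraph V)
    [DecidableRel H.Adj] (l : ℕ)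
    (hleaf : ∀ v u, H.Adj v u → ∃ y, y ≠ u ∧ H.Adj v y)
    (hcount : (3 * l + 2) * #H.edgeFinset < (3 * l + 3) * #{v | 0 < H.degree v}) :
    ∃ x : ℕ → V, (∀ i, i ≤ l + 1 → H.Adj (x i) (x (i + 1))) ∧
      (∀ i, i ≤ l → x i ≠ x (i + 2)) ∧
      (∀ i, 0 < i → i ≤ l + 1 → ∀ y, H.Adj (x i) y → y = x (i - 1) ∨ y = x (i + 1)) := by
  have hex : ∀ v u, ∃ y, H.Adj v u → y ≠ u ∧ H.Adj v y := by
    intro v u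
    by_cases h : H.Adj v u
    · obtain ⟨y, hy⟩ := hleaf v u h
      exact ⟨y, fun _ => hy⟩
    · exact ⟨v, fun h' => absurd h' h⟩
  choose nx hnx using hex
  set f : V × V → V × V := fun p => (p.2, nx p.2 p.1) with hf
  have deg2 : ∀ v u y z, H.degree v = 2 → H.Adj v u → H.Adj v y → u ≠ y → H.Adj v z →
      z = u ∨ z = y := by
    intro v u y z hd hu hy huy hz
    have hs : ({u, y} : Finset V) ⊆ H.neighborFinset v := by
      intro t ht
      simp only [mem_insert, mem_singleton] at ht
      rw [mem_neighborFinset]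
      rcases ht with rfl | rfl <;> assumption
    have := eq_of_subset_of_card_le hs (by rw [card_pair huy, card_neighborFinset_eq_degree, hd])
    have hz' : z ∈ H.neighborFinset v := by rwa [mem_neighborFinset]
    rw [← this] at hz'
    simpa using hz'
  have degge : ∀ v u, H.Adj v u → 2 ≤ H.degree v := by
    intro v u h
    obtain ⟨y, hyu, hy⟩ := hleaf v u h
    have hs : ({u, y} : Finset V) ⊆ H.neighborFinset v := by
      intro t ht
      simp only [mem_insert, mem_singleton] at ht
      rw [mem_neighborFinset]
      rcases ht with rfl | rfl <;> assumption
    have := card_le_card hs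
    rwa [card_pair hyu.symm, card_neighborFinset_eq_degree] at this
  by_contra hcon
  push Not at hcon
  -- sequence
  have seq : ∀ w v, H.Adj w v → ∃ x : ℕ → V, x 0 = w ∧ x 1 = v ∧
      (∀ i, H.Adj (x i) (x (i + 1))) ∧ (∀ i, x i ≠ x (i + 2)) := by
    intro w v hwv
    have h1 : ∀ i, H.Adj (f^[i] (w, v)).1 (f^[i] (w, v)).2 := by
      intro i
      induction i with
      | zero => exact hwv
      | succ i ih =>
        rw [Function.iterate_succ_apply']
        exact (hnx _ _ ih.symm).2
    have h2 : ∀ i, (f^[i + 1] (w, v)).1 = (f^[i] (w, v)).2 := by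
      intro i
      rw [Function.iterate_succ_apply']
    refine ⟨fun i => (f^[i] (w, v)).1, rfl, rfl, ?_, ?_⟩
    · intro i
      simp only [h2]
      exact h1 i
    · intro i
      simp only
      rw [h2 (i + 1), Function.iterate_succ_apply']
      exact (hnx _ _ (h1 i).symm).1.symm
  set D2 : Finset (V × V) := {p | H.Adj p.1 p.2 ∧ H.degree p.1 = 2} with hD2
  set D3 : Finset (V × V) := {p | H.Adj p.1 p.2 ∧ 3 ≤ H.degree p.1} with hD3
  have hcov : D2 ⊆ (D3 ×ˢ Finset.Icc 1 l).image (fun q => f^[q.2] q.1) := by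
    rintro ⟨v, w⟩ hp
    simp only [hD2, mem_filter, mem_univ, true_and] at hp
    obtain ⟨x, x0, x1, xadj, xnb⟩ := seq w v hp.1.symm
    have hbad : ∃ i, 0 < i ∧ i ≤ l + 1 ∧ H.degree (x i) ≠ 2 := by
      by_contra hno
      push Not at hno
      obtain ⟨i, h0, h1, y, hy, hy1, hy2⟩ := hcon x (fun i _ => xadj i) (fun i _ => xnb i)
      have q1 := xadj (i - 1)
      have q2 := xnb (i - 1)
      rw [show i - 1 + 2 = i + 1 by omega] at q2
      rw [Nat.sub_add_cancel h0] at q1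
      rcases deg2 (x i) _ _ y (hno i h0 h1) q1.symm (xadj i) q2 hy with h | h
      · exact hy1 h
      · exact hy2 h
    classical
    obtain ⟨s0, s1, s2⟩ := Nat.find_spec hbad
    set j := Nat.find hbad with hj
    have hmin : ∀ i, 0 < i → i < j → H.degree (x i) = 2 := by
      intro i h0 h1
      have := Nat.find_min hbad h1
      push Not at this
      exact this h0 (by omega)
    have hj1 : j ≠ 1 := by
      intro h
      rw [h, x1] at s2
      exact s2 hp.2
    have hiter : ∀ t, t + 1 ≤ j → f^[t] (x (t + 1), x t) = (x 1, x 0) := by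
      intro t
      induction t with
      | zero => intro _; rfl
      | succ t ih =>
        intro ht
        rw [Function.iterate_succ_apply]
        have : f (x (t + 1 + 1), x (t + 1)) = (x (t + 1), x t) := by
          simp only [hf]
          have q := hnx (x (t + 1)) (x (t + 1 + 1)) (xadj (t + 1))
          rcases deg2 _ _ _ _ (hmin (t + 1) (by omega) (by omega)) (xadj t).symm (xadj (t + 1))
            (xnb t) q.2 with h | h
          · rw [h]
          · exact absurd h q.1
        rw [this]
        exact ih (by omega)
    rw [mem_image]
    refine ⟨((x j, x (j - 1)), j - 1), ?_, ?_⟩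
    · rw [mem_product]
      have q := xadj (j - 1)
      rw [Nat.sub_add_cancel s0] at q
      have := degge _ _ q.symm
      simp only [hD3, mem_filter, mem_univ, true_and, Finset.mem_Icc]
      exact ⟨⟨q.symm, by omega⟩, by omega, by omega⟩
    · have := hiter (j - 1) (by omega)
      rw [Nat.sub_add_cancel s0, x1, x0] at this
      exact this
  have c1 : #D2 ≤ #D3 * l := by
    refine (card_le_card hcov).trans (card_image_le.trans ?_)
    rw [card_product, Nat.card_Icc]
    simp
  have cardD : ∀ P : V → Prop, ∀ [DecidablePred P],
      #({p | H.Adj p.1 p.2 ∧ P p.1} : Finset (V × V)) = ∑ v with P v, H.degree v := by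
    intro P _
    rw [card_filter, ← univ_product_univ, sum_product, sum_filter]
    refine sum_congr rfl fun v _ => ?_
    by_cases h : P v
    · simp only [h, and_true, if_true]
      rw [← card_filter, ← card_neighborFinset_eq_degree]
      congr 1
      ext y
      simp
    · simp [h]
  have cD2 := cardD (fun v => H.degree v = 2)
  have cD3 := cardD (fun v => 3 ≤ H.degree v)
  rw [← hD2] at cD2
  rw [← hD3] at cD3
  have n2 : ∑ v with H.degree v = 2, H.degree v = 2 * #{v | H.degree v = 2} := by
    rw [sum_congr rfl (g := fun _ => 2) (fun v hv => (mem_filter.1 hv).2)]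
    simp [mul_comm]
  have n3 : 3 * #{v | 3 ≤ H.degree v} ≤ ∑ v with 3 ≤ H.degree v, H.degree v := by
    rw [mul_comm, ← smul_eq_mul]
    exact card_nsmul_le_sum _ _ _ (fun v hv => (mem_filter.1 hv).2)
  have hdich : ∀ v, H.degree v = 0 ∨ H.degree v = 2 ∨ 3 ≤ H.degree v := by
    intro v
    by_cases h : H.degree v = 0
    · exact Or.inl h
    · obtain ⟨u, hu⟩ := (H.degree_pos_iff_exists_adj v).1 (Nat.pos_of_ne_zero h)
      have := degge v u hu
      omega
  have tot : ∑ v, H.degree v = ∑ v with H.degree v = 2, H.degree v +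
      ∑ v with 3 ≤ H.degree v, H.degree v := by
    rw [sum_filter, sum_filter, ← sum_add_distrib]
    refine sum_congr rfl fun v _ => ?_
    rcases hdich v with h | h | h
    · simp [h]
    · simp [h]
    · simp [h, show H.degree v ≠ 2 by omega]
  have nn : #{v | 0 < H.degree v} = #{v | H.degree v = 2} + #{v | 3 ≤ H.degree v} := by
    rw [card_filter, card_filter, card_filter, ← sum_add_distrib]
    refine sum_congr rfl fun v _ => ?_
    rcases hdich v with h | h | h
    · simp [h]
    · simp [h]
    · simp [h, show H.degree v ≠ 2 by omega, show 0 < H.degree v by omega]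
  have hE := H.sum_degrees_eq_twice_card_edges
  rw [tot, ← cD3, n2] at hE
  rw [n2] at cD2
  rw [← cD3] at n3
  rw [nn] at hcount
  rw [cD2] at c1
  generalize #{v | H.degree v = 2} = a at *
  generalize #{v | 3 ≤ H.degree v} = b at *
  generalize #H.edgeFinset = E at *
  generalize #D3 = D at *
  nlinarith

open Finset in
theorem leaf_ext {V : Type*} [Fintype V] {k : ℕ} (d : V → ℕ) (H H' : SimpleGraph V)
    (hdk : ∀ u v, H.Adj u v → d u + d v ≤ k)
    (hdeg : ∀ v (s : Finset V), (∀ y ∈ s, H.Adj v y) → #s ≤ d v)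
    (v u : V) (hvu : H.Adj v u) (hleaf : ∀ y, H.Adj v y → y = u)
    (hH' : ∀ a b, H'.Adj a b ↔ H.Adj a b ∧ s(a, b) ≠ s(v, u))
    (S : V → Finset (Fin k)) (c : Sym2 V → Fin k) (hS : IsSystem k d H' S c) :
    ∃ S' c', IsSystem k d H S' c' := by
  classical
  obtain ⟨hS1, hS2, hS3⟩ := hS
  have hne : v ≠ u := hvu.ne
  -- pick the new color
  obtain ⟨γ, hγ, hγn⟩ : ∃ γ ∈ S u, ∀ y, H'.Adj u y → c s(u, y) ≠ γ := by
    by_contra hcon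
    push Not at hcon
    have hsub : S u ⊆ (univ.filter (fun y => H'.Adj u y)).image (fun y => c s(u, y)) := by
      intro γ hγ
      obtain ⟨y, hy, h⟩ := hcon γ hγ
      exact mem_image.2 ⟨y, by simpa using hy, h⟩
    have h1 := (card_le_card hsub).trans card_image_le
    have hv : v ∉ univ.filter (fun y => H'.Adj u y) := by
      simp only [mem_filter, mem_univ, true_and, hH']
      rintro ⟨_, h⟩
      exact h Sym2.eq_swap
    have h2 := hdeg u (insert v (univ.filter (fun y => H'.Adj u y))) (by
      intro y hy
      rw [mem_insert] at hy
      rcases hy with rfl | hy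
      · exact hvu.symm
      · simp only [mem_filter, mem_univ, true_and, hH'] at hy
        exact hy.1)
    rw [card_insert_of_notMem hv] at h2
    rw [hS1] at h1
    omega
  have hdv : 1 ≤ d v := by
    have := hdeg v {u} (by simpa using hvu)
    simpa using this
  obtain ⟨X, hX, hXc⟩ : ∃ X ⊆ univ \ S u, #X = d v - 1 := by
    apply exists_subset_card_eq
    have h1 := le_card_sdiff (S u) univ
    have h2 : #(univ : Finset (Fin k)) = k := by simp
    have h3 := hdk v u hvu
    rw [hS1] at h1
    omega
  have mX : ∀ z ∈ X, z ∉ S u := fun z hz => (mem_sdiff.1 (hX hz)).2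
  have hγX : γ ∉ X := fun h => mX γ h hγ
  have hinter : insert γ X ∩ S u = {γ} := by
    ext z
    simp only [mem_inter, mem_insert, mem_singleton]
    constructor
    · rintro ⟨h | h, h'⟩
      · exact h
      · exact absurd h' (mX z h)
    · rintro rfl; exact ⟨Or.inl rfl, hγ⟩
  set S' : V → Finset (Fin k) := fun a => if a = v then insert γ X else S a with hS'
  set c' : Sym2 V → Fin k := fun e => if e = s(v, u) then γ else c e with hc'
  have hv' : ∀ a, a ≠ v → S' a = S a := fun a ha => by simp [hS', ha]
  have hvv : S' v = insert γ X := by simp [hS']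
  have hcv : c' s(v, u) = γ := by simp [hc']
  have hcv' : c' s(u, v) = γ := by rw [Sym2.eq_swap]; exact hcv
  have hcn : ∀ a b, a ≠ v → b ≠ v → c' s(a, b) = c s(a, b) := by
    intro a b ha hb
    simp only [hc']
    rw [if_neg]
    intro h
    simp only [Sym2.eq_iff] at h
    rcases h with h | h
    · exact ha h.1
    · exact hb h.2
  have hHn : ∀ a b, a ≠ v → b ≠ v → H.Adj a b → H'.Adj a b := by
    intro a b ha hb hab
    refine (hH' a b).2 ⟨hab, ?_⟩
    intro h
    simp only [Sym2.eq_iff] at h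
    rcases h with h | h
    · exact ha h.1
    · exact hb h.2
  refine ⟨S', c', ?_, ?_, ?_⟩
  · intro a
    by_cases ha : a = v
    · subst ha
      rw [hvv, card_insert_of_notMem hγX]; omega
    · rw [hv' a ha, hS1]
  · intro a b hab
    by_cases ha : a = v
    · subst ha
      have := hleaf b hab
      subst this
      rw [hvv, hv' b hne.symm, hcv, hinter]
    by_cases hb : b = v
    · subst hb
      have := hleaf a hab.symm
      subst this
      rw [hvv, hv' a hne.symm, hcv', inter_comm, hinter]
    rw [hv' a ha, hv' b hb, hcn a b ha hb]
    exact hS2 a b (hHn a b ha hb hab)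
  · intro a b w hab haw hbw
    by_cases ha : a = v
    · subst ha
      exact absurd ((hleaf b hab).trans (hleaf w haw).symm) hbw
    by_cases hb : b = v
    · subst hb
      have := hleaf a hab.symm
      subst this
      rw [hcv', hcn a w ha hbw.symm]
      exact (hγn w (hHn a w ha hbw.symm haw)).symm
    by_cases hw : w = v
    · subst hw
      have := hleaf a haw.symm
      subst this
      rw [hcv', hcn a b ha hbw]
      exact (hγn b (hHn a b ha hbw hab))
    rw [hcn a b ha hb, hcn a w ha hw]
    exact hS3 a b w (hHn a b ha hb hab) (hHn a w ha hw haw) hbw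

/-- Deleting the inner edges of a thread. -/
def cutThread {V : Type*} (H : SimpleGraph V) (x : ℕ → V) (R : ℕ) : SimpleGraph V where
  Adj u v := H.Adj u v ∧ ∀ i, 0 < i → i < 2 * R + 2 → s(u, v) ≠ s(x i, x (i + 1))
  symm := ⟨fun u v h => ⟨h.1.symm, fun i h0 h1 h2 => h.2 i h0 h1 (by rw [Sym2.eq_swap]; exact h2)⟩⟩
  loopless := ⟨fun u h => h.1.ne rfl⟩

lemma cutThread_lt {V : Type*} (H : SimpleGraph V) (x : ℕ → V) (R : ℕ)
    (h : H.Adj (x 1) (x 2)) : cutThread H x R < H := by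
  refine lt_of_le_not_ge (fun u v huv => huv.1) ?_
  intro hle
  exact (hle h).2 1 (by omega) (by omega) rfl

open Finset in
theorem system_exists {V : Type*} [Fintype V] {k : ℕ} (hk : 5 ≤ k) (d : V → ℕ)
    (G : SimpleGraph V)
    (hdk : ∀ u v, G.Adj u v → d u + d v ≤ k) (hd : ∀ v, d v ≤ k)
    (hdeg : ∀ v (s : Finset V), (∀ y ∈ s, G.Adj v y) → #s ≤ d v)
    (hodd : ∀ (x : ℕ → V) (n : ℕ), 3 ≤ n → Odd n → (∀ i, i < n → G.Adj (x i) (x (i + 1))) →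
      x n = x 0 → (∀ i j, i < n → j < n → x i = x j → i = j) → k ≤ 2 * n)
    (hmad : ∀ H ≤ G, ∀ [DecidableRel H.Adj], (∃ u v, H.Adj u v) →
      (3 * (k - 1) + 2) * #H.edgeFinset < (3 * (k - 1) + 3) * #{v | 0 < H.degree v})
    (H : SimpleGraph V) : H ≤ G → ∃ S c, IsSystem k d H S c := by
  classical
  induction H using WellFoundedLT.induction with
  | ind H ih =>
  intro hHG
  have hdkH : ∀ u v, H.Adj u v → d u + d v ≤ k := fun u v h => hdk u v (hHG h)
  have hdegH : ∀ v (s : Finset V), (∀ y ∈ s, H.Adj v y) → #s ≤ d v :=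
    fun v s h => hdeg v s (fun y hy => hHG (h y hy))
  by_cases hE : ∃ u v, H.Adj u v
  swap
  · have : ∀ v, ∃ s : Finset (Fin k), #s = d v := by
      intro v
      obtain ⟨s, _, hs⟩ := exists_subset_card_eq (s := (univ : Finset (Fin k))) (n := d v)
        (by simpa using hd v)
      exact ⟨s, hs⟩
    choose S hS using this
    push Not at hE
    exact ⟨S, fun _ => ⟨0, by omega⟩, hS, fun u v h => absurd h (hE u v),
      fun u v _ h => absurd h (hE u v)⟩
  by_cases hleaf : ∃ v u, H.Adj v u ∧ ∀ y, H.Adj v y → y = u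
  · obtain ⟨v, u, hvu, hl⟩ := hleaf
    have hlt : H.deleteEdges {s(v, u)} < H := by
      refine lt_of_le_not_ge (deleteEdges_le _) ?_
      intro hle
      have := hle hvu
      simp [deleteEdges_adj] at this
    obtain ⟨S, c, hS⟩ := ih _ hlt (hlt.le.trans hHG)
    exact leaf_ext d H _ hdkH hdegH v u hvu hl (fun a b => by simp [deleteEdges_adj]) S c hS
  push Not at hleaf
  obtain ⟨x, xadj, xnb, xdeg⟩ := find_thread H (k - 1)
    (fun v u h => by obtain ⟨y, hy, hyu⟩ := hleaf v u h; exact ⟨y, hyu, hy⟩) (hmad H hHG hE)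
  rw [Nat.sub_add_cancel (by omega)] at xadj xdeg
  have xd2 : ∀ i, 0 < i → i ≤ k → 2 ≤ d (x i) := by
    intro i h0 h1
    have q1 := xadj (i - 1) (by omega)
    have q2 := xnb (i - 1) (by omega)
    rw [show i - 1 + 2 = i + 1 by omega] at q2
    rw [Nat.sub_add_cancel h0] at q1
    have := hdegH (x i) {x (i - 1), x (i + 1)} (by
      intro y hy
      simp only [mem_insert, mem_singleton] at hy
      rcases hy with rfl | rfl
      · exact q1.symm
      · exact xadj i h1)
    rwa [card_pair q2] at this
  by_cases hinj : ∀ i j, i < j → j ≤ k → x i ≠ x j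
  · -- a genuine thread
    set R := (k - 3) / 2 with hR
    have hRk : 2 * R + 3 ≤ k := by omega
    have hlt := cutThread_lt H x R (xadj 1 (by omega))
    obtain ⟨S, c, hS⟩ := ih _ hlt (hlt.le.trans hHG)
    refine thread_ext hk d H (cutThread H x R) x R (fun i hi => xadj i (by omega)) ?_
      (fun i h0 h1 => xdeg i h0 (by omega)) (fun i h0 h1 => xd2 i h0 (by omega)) hdkH
      (fun u v => Iff.rfl) S c hS (by omega) (Or.inl ?_)
    · intro i j h0 h1 h2 h
      rcases lt_trichotomy i j with h3 | h3 | h3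
      · exact absurd h (hinj i j h3 (by omega))
      · exact h3
      · exact absurd h.symm (hinj j i h3 (by omega))
    · have m0 : c s(x 0, x 1) ∈ S (x 0) := by
        have a0 : (cutThread H x R).Adj (x 0) (x 1) := by
          refine ⟨xadj 0 (by omega), fun i h0 h1 h => ?_⟩
          simp only [Sym2.eq_iff] at h
          rcases h with h | h
          · exact hinj 0 i h0 (by omega) h.1
          · exact hinj 0 (i + 1) (by omega) (by omega) h.1
        have := hS.2.1 _ _ a0
        have h : c s(x 0, x 1) ∈ S (x 0) ∩ S (x 1) := by rw [this]; simp
        exact (mem_inter.1 h).1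
      have hs : (S (x 0) ∩ S (x (2 * R + 3))) \
          {c s(x 0, x 1), c s(x (2 * R + 2), x (2 * R + 3))} ⊆ (S (x 0)).erase (c s(x 0, x 1)) := by
        intro z hz
        simp only [mem_sdiff, mem_inter, mem_insert, mem_singleton, not_or] at hz
        exact mem_erase.2 ⟨hz.2.1, hz.1.1⟩
      have h1 := card_le_card hs
      rw [card_erase_of_mem m0, hS.1] at h1
      have h2 := hdkH _ _ (xadj 0 (by omega))
      have h3 := xd2 1 (by omega) (by omega)
      simp only [Nat.zero_add] at h2
      omega
  -- a cycle
  have hex : ∃ j, j ≤ k ∧ ∃ i, i < j ∧ x i = x j := by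
    push Not at hinj
    obtain ⟨i, j, h1, h2, h3⟩ := hinj
    exact ⟨j, h2, i, h1, h3⟩
  obtain ⟨hnk, i, hin, hxi⟩ := Nat.find_spec hex
  set n := Nat.find hex with hn
  have hmin : ∀ a b, a < n → b < n → x a = x b → a = b := by
    have key : ∀ a b, a < b → b < n → x a ≠ x b := by
      intro a b hab hb h
      exact Nat.find_min hex hb ⟨by omega, a, hab, h⟩
    intro a b ha hb h
    rcases lt_trichotomy a b with h3 | h3 | h3
    · exact absurd h (key a b h3 hb)
    · exact h3
    · exact absurd h.symm (key b a h3 ha)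
  have hadjn : H.Adj (x (n - 1)) (x n) := by
    have := xadj (n - 1) (by omega)
    rwa [Nat.sub_add_cancel (by omega)] at this
  have hi1 : i + 1 ≠ n := by
    intro h
    have := xadj i (by omega)
    rw [h, hxi] at this
    exact this.ne rfl
  have hi2 : i + 2 ≠ n := by
    intro h
    have := xnb i (by omega)
    rw [h] at this
    exact this hxi
  have hi0 : i = 0 := by
    by_contra h0
    have h1 : H.Adj (x i) (x (n - 1)) := by rw [hxi]; exact hadjn.symm
    rcases xdeg i (by omega) (by omega) _ h1 with h | h
    · have := hmin _ _ (by omega) (by omega) h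
      omega
    · have := hmin _ _ (by omega) (by omega) h
      omega
  subst hi0
  have hn3 : 3 ≤ n := by omega
  rcases Nat.even_or_odd n with hev | hod
  · -- even cycle
    obtain ⟨r, hr⟩ := hev
    obtain ⟨R, hR⟩ : ∃ R, n = 2 * R + 4 := ⟨r - 2, by omega⟩
    set y : ℕ → V := fun i => x (i + 1) with hy
    have yL : y (2 * R + 3) = x 0 := by
      simp only [hy]; rw [hxi, hR]
    have hlt := cutThread_lt H y R (xadj 2 (by omega))
    obtain ⟨S, c, hS⟩ := ih _ hlt (hlt.le.trans hHG)
    have ncut : ∀ a b, (∀ i, 2 ≤ i → i < n → a ≠ x i) → H.Adj a b → (cutThread H y R).Adj a b := by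
      intro a b ha hab
      refine ⟨hab, fun i h0 h1 h => ?_⟩
      simp only [Sym2.eq_iff, hy] at h
      rcases h with h | h
      · exact ha (i + 1) (by omega) (by omega) h.1
      · exact ha (i + 1 + 1) (by omega) (by omega) h.1
    have nx0 : ∀ i, 2 ≤ i → i < n → x 0 ≠ x i := fun i h h' h'' => by
      have := hmin 0 i (by omega) h' h''; omega
    have nx1 : ∀ i, 2 ≤ i → i < n → x 1 ≠ x i := fun i h h' h'' => by
      have := hmin 1 i (by omega) h' h''; omega
    have b1 : (cutThread H y R).Adj (x 1) (x 0) := ncut _ _ nx1 (xadj 0 (by omega)).symm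
    have b2 : (cutThread H y R).Adj (x 1) (x 2) := ncut _ _ nx1 (xadj 1 (by omega))
    have b3 : (cutThread H y R).Adj (x 0) (x (n - 1)) := by
      refine ncut _ _ nx0 ?_
      rw [hxi]; exact hadjn.symm
    have hI := hS.2.1 _ _ b1
    have hyn : y (2 * R + 2) = x (n - 1) := by
      simp only [hy]; congr 1; omega
    have hyy : ∀ i, i < 2 * R + 3 → y i = x (i + 1) := fun i _ => rfl
    refine thread_ext hk d H (cutThread H y R) y R (fun i hi => xadj (i + 1) (by omega)) ?_
      ?_ (fun i h0 h1 => xd2 (i + 1) (by omega) (by omega)) hdkH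
      (fun u v => Iff.rfl) S c hS ?_ (Or.inl ?_)
    · intro i j h0 h1 h2 h
      by_cases hj : j = 2 * R + 3
      · rw [hj, yL] at h
        exact absurd h.symm (nx0 (i + 1) (by omega) (by omega))
      · have := hmin (i + 1) (j + 1) (by omega) (by omega) h
        omega
    · intro i h0 h1 z hz
      have := xdeg (i + 1) (by omega) (by omega) z hz
      rw [Nat.add_sub_cancel] at this
      simp only [hy]
      rwa [Nat.sub_add_cancel h0]
    · intro _
      rw [yL, hyn]
      refine ⟨?_, ?_⟩
      · intro h
        have h1 : c s(x 1, x 2) ∈ S (x 1) := by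
          have := hS.2.1 _ _ b2
          have h : c s(x 1, x 2) ∈ S (x 1) ∩ S (x 2) := by rw [this]; simp
          exact (mem_inter.1 h).1
        have h2 : c s(x (n - 1), x 0) ∈ S (x 0) := by
          have := hS.2.1 _ _ b3
          have h : c s(x (n - 1), x 0) ∈ S (x 0) ∩ S (x (n - 1)) := by
            rw [this, Sym2.eq_swap]; simp
          exact (mem_inter.1 h).1
        have h3 : c s(x 1, x 2) ∈ S (x 1) ∩ S (x 0) := by
          refine mem_inter.2 ⟨h1, ?_⟩
          have h' : c s(x 1, x 2) = c s(x (n - 1), x 0) := h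
          rw [h']; exact h2
        rw [hI, mem_singleton] at h3
        exact hS.2.2 _ _ _ b2 b1 (xnb 0 (by omega)).symm h3
      · have hc : #(S (x 1) ∪ S (x 0)) < k := by
          have q1 := card_union_add_card_inter (S (x 1)) (S (x 0))
          rw [hI, card_singleton, hS.1, hS.1] at q1
          have q2 := hdkH _ _ (xadj 0 (by omega))
          simp only [Nat.zero_add] at q2
          omega
        by_contra hcon
        push Not at hcon
        have : S (x 1) ∪ S (x 0) = univ := by
          refine eq_univ_iff_forall.2 fun w => ?_
          rw [mem_union]
          by_cases hw : w ∈ S (x 1)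
          · exact Or.inl hw
          · exact Or.inr (hcon w hw)
        rw [this, card_univ, Fintype.card_fin] at hc
        omega
    · rw [yL]
      have : S (y 0) ∩ S (x 0) = {c s(x 1, x 0)} := hI
      rw [this]
      refine (card_le_card sdiff_subset).trans ?_
      rw [card_singleton]; omega
  · -- odd cycle
    have hkn : k ≤ 2 * n := hodd x n hn3 hod (fun i hi => hHG (xadj i (by omega))) hxi.symm hmin
    obtain ⟨r, hr⟩ := hod
    obtain ⟨R, hR⟩ : ∃ R, n = 2 * R + 3 := ⟨r - 1, by omega⟩
    have hlt := cutThread_lt H x R (xadj 1 (by omega))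
    obtain ⟨S, c, hS⟩ := ih _ hlt (hlt.le.trans hHG)
    have nx0 : ∀ i, 0 < i → i < n → x 0 ≠ x i := fun i h h' h'' => by
      have := hmin 0 i (by omega) h' h''; omega
    have ncut : ∀ b, H.Adj (x 0) b → (cutThread H x R).Adj (x 0) b := by
      intro b hab
      refine ⟨hab, fun i h0 h1 h => ?_⟩
      simp only [Sym2.eq_iff] at h
      rcases h with h | h
      · exact nx0 i (by omega) (by omega) h.1
      · exact nx0 (i + 1) (by omega) (by omega) h.1
    have xL : x (2 * R + 3) = x 0 := by rw [hxi, hR]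
    have b1 : (cutThread H x R).Adj (x 0) (x 1) := ncut _ (xadj 0 (by omega))
    have b2 : (cutThread H x R).Adj (x 0) (x (2 * R + 2)) := by
      refine ncut _ ?_
      rw [hxi]
      have := hadjn.symm
      rwa [show n - 1 = 2 * R + 2 by omega] at this
    have hcne : c s(x 0, x 1) ≠ c s(x (2 * R + 2), x 0) := by
      rw [Sym2.eq_swap (a := x (2 * R + 2))]
      refine hS.2.2 _ _ _ b1 b2 fun h => ?_
      have := hmin _ _ (by omega) (by omega) h
      omega
    have hmem : ∀ b, (cutThread H x R).Adj (x 0) b → c s(x 0, b) ∈ S (x 0) := by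
      intro b hb
      have := hS.2.1 _ _ hb
      have h : c s(x 0, b) ∈ S (x 0) ∩ S b := by rw [this]; simp
      exact (mem_inter.1 h).1
    have hm1 := hmem _ b1
    have hm2 := hmem _ b2
    rw [Sym2.eq_swap] at hm2
    have hd0 := hdkH _ _ (xadj 0 (by omega))
    have hd1 := xd2 1 (by omega) (by omega)
    simp only [Nat.zero_add] at hd0
    refine thread_ext hk d H (cutThread H x R) x R (fun i hi => xadj i (by omega)) ?_
      (fun i h0 h1 => xdeg i h0 (by omega)) (fun i h0 h1 => xd2 i h0 (by omega)) hdkH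
      (fun u v => Iff.rfl) S c hS ?_ ?_
    · intro i j h0 h1 h2 h
      by_cases hj : j = 2 * R + 3
      · rw [hj, xL] at h
        exact absurd h.symm (nx0 i (by omega) (by omega))
      · exact hmin i j (by omega) (by omega) h
    · intro _
      rw [xL]
      refine ⟨hcne, ?_⟩
      by_contra hcon
      push Not at hcon
      have : S (x 0) = univ := by
        refine eq_univ_iff_forall.2 fun w => ?_
        by_contra hw
        exact hw (hcon w hw)
      have h1 := hS.1 (x 0)
      rw [this, card_univ, Fintype.card_fin] at h1
      omega
    · rw [xL, inter_self, hS.1]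
      have hs : ({c s(x 0, x 1), c s(x (2 * R + 2), x 0)} : Finset (Fin k)) ⊆ S (x 0) := by
        intro z hz
        simp only [mem_insert, mem_singleton] at hz
        rcases hz with rfl | rfl <;> assumption
      have h1 := card_sdiff_add_card_eq_card hs
      rw [card_pair hcne, hS.1] at h1
      omega

lemma system_strong {V : Type*} {k : ℕ} {d : V → ℕ} {G : SimpleGraph V}
    {S : V → Finset (Fin k)} {c : Sym2 V → Fin k} (h : IsSystem k d G S c) :
    IsStrongEdgeColoring G (fun e => (c e : ℕ)) := by
  obtain ⟨_, h2, h3⟩ := h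
  have mem : ∀ u y, G.Adj u y → c s(u, y) ∈ S u := by
    intro u y hy
    have : c s(u, y) ∈ S u ∩ S y := by rw [h2 u y hy]; simp
    exact (Finset.mem_inter.1 this).1
  have key : ∀ u v y z, G.Adj u v → G.Adj u y → G.Adj v z → c s(u, y) = c s(v, z) →
      s(u, y) = s(v, z) := by
    intro u v y z huv huy hvz he
    have m1 := mem u y huy
    have m2 := mem v z hvz
    have m3 : c s(u, y) ∈ S u ∩ S v := by
      rw [Finset.mem_inter]; exact ⟨m1, he ▸ m2⟩
    rw [h2 u v huv, Finset.mem_singleton] at m3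
    have e1 : y = v := by
      by_contra hne
      exact h3 u y v huy huv hne m3
    have e2 : z = u := by
      by_contra hne
      refine h3 v z u hvz huv.symm hne ?_
      rw [← he, m3, Sym2.eq_swap]
    subst e1; subst e2
    exact Sym2.eq_swap
  rintro e he f hf hne ⟨u, v, hu, hv, huv⟩ heq
  have heq' : c e = c f := Fin.ext heq
  obtain ⟨y, rfl⟩ := hu
  obtain ⟨z, rfl⟩ := hv
  rw [mem_edgeSet] at he hf
  rcases huv with rfl | huv
  · refine hne ?_
    have := key y u u z he.symm he.symm hf (by rw [← heq', Sym2.eq_swap])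
    rw [← this, Sym2.eq_swap]
  · exact hne (key u v y z huv he hf heq')

lemma sigma_bdd {V : Type*} [Fintype V] (G : SimpleGraph V) :
    BddAbove {m | ∃ x y, G.Adj x y ∧ m = ndeg G x + ndeg G y - 1} := by
  apply Set.Finite.bddAbove
  apply (Set.finite_range (fun p : V × V => ndeg G p.1 + ndeg G p.2 - 1)).subset
  rintro m ⟨x, y, _, rfl⟩
  exact ⟨(x, y), rfl⟩

lemma walk_of_seq {V : Type*} {G : SimpleGraph V} (x : ℕ → V) (a m : ℕ)
    (hadj : ∀ i, i < m → G.Adj (x (a + i)) (x (a + i + 1))) :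
    ∃ p : G.Walk (x (a + m)) (x a), p.length = m ∧ p.support = ((List.range (m + 1)).map (fun i => x (a + i))).reverse := by
  induction m with
  | zero => exact ⟨Walk.nil, by simp, by simp⟩
  | succ m ih =>
    obtain ⟨p, h1, h2⟩ := ih (fun i hi => hadj i (by omega))
    refine ⟨Walk.cons (hadj m (by omega)).symm p, by simp [h1], ?_⟩
    rw [Walk.support_cons, h2, List.range_succ (n := m + 1), List.map_append, List.reverse_append]
    simp

lemma cycle_of_seq {V : Type*} {G : SimpleGraph V} (x : ℕ → V) (n : ℕ) (hn : 3 ≤ n)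
    (hadj : ∀ i, i < n → G.Adj (x i) (x (i + 1))) (h0 : x n = x 0)
    (hinj : ∀ i j, i < n → j < n → x i = x j → i = j) :
    ∃ (v : V) (p : G.Walk v v), p.IsCycle ∧ p.length = n := by
  obtain ⟨m, rfl⟩ : ∃ m, n = m + 1 := ⟨n - 1, by omega⟩
  obtain ⟨p, h1, h2⟩ := walk_of_seq (G := G) x 0 m (fun i hi => by simpa using hadj i (by omega))
  have hp : p.IsPath := by
    rw [Walk.isPath_def, h2, List.nodup_reverse]
    refine List.Nodup.map_on ?_ List.nodup_range
    intro i hi j hj hij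
    simp only [List.mem_range, zero_add] at hi hj hij
    exact hinj i j hi hj hij
  have ha : G.Adj (x 0) (x (0 + m)) := by
    have := hadj m (by omega)
    rw [h0] at this
    simpa using this.symm
  refine ⟨x 0, Walk.cons ha p, ?_, by simp [h1]⟩
  rw [Walk.cons_isCycle_iff]
  refine ⟨hp, fun hmem => ?_⟩
  have hl := hp.length_eq_one_of_mem_edges (by rwa [Sym2.eq_swap] at hmem)
  omega

lemma le_ell (k : ℕ) : k ≤ ellSigma k := by
  unfold ellSigma; split_ifs <;> omega

lemma sigma_le_index {V : Type*} [Fintype V] (G : SimpleGraph V) (h4 : 4 ≤ sigmaG G)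
    (k : ℕ) (φ : Sym2 V → ℕ) (hφ : ∀ e ∈ G.edgeSet, φ e < k) (hs : IsStrongEdgeColoring G φ) :
    sigmaG G ≤ k := by
  classical
  have hne : {m | ∃ x y, G.Adj x y ∧ m = ndeg G x + ndeg G y - 1}.Nonempty := by
    by_contra h
    rw [Set.not_nonempty_iff_eq_empty] at h
    have : sigmaG G = 0 := by unfold sigmaG; rw [h]; simp
    omega
  obtain ⟨x, y, hxy, hσ⟩ := Nat.sSup_mem hne (sigma_bdd G)
  have hσ' : sigmaG G = ndeg G x + ndeg G y - 1 := hσ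
  rw [hσ']
  have hnd : ∀ v, ndeg G v = G.degree v := by
    intro v
    unfold ndeg
    rw [← card_neighborFinset_eq_degree, ← Set.ncard_coe_finset, coe_neighborFinset]
  rw [hnd, hnd, ← card_incidenceFinset_eq_degree, ← card_incidenceFinset_eq_degree,
    ← Finset.card_union_add_card_inter]
  have hinter : (G.incidenceFinset x ∩ G.incidenceFinset y).card ≤ 1 := by
    rw [Finset.card_le_one]
    have : ∀ e ∈ G.incidenceFinset x ∩ G.incidenceFinset y, e = s(x, y) := by
      intro e he
      simp only [Finset.mem_inter, mem_incidenceFinset, incidenceSet, Set.mem_ofPred_eq] at he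
      exact (Sym2.mem_and_mem_iff hxy.ne).1 ⟨he.1.2, he.2.2⟩
    intro a ha b hb
    rw [this a ha, this b hb]
  have hle : (G.incidenceFinset x ∪ G.incidenceFinset y).card ≤ (Finset.range k).card := by
    have hm : ∀ e ∈ G.incidenceFinset x ∪ G.incidenceFinset y,
        e ∈ G.edgeSet ∧ (x ∈ e ∨ y ∈ e) := by
      intro e he
      simp only [Finset.mem_union, mem_incidenceFinset, incidenceSet, Set.mem_ofPred_eq] at he
      tauto
    refine Finset.card_le_card_of_injOn φ ?_ ?_
    · intro e he
      simpa using hφ e (hm e he).1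
    · intro e he f hf hef
      by_contra hne
      obtain ⟨he1, he2⟩ := hm e he
      obtain ⟨hf1, hf2⟩ := hm f hf
      refine hs e he1 f hf1 hne ?_ hef
      rcases he2 with he2 | he2 <;> rcases hf2 with hf2 | hf2
      · exact ⟨x, x, he2, hf2, Or.inl rfl⟩
      · exact ⟨x, y, he2, hf2, Or.inr hxy⟩
      · exact ⟨y, x, he2, hf2, Or.inr hxy.symm⟩
      · exact ⟨y, y, he2, hf2, Or.inl rfl⟩
  rw [Finset.card_range] at hle
  omega

lemma mad_count {V : Type*} [Fintype V] (G : SimpleGraph V) (k l : ℕ) (hk : 5 ≤ k) (hl : k ≤ l)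
    (hmad : ∀ H : G.Subgraph, H.verts.Nonempty →
      (2 * H.edgeSet.ncard : ℚ) / (H.verts.ncard : ℚ) < 2 + 2 / (3 * (l : ℚ) - 1))
    (H : SimpleGraph V) (hH : H ≤ G) [DecidableRel H.Adj] (he : ∃ u v, H.Adj u v) :
    (3 * (k - 1) + 2) * H.edgeFinset.card <
      (3 * (k - 1) + 3) * (Finset.univ.filter (fun v => 0 < H.degree v)).card := by
  classical
  let K : G.Subgraph :=
    { verts := {v | 0 < H.degree v}
      Adj := H.Adj
      adj_sub := fun h => hH h
      edge_vert := fun {v w} h => by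
        rw [Set.mem_ofPred_eq, degree_pos_iff_exists_adj]; exact ⟨w, h⟩
      symm := H.symm }
  have hv : K.verts.ncard = (Finset.univ.filter (fun v => 0 < H.degree v)).card := by
    rw [← Set.ncard_coe_finset]; congr 1; ext v; simp [K]
  have hE : K.edgeSet.ncard = H.edgeFinset.card := by
    rw [← Set.ncard_coe_finset]; congr 1; ext e
    induction e with | _ a b => simp [K]
  obtain ⟨u, v, huv⟩ := he
  have hne : K.verts.Nonempty := ⟨u, K.edge_vert huv⟩
  have h := hmad K hne
  have hpos : 0 < K.verts.ncard := (Set.ncard_pos (Set.toFinite _)).2 hne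
  rw [hv] at h hpos
  rw [hE] at h
  generalize H.edgeFinset.card = E at *
  generalize (Finset.univ.filter (fun v => 0 < H.degree v)).card = n at *
  have hn : (0 : ℚ) < n := by exact_mod_cast hpos
  have hkl : (k : ℚ) ≤ l := by exact_mod_cast hl
  have hk5 : (5 : ℚ) ≤ k := by exact_mod_cast hk
  have h2 : (2 : ℚ) / (3 * l - 1) ≤ 2 / (3 * k - 1) := by
    apply div_le_div_of_nonneg_left <;> linarith
  have h3 : (2 * E : ℚ) / n < 2 + 2 / (3 * k - 1) := lt_of_lt_of_le h (by linarith)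
  have hkp : (0 : ℚ) < 3 * k - 1 := by linarith
  have h4 : (2 : ℚ) + 2 / (3 * k - 1) = 6 * k / (3 * k - 1) := by field_simp; ring
  rw [h4, div_lt_div_iff₀ hn hkp] at h3
  obtain ⟨j, rfl⟩ : ∃ j, k = j + 1 := ⟨k - 1, by omega⟩
  simp only [Nat.add_sub_cancel]
  have : ((3 * j + 2 : ℕ) * E : ℚ) < (3 * j + 3 : ℕ) * n := by
    push_cast at h3 ⊢
    linarith
  exact_mod_cast this

theorem strongChromaticIndex_le_sigma_succ_of_mad {V : Type*} [Fintype V] (G : SimpleGraph V)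
    (h4 : 4 ≤ sigmaG G)
    (hodd : ∀ (v : V) (c : G.Walk v v), c.IsCycle → Odd c.length →
      ((sigmaG G : ℚ) + 1) / 2 ≤ (c.length : ℚ))
    (hmad : ∀ H : G.Subgraph, H.verts.Nonempty →
      (2 * H.edgeSet.ncard : ℚ) / (H.verts.ncard : ℚ) <
        2 + 2 / (3 * (ellSigma (sigmaG G + 1) : ℚ) - 1)) :
    sigmaG G ≤ strongChromaticIndex G ∧ strongChromaticIndex G ≤ sigmaG G + 1 := by
  have hdk : ∀ u v, G.Adj u v → ndeg G u + ndeg G v ≤ sigmaG G + 1 := by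
    intro u v huv
    have : ndeg G u + ndeg G v - 1 ≤ sigmaG G := le_csSup (sigma_bdd G) ⟨u, v, huv, rfl⟩
    omega
  have hd : ∀ v, ndeg G v ≤ sigmaG G + 1 := by
    intro v
    by_cases h : ∃ w, G.Adj v w
    · obtain ⟨w, hw⟩ := h
      have := hdk v w hw
      omega
    · have : G.neighborSet v = ∅ := by
        ext w; simp only [mem_neighborSet, Set.mem_empty_iff_false, iff_false]
        exact fun hw => h ⟨w, hw⟩
      unfold ndeg
      rw [this]; simp
  obtain ⟨S, c, hS⟩ := system_exists (k := sigmaG G + 1) (by omega) (ndeg G) G hdk hd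
    (by
      intro v s hs
      unfold ndeg
      rw [← Set.ncard_coe_finset]
      exact Set.ncard_le_ncard (fun y hy => hs y hy) (Set.toFinite _))
    (by
      intro x n hn ho hadj h0 hinj
      obtain ⟨v, p, hp, hl⟩ := cycle_of_seq x n hn hadj h0 hinj
      have := hodd v p hp (by rwa [hl])
      rw [hl] at this
      have h' : ((sigmaG G + 1 : ℕ) : ℚ) ≤ (2 * n : ℕ) := by push_cast; linarith
      exact_mod_cast h')
    (by
      intro H hH _ he
      exact mad_count G (sigmaG G + 1) _ (by omega) (le_ell _) hmad H hH he)
    G le_rfl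
  have hmem : sigmaG G + 1 ∈ {k | ∃ φ : Sym2 V → ℕ,
      (∀ e ∈ G.edgeSet, φ e < k) ∧ IsStrongEdgeColoring G φ} :=
    ⟨fun e => (c e : ℕ), fun e _ => (c e).isLt, system_strong hS⟩
  refine ⟨?_, Nat.sInf_le hmem⟩
  obtain ⟨φ, h1, h2⟩ := Nat.sInf_mem ⟨_, hmem⟩
  exact sigma_le_index G h4 _ φ h1 h2
end
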